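/- Let K be a number field. Assume the Riemann hypothesis for ζ_K, that all nontrivial zeros of ζ_K are simple, and that there exists a constant C > 0 such that 1/|ρ ζ_K'(ρ)| ≤ C for every nontrivial zero ρ of ζ_K. Then for every x > 0, the number (M_K(x) + M_K^*(x))/x^{1/2} is a limit point of the function t ↦ M_K(t)/t^{1/2} as t → ∞; that is, there exists a sequence t_j → ∞ with M_K(t_j)/t_j^{1/2} → (M_K(x) + M_K^*(x))/x^{1/2}. -/

import Mathlib

noncomputable section

open NumberField Filter Topology MeasureTheory Complex

open scoped Classical

/-- The Möbius function on integral ideals of a number field `K`. -/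
def moebiusK (K : Type) [Field K] [NumberField K] (I : Ideal (𝓞 K)) : ℤ :=
  if Squarefree I then (-1) ^ (UniqueFactorizationMonoid.factors I).card else 0

/-- The Mertens function of a number field `K`: the sum of `μ_K(𝔞)` over nonzero integral
ideals `𝔞` of norm at most `x`, where ideals of norm exactly `x` count with weight `1/2`. -/
def mertensK (K : Type) [Field K] [NumberField K] (x : ℝ) : ℝ :=
  ∑' I : Ideal (𝓞 K),
    if I ≠ ⊥ ∧ (Ideal.absNorm I : ℝ) < x then (moebiusK K I : ℝ)
    else if I ≠ ⊥ ∧ (Ideal.absNorm I : ℝ) = x then (moebiusK K I : ℝ) / 2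
    else 0

/-- `M_K^- = liminf_{x → ∞} M_K(x) / x^{1/2}`, as an extended real number. -/
def MKminus (K : Type) [Field K] [NumberField K] : EReal :=
  Filter.liminf (fun x : ℝ => ((mertensK K x / Real.sqrt x : ℝ) : EReal)) Filter.atTop

/-- `M_K^+ = limsup_{x → ∞} M_K(x) / x^{1/2}`, as an extended real number. -/
def MKplus (K : Type) [Field K] [NumberField K] : EReal :=
  Filter.limsup (fun x : ℝ => ((mertensK K x / Real.sqrt x : ℝ) : EReal)) Filter.atTop

/-- The naïve Mertens-type conjecture over `K`: `-1 ≤ M_K^- ≤ M_K^+ ≤ 1`. -/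
def NaiveMertensConj (K : Type) [Field K] [NumberField K] : Prop :=
  -1 ≤ MKminus K ∧ MKminus K ≤ MKplus K ∧ MKplus K ≤ 1

/-- A predicate identifying the Dedekind zeta function of `K`: a function analytic away
from `s = 1` agreeing with the Dirichlet series `∑ N(𝔞)^{-s}` on `Re s > 1`. -/
def IsDedekindZeta (K : Type) [Field K] [NumberField K] (Z : ℂ → ℂ) : Prop :=
  (∀ s : ℂ, s ≠ 1 → DifferentiableAt ℂ Z s) ∧
  ∀ s : ℂ, 1 < s.re →
    Z s = ∑' I : {I : Ideal (𝓞 K) // I ≠ ⊥}, (Ideal.absNorm I.1 : ℂ) ^ (-s)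

/-- The Riemann hypothesis for a zeta function `Z`: all nontrivial zeros lie on `Re s = 1/2`. -/
def ZetaRH (Z : ℂ → ℂ) : Prop :=
  ∀ ρ : ℂ, Z ρ = 0 → 0 < ρ.re → ρ.re < 1 → ρ.re = 1 / 2

/-- `r` is the residue of `f` at `c`: for all sufficiently small radii `R > 0`, the
circle integral of `f` around `c` equals `2πi r`. -/
def IsResidue (f : ℂ → ℂ) (c r : ℂ) : Prop :=
  ∀ᶠ R in 𝓝[>] (0 : ℝ), (∮ z in C(c, R), f z) = 2 * Real.pi * Complex.I * r

section Poisson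

variable {ι : Type*} [Fintype ι]

lemma summable_exp_neg_mul_sq_norm_int (a : ℝ) (ha : 0 < a) :
    Summable fun k : ι → ℤ => Real.exp (-a * ‖(fun i => (k i : ℝ))‖ ^ 2) := by
  set L := Submodule.span ℤ (Set.range (Pi.basisFun ℝ ι)) with hL
  set m := Module.finrank ℤ L + 1 with hm
  have h1 := ZLattice.summable_norm_zpow L (-(m : ℤ)) (by rw [hm]; push_cast; linarith)
  have hmem : ∀ k : ι → ℤ, (fun i => (k i : ℝ)) ∈ L := by
    intro k
    have : (fun i => (k i : ℝ)) = ∑ i, k i • (Pi.basisFun ℝ ι i) := by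
      ext j
      simp [Finset.sum_apply, Pi.single_apply]
    rw [this]
    exact Submodule.sum_mem _ fun i _ =>
      Submodule.smul_mem _ _ (Submodule.subset_span (Set.mem_range_self i))
  have hinj : Function.Injective (fun k : ι → ℤ => (⟨fun i => (k i : ℝ), hmem k⟩ : L)) := by
    intro k k' h
    funext i
    have := congrFun (congrArg Subtype.val h) i
    simpa using this
  have h2 := (h1.comp_injective hinj).mul_left (m.factorial / a ^ m)
  refine Summable.of_norm_bounded_eventually h2 ?_
  refine (Set.finite_singleton (0 : ι → ℤ)).subset ?_
  intro k hk
  by_contra hk0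
  apply hk
  have hk0 : k ≠ 0 := hk0
  obtain ⟨i, hi⟩ := Function.ne_iff.mp hk0
  have ht : (1 : ℝ) ≤ ‖(fun i => (k i : ℝ))‖ := by
    refine le_trans ?_ (norm_le_pi_norm _ i)
    rw [Real.norm_eq_abs]
    exact_mod_cast Int.one_le_abs hi
  simp only [Function.comp_def]
  change ‖Real.exp (-a * ‖(fun i => (k i : ℝ))‖ ^ 2)‖ ≤ m.factorial / a ^ m * ‖(fun i => (k i : ℝ))‖ ^ (-(m : ℤ))
  set t := ‖(fun i => (k i : ℝ))‖
  rw [Real.norm_eq_abs, abs_of_pos (Real.exp_pos _), neg_mul, Real.exp_neg, zpow_neg, zpow_natCast]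
  have h3 : (a * t ^ 2) ^ m / m.factorial ≤ Real.exp (a * t ^ 2) :=
    Real.pow_div_factorial_le_exp _ (by positivity) _
  have h4 : a ^ m * t ^ m / m.factorial ≤ Real.exp (a * t ^ 2) := by
    refine le_trans ?_ h3
    rw [← mul_pow]
    gcongr
    nlinarith
  have ht0 : 0 < t := by linarith
  rw [inv_le_comm₀ (Real.exp_pos _) (by positivity)]
  refine le_trans (le_of_eq ?_) h4
  field_simp

theorem poisson_pi (f : (ι → ℝ) → ℂ) (hf : Continuous f) (hint : Integrable f)
    (B : (ι → ℝ) → ℝ) (hB : Continuous B) (u : (ι → ℤ) → ℝ) (hu : Summable u) (hu0 : ∀ k, 0 ≤ u k)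
    (hfB : ∀ x k, ‖f (fun i => x i + k i)‖ ≤ B x * u k)
    (hsum : Summable fun n : ι → ℤ => ∫ x : ι → ℝ, cexp (-(2 * Real.pi * I * ∑ i, (n i : ℂ) * x i)) * f x) :
    ∑' k : ι → ℤ, f (fun i => k i) =
      ∑' n : ι → ℤ, ∫ x : ι → ℝ, cexp (-(2 * Real.pi * I * ∑ i, (n i : ℂ) * x i)) * f x := by
  set G : (ι → ℝ) → ℂ := fun x => ∑' k : ι → ℤ, f (fun i => x i + k i) with hG
  have hGc : Continuous G := by
    rw [continuous_iff_continuousAt]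
    intro x₀
    have ho : IsOpen {x | B x < B x₀ + 1} := isOpen_lt hB continuous_const
    refine ContinuousOn.continuousAt (s := {x | B x < B x₀ + 1}) ?_ (ho.mem_nhds (by simp))
    refine continuousOn_tsum (u := fun k => (B x₀ + 1) * u k)
      (fun k => (hf.comp (by fun_prop)).continuousOn) (hu.mul_left _) ?_
    intro k x hx
    refine (hfB x k).trans ?_
    have : B x < B x₀ + 1 := hx
    exact mul_le_mul_of_nonneg_right this.le (hu0 k)
  have hper : ∀ (x : ι → ℝ) (m : ι → ℤ), G (fun i => x i + m i) = G x := by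
    intro x m
    simp only [hG]
    rw [← (Equiv.addLeft (-m)).tsum_eq]
    refine tsum_congr fun k => ?_
    congr 1
    funext i
    simp
  set q : (ι → ℝ) → UnitAddTorus ι := fun x i => (x i : UnitAddCircle) with hq
  have hqo : IsOpenQuotientMap q :=
    IsOpenQuotientMap.piMap (fun _ => QuotientAddGroup.isOpenQuotientMap_mk)
  set g : UnitAddTorus ι → ℂ := fun y => G (fun i => Quotient.out (y i)) with hg
  have hgq : ∀ x, g (q x) = G x := by
    intro x
    have : ∀ i, ∃ m : ℤ, Quotient.out (q x i) = x i + m := by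
      intro i
      have h1 : ((Quotient.out (q x i) : ℝ) : UnitAddCircle) = (x i : UnitAddCircle) :=
        Quotient.out_eq _
      rw [← sub_eq_zero, ← AddCircle.coe_sub, AddCircle.coe_eq_zero_iff] at h1
      obtain ⟨m, hm⟩ := h1
      refine ⟨m, ?_⟩
      rw [zsmul_eq_mul, mul_one] at hm
      linarith
    choose m hm using this
    simp only [hg, hm]
    exact hper x m
  have hgc : Continuous g := by
    rw [hqo.isQuotientMap.continuous_iff]
    exact hGc.congr fun x => (hgq x).symm
  have hcoef : ∀ n, UnitAddTorus.mFourierCoeff g n =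
      ∫ x : ι → ℝ, cexp (-(2 * Real.pi * I * ∑ i, (n i : ℂ) * x i)) * f x := by
    intro n
    rw [UnitAddTorus.mFourierCoeff_eq_integral g n 0]
    set h : (ι → ℝ) → ℂ := fun x => cexp (-(2 * Real.pi * I * ∑ i, (n i : ℂ) * x i)) * f x with hh
    have hexp : ∀ x : ι → ℝ, ‖cexp (-(2 * Real.pi * I * ∑ i, (n i : ℂ) * x i))‖ = 1 := by
      intro x
      have : -(2 * Real.pi * I * ∑ i, (n i : ℂ) * x i) = ((-(2 * Real.pi * ∑ i, n i * x i : ℝ) : ℝ) : ℂ) * I := by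
        push_cast; ring
      rw [this, norm_exp_ofReal_mul_I]
    have hcont : Continuous fun x : ι → ℝ => cexp (-(2 * Real.pi * I * ∑ i, (n i : ℂ) * x i)) := by fun_prop
    have hhint : Integrable h := hint.bdd_mul hcont.aestronglyMeasurable (c := 1)
      (Eventually.of_forall fun x => (hexp x).le)
    have hhshift : ∀ (x : ι → ℝ) (k : ι → ℤ), h (fun i => x i + k i) =
        cexp (-(2 * Real.pi * I * ∑ i, (n i : ℂ) * x i)) * f (fun i => x i + k i) := by
      intro x k
      simp only [hh]
      congr 1
      push_cast
      simp only [mul_add, Finset.sum_add_distrib, neg_add, Complex.exp_add]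
      rw [mul_eq_left₀ (Complex.exp_ne_zero _)]
      rw [Complex.exp_eq_one_iff]
      refine ⟨-∑ i, n i * k i, ?_⟩
      push_cast
      ring
    set S : Set (ι → ℝ) := {x | ∀ i, x i ∈ Set.Ioc ((0 : ι → ℝ) i) ((0 : ι → ℝ) i + 1)} with hS
    have hSm : MeasurableSet S := by
      have : S = Set.univ.pi fun i => Set.Ioc (0 : ℝ) (0 + 1) := by ext; simp [hS]
      rw [this]
      exact MeasurableSet.univ_pi fun i => measurableSet_Ioc
    have hScl : S ⊆ Set.Icc 0 1 := fun x hx =>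
      ⟨fun i => (hx i).1.le, fun i => by simpa using (hx i).2⟩
    have hSfin : volume S ≠ ⊤ := by
      refine ne_top_of_le_ne_top ?_ (measure_mono hScl)
      exact isCompact_Icc.measure_lt_top.ne
    have hBint : IntegrableOn B S := (hB.continuousOn.integrableOn_compact isCompact_Icc).mono_set hScl
    set T : (ι → ℤ) → Set (ι → ℝ) := fun k => (fun x i => x i - k i) ⁻¹' S with hT
    have hTm : ∀ k, MeasurableSet (T k) := fun k => by
      refine hSm.preimage ?_
      fun_prop
    have hTd : Pairwise (Function.onFun Disjoint T) := by
      intro k k' hkk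
      rw [Function.onFun, Set.disjoint_left]
      intro x hx hx'
      apply hkk
      funext i
      have h1 := hx i
      have h2 := hx' i
      simp only [Pi.zero_apply, zero_add, Set.mem_Ioc] at h1 h2
      have h3 : (k i : ℝ) < k' i + 1 := by linarith
      have h4 : (k' i : ℝ) < k i + 1 := by linarith
      have h3' : k i < k' i + 1 := by exact_mod_cast h3
      have h4' : k' i < k i + 1 := by exact_mod_cast h4
      omega
    have hTu : (⋃ k, T k) = Set.univ := by
      rw [Set.eq_univ_iff_forall]
      intro x
      rw [Set.mem_iUnion]
      refine ⟨fun i => ⌈x i⌉ - 1, fun i => ?_⟩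
      have h1 := Int.le_ceil (x i)
      have h2 := Int.ceil_lt_add_one (x i)
      simp only [Pi.zero_apply, zero_add, Set.mem_Ioc]
      push_cast
      constructor <;> linarith
    have e1 : ∫ x, h x = ∑' k, ∫ x in T k, h x := by
      rw [← integral_iUnion hTm hTd hhint.integrableOn, hTu, setIntegral_univ]
    have e2 : ∀ k : ι → ℤ, ∫ x in T k, h x = ∫ x in S, h (fun i => x i + k i) := by
      intro k
      have hmp : MeasurePreserving (fun (x : ι → ℝ) i => x i + (k i : ℝ)) volume volume :=
        measurePreserving_add_right volume (fun i => (k i : ℝ))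
      have hme : MeasurableEmbedding (fun (x : ι → ℝ) i => x i + (k i : ℝ)) :=
        measurableEmbedding_addRight (fun i => (k i : ℝ))
      rw [← hmp.setIntegral_preimage_emb hme]
      congr 1
      congr 1
      ext x
      simp [hT]
    have hgi : ∀ k : ι → ℤ, Integrable (fun x => h (fun i => x i + k i)) (volume.restrict S) := by
      intro k
      have := hhint.comp_add_right (fun i => (k i : ℝ))
      exact this.integrableOn
    have e3 := hasSum_integral_of_summable_integral_norm hgi (by
      refine Summable.of_nonneg_of_le (fun k => integral_nonneg fun x => norm_nonneg _) ?_
        (hu.mul_left (∫ x in S, B x))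
      intro k
      rw [← integral_mul_const]
      refine integral_mono (hgi k).norm (hBint.mul_const _) fun x => ?_
      rw [hhshift, norm_mul, hexp, one_mul]
      exact hfB x k)
    rw [e1, tsum_congr e2, e3.tsum_eq]
    refine setIntegral_congr_fun hSm fun x _ => ?_
    change UnitAddTorus.mFourier (-n) (q x) • g (q x) = _
    rw [hgq]
    simp only [hhshift, tsum_mul_left, hG, smul_eq_mul]
    congr 1
    change ∏ i, fourier ((-n) i) (x i : UnitAddCircle) = _
    simp only [fourier_coe_apply, ← Complex.exp_sum]
    congr 1
    rw [Finset.mul_sum, ← Finset.sum_neg_distrib]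
    refine Finset.sum_congr rfl fun i _ => ?_
    simp
    ring
  have h := UnitAddTorus.hasSum_mFourier_series_apply_of_summable (f := ⟨g, hgc⟩)
    (by simpa only [funext hcoef, ContinuousMap.coe_mk] using hsum) (q 0)
  simp only [ContinuousMap.coe_mk, hgq, funext hcoef] at h
  have h0 : G 0 = ∑' k : ι → ℤ, f (fun i => k i) := by simp [hG]
  rw [← h0, ← h.tsum_eq]
  refine tsum_congr fun n => ?_
  simp [UnitAddTorus.mFourier, hq]

lemma exists_norm_mulVec_ge (A : Matrix ι ι ℝ) (hA : IsUnit A.det) :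
    ∃ a > 0, ∀ x : ι → ℝ, a * ‖x‖ ^ 2 ≤ ∑ i, (A.mulVec x i) ^ 2 := by
  obtain ⟨c, hc0, hc⟩ : ∃ c > 0, ∀ x : ι → ℝ, ‖x‖ ≤ c * ‖A.mulVec x‖ := by
    set L := LinearMap.toContinuousLinearMap (Matrix.mulVecLin A⁻¹)
    refine ⟨‖L‖ + 1, by positivity, fun x => ?_⟩
    have h1 : L (A.mulVec x) = x := by
      simp [L, Matrix.mulVec_mulVec, Matrix.nonsing_inv_mul A hA]
    calc ‖x‖ = ‖L (A.mulVec x)‖ := by rw [h1]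
      _ ≤ ‖L‖ * ‖A.mulVec x‖ := L.le_opNorm _
      _ ≤ _ := by nlinarith [norm_nonneg (A.mulVec x)]
  refine ⟨(c ^ 2)⁻¹, by positivity, fun x => ?_⟩
  have h2 : ‖A.mulVec x‖ ^ 2 ≤ ∑ i, (A.mulVec x i) ^ 2 := by
    have h3 : ‖A.mulVec x‖ ≤ Real.sqrt (∑ i, (A.mulVec x i) ^ 2) := by
      rw [pi_norm_le_iff_of_nonneg (Real.sqrt_nonneg _)]
      intro i
      rw [Real.norm_eq_abs, ← Real.sqrt_sq_eq_abs]
      refine Real.sqrt_le_sqrt ?_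
      exact Finset.single_le_sum (f := fun i => (A.mulVec x i) ^ 2) (fun i _ => sq_nonneg _)
        (Finset.mem_univ i)
    calc ‖A.mulVec x‖ ^ 2 ≤ (Real.sqrt (∑ i, (A.mulVec x i) ^ 2)) ^ 2 := by gcongr
      _ = _ := Real.sq_sqrt (Finset.sum_nonneg fun i _ => sq_nonneg _)
  rw [inv_mul_le_iff₀ (by positivity)]
  calc ‖x‖ ^ 2 ≤ (c * ‖A.mulVec x‖) ^ 2 := by gcongr; exact hc x
    _ = c ^ 2 * ‖A.mulVec x‖ ^ 2 := by ring
    _ ≤ _ := by gcongr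

lemma summable_gauss_mulVec (A : Matrix ι ι ℝ) (hA : IsUnit A.det) (c : ℝ) (hc : 0 < c) :
    Summable fun k : ι → ℤ => Real.exp (-c * ∑ i, (A.mulVec (fun i => (k i : ℝ)) i) ^ 2) := by
  obtain ⟨a, ha, h⟩ := exists_norm_mulVec_ge A hA
  refine Summable.of_nonneg_of_le (fun k => (Real.exp_pos _).le) (fun k => ?_)
    (summable_exp_neg_mul_sq_norm_int (c * a) (mul_pos hc ha))
  refine Real.exp_le_exp.mpr ?_
  have := mul_le_mul_of_nonneg_left (h (fun i => (k i : ℝ))) hc.le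
  linarith

theorem poisson_gauss (A : Matrix ι ι ℝ) (hA : IsUnit A.det) :
    ∑' k : ι → ℤ, Real.exp (-Real.pi * ∑ i, (A.mulVec (fun i => (k i : ℝ)) i) ^ 2) =
      |A.det|⁻¹ * ∑' k : ι → ℤ,
        Real.exp (-Real.pi * ∑ i, (A⁻¹.transpose.mulVec (fun i => (k i : ℝ)) i) ^ 2) := by
  have hA' : IsUnit (A⁻¹.transpose).det := by
    rw [Matrix.det_transpose, Matrix.det_nonsing_inv]
    exact hA.ringInverse
  set f : (ι → ℝ) → ℂ := fun x => cexp (-Real.pi * ∑ i, (A.mulVec x i : ℂ) ^ 2) with hf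
  have hAc : Continuous fun x : ι → ℝ => A.mulVec x :=
    (Continuous.matrix_mulVec continuous_const continuous_id)
  have hfn : ∀ x, f x = (Real.exp (-Real.pi * ∑ i, (A.mulVec x i) ^ 2) : ℝ) := by
    intro x; simp [hf]
  have hft : ∀ n : ι → ℤ, Integrable f ∧
      ∫ x : ι → ℝ, cexp (-(2 * Real.pi * I * ∑ i, (n i : ℂ) * x i)) * f x =
      ((|A.det|⁻¹ *
        Real.exp (-Real.pi * ∑ i, (A⁻¹.transpose.mulVec (fun i => (n i : ℝ)) i) ^ 2) : ℝ) : ℂ) := by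
    intro n
    have hpi : (0 : ℝ) < (Real.pi : ℂ).re := by simpa using Real.pi_pos
    have hmap := Real.map_linearMap_volume_pi_eq_smul_volume_pi (f := Matrix.toLin' A)
      (by simpa using hA.ne_zero)
    have hmeas : MeasurableEmbedding (Matrix.toLin' A) := by
      have e : (Matrix.toLin' A : (ι → ℝ) → ι → ℝ) =
          (LinearEquiv.ofIsUnitDet (f := Matrix.toLin' A) (v := Pi.basisFun ℝ ι)
            (v' := Pi.basisFun ℝ ι) (by simpa using hA)).toContinuousLinearEquiv.toHomeomorph := by
        rfl
      rw [e]
      exact Homeomorph.measurableEmbedding _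
    constructor
    · have h1 : Integrable (fun v : ι → ℝ => cexp (-Real.pi * ∑ i, (v i : ℂ) ^ 2)) := by
        simpa using GaussianFourier.integrable_cexp_neg_mul_sum_add (ι := ι) hpi 0
      have h2 := h1.smul_measure (c := ENNReal.ofReal |(LinearMap.det (Matrix.toLin' A))⁻¹|)
        ENNReal.ofReal_ne_top
      rw [← hmap, hmeas.integrable_map_iff] at h2
      exact h2
    · set w := A⁻¹.transpose.mulVec (fun i => (n i : ℝ)) with hw
      have h1 := GaussianFourier.integral_cexp_neg_mul_sum_add (ι := ι) hpi
        (fun i => -(2 * Real.pi * I * w i))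
      have h2 : ∀ x : ι → ℝ, cexp (-(2 * Real.pi * I * ∑ i, (n i : ℂ) * x i)) * f x =
          (fun v : ι → ℝ => cexp (-Real.pi * ∑ i, (v i : ℂ) ^ 2 +
            ∑ i, (-(2 * Real.pi * I * w i)) * v i)) (Matrix.toLin' A x) := by
        intro x
        have h3 : ∑ i, (n i : ℝ) * x i = ∑ i, w i * A.mulVec x i := by
          change (fun i => (n i : ℝ)) ⬝ᵥ x = w ⬝ᵥ A.mulVec x
          rw [hw, Matrix.mulVec_transpose, ← Matrix.dotProduct_mulVec, Matrix.mulVec_mulVec,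
            Matrix.nonsing_inv_mul A hA, Matrix.one_mulVec]
        have h3' : ∑ i, (n i : ℂ) * x i = ∑ i, (w i : ℂ) * A.mulVec x i := by exact_mod_cast h3
        simp only [hf, Matrix.toLin'_apply]
        rw [h3', ← Complex.exp_add, add_comm]
        congr 2
        rw [Finset.mul_sum, ← Finset.sum_neg_distrib]
        exact Finset.sum_congr rfl fun i _ => by ring
      have h4 := hmeas.integral_map (μ := volume) (fun v : ι → ℝ =>
        cexp (-Real.pi * ∑ i, (v i : ℂ) ^ 2 + ∑ i, (-(2 * Real.pi * I * w i)) * v i))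
      rw [integral_congr_ae (Eventually.of_forall h2)]
      refine h4.symm.trans ?_
      rw [hmap, integral_smul_measure, h1,
        ENNReal.toReal_ofReal (abs_nonneg _), div_self (by exact_mod_cast Real.pi_ne_zero),
        Complex.one_cpow, one_mul, LinearMap.det_toLin', abs_inv, Complex.real_smul]
      push_cast
      congr 2
      rw [div_eq_iff (by simp), Finset.mul_sum, Finset.sum_mul]
      refine Finset.sum_congr rfl fun i _ => ?_
      have : I ^ 2 = -1 := I_sq
      linear_combination 4 * (Real.pi : ℂ) ^ 2 * (w i) ^ 2 * this
  have := poisson_pi f (by fun_prop) (hft 0).1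
    (fun x => Real.exp (Real.pi * ∑ i, (A.mulVec x i) ^ 2)) (by fun_prop) _
    (summable_gauss_mulVec A hA (Real.pi / 2) (by positivity)) (fun k => (Real.exp_pos _).le) ?_ ?_
  · simp only [fun n => (hft n).2] at this
    simp only [hfn] at this
    rw [← Complex.ofReal_tsum, ← Complex.ofReal_tsum, Complex.ofReal_inj, tsum_mul_left] at this
    exact this
  · intro x k
    rw [hfn, Complex.norm_real, Real.norm_eq_abs, abs_of_pos (Real.exp_pos _), ← Real.exp_add,
      Real.exp_le_exp]
    have : A.mulVec (fun i => x i + k i) = A.mulVec x + A.mulVec (fun i => (k i : ℝ)) := by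
      rw [← Matrix.mulVec_add]; rfl
    rw [this]
    have key : ∑ i, (A.mulVec (fun i => (k i : ℝ)) i) ^ 2 ≤
        2 * ∑ i, ((A.mulVec x + A.mulVec (fun i => (k i : ℝ))) i) ^ 2 +
          2 * ∑ i, (A.mulVec x i) ^ 2 := by
      rw [Finset.mul_sum, Finset.mul_sum, ← Finset.sum_add_distrib]
      refine Finset.sum_le_sum fun i _ => ?_
      rw [Pi.add_apply]
      nlinarith [sq_nonneg (2 * A.mulVec x i + A.mulVec (fun i => (k i : ℝ)) i)]
    nlinarith [Real.pi_pos, mul_le_mul_of_nonneg_left key Real.pi_pos.le]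
  · simp only [fun n => (hft n).2]
    rw [Complex.summable_ofReal]
    exact (summable_gauss_mulVec _ hA' _ Real.pi_pos).mul_left _

end Poisson

section Theta

variable {K : Type} [Field K] [NumberField K]

open InfinitePlace in
/-- The quadratic form `∑_w n_w (T_w |α|_w)²` on a number field. -/
def quadPlace (T : InfinitePlace K → ℝ) (α : K) : ℝ :=
  ∑ w : InfinitePlace K, (mult w : ℝ) * (T w * w α) ^ 2

/-- The product `∏_w T_w ^ n_w`. -/
def prodPlace (T : InfinitePlace K → ℝ) : ℝ :=
  ∏ w : InfinitePlace K, T w ^ w.mult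

/-- The infinite place below an embedding. -/
def placeOf (σ : K →ₐ[ℚ] ℂ) : InfinitePlace K := InfinitePlace.mk (σ : K →+* ℂ)

lemma card_fiber_placeOf (w : InfinitePlace K) :
    (Finset.univ.filter fun σ : K →ₐ[ℚ] ℂ => placeOf σ = w).card = w.mult := by
  rw [← InfinitePlace.card_filter_mk_eq w]
  refine Finset.card_bij' (fun σ _ => (RingHom.equivRatAlgHom K ℂ).symm σ)
    (fun φ _ => RingHom.equivRatAlgHom K ℂ φ) ?_ ?_ ?_ ?_
  · intro σ h
    rw [Finset.mem_filter] at h ⊢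
    exact ⟨Finset.mem_univ _, h.2⟩
  · intro φ h
    rw [Finset.mem_filter] at h ⊢
    exact ⟨Finset.mem_univ _, h.2⟩
  · intro σ h; simp
  · intro φ h; simp

lemma quadPlace_eq_sum (T : InfinitePlace K → ℝ) (α : K) :
    quadPlace T α = ∑ σ : K →ₐ[ℚ] ℂ, (T (placeOf σ) * ‖σ α‖) ^ 2 := by
  rw [quadPlace, ← Finset.sum_fiberwise (s := Finset.univ) (g := placeOf)]
  refine Finset.sum_congr rfl fun w _ => ?_
  rw [← card_fiber_placeOf w, ← nsmul_eq_mul, ← Finset.sum_const]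
  refine Finset.sum_congr rfl fun σ hσ => ?_
  rw [Finset.mem_filter] at hσ
  rw [← hσ.2]
  rfl

lemma prodPlace_eq_prod (T : InfinitePlace K → ℝ) :
    prodPlace T = ∏ σ : K →ₐ[ℚ] ℂ, T (placeOf σ) := by
  rw [prodPlace, ← Finset.prod_fiberwise (s := Finset.univ) (g := placeOf)]
  refine Finset.prod_congr rfl fun w _ => ?_
  rw [← card_fiber_placeOf w, ← Finset.prod_const]
  refine Finset.prod_congr rfl fun σ hσ => ?_
  rw [Finset.mem_filter] at hσ
  rw [← hσ.2]

variable {ι : Type*} [Fintype ι]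

/-- The Gram matrix of a family of elements for the form `quadPlace T`. -/
def gramPlace (T : InfinitePlace K → ℝ) (b : ι → K) : Matrix ι ι ℝ :=
  fun i j => (∑ σ : K →ₐ[ℚ] ℂ, (T (placeOf σ) : ℂ) ^ 2 * σ (b i) * (starRingEnd ℂ) (σ (b j))).re

/-- Complex conjugation on the embeddings. -/
def conjEmb : Equiv.Perm (K →ₐ[ℚ] ℂ) where
  toFun σ := (Complex.conjAe.restrictScalars ℚ : ℂ →ₐ[ℚ] ℂ).comp σ
  invFun σ := (Complex.conjAe.restrictScalars ℚ : ℂ →ₐ[ℚ] ℂ).comp σ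
  left_inv σ := by ext; simp
  right_inv σ := by ext; simp

lemma conjEmb_apply (σ : K →ₐ[ℚ] ℂ) (x : K) : conjEmb σ x = (starRingEnd ℂ) (σ x) := rfl

lemma placeOf_conjEmb (σ : K →ₐ[ℚ] ℂ) : placeOf (conjEmb σ) = placeOf σ :=
  InfinitePlace.mk_conjugate_eq (σ : K →+* ℂ)

/-- The weighted matrix of embeddings. -/
def embPlace (T : InfinitePlace K → ℝ) (b : ι → K) (e : ι ≃ (K →ₐ[ℚ] ℂ)) : Matrix ι ι ℂ :=
  fun i j => (T (placeOf (e i)) : ℂ) * e i (b j)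

lemma gramPlace_map (T : InfinitePlace K → ℝ) (b : ι → K) (e : ι ≃ (K →ₐ[ℚ] ℂ)) :
    (gramPlace T b).map ((↑) : ℝ → ℂ) =
      (embPlace T b e).transpose * (embPlace T b e).map (starRingEnd ℂ) := by
  ext i j
  rw [Matrix.map_apply, gramPlace]
  rw [Complex.conj_eq_iff_re.mp]
  · rw [Matrix.mul_apply, ← e.sum_comp]
    refine Finset.sum_congr rfl fun l _ => ?_
    simp [embPlace]
    ring
  · rw [map_sum, ← Equiv.sum_comp conjEmb]
    refine Finset.sum_congr rfl fun σ _ => ?_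
    simp [placeOf_conjEmb, conjEmb_apply]

lemma dotProduct_gramPlace (T : InfinitePlace K → ℝ) (b : ι → K) (x : ι → ℝ) :
    x ⬝ᵥ (gramPlace T b).mulVec x =
      ∑ σ : K →ₐ[ℚ] ℂ, (T (placeOf σ) * ‖∑ i, (x i : ℂ) * σ (b i)‖) ^ 2 := by
  have h : ∀ σ : K →ₐ[ℚ] ℂ, (T (placeOf σ) * ‖∑ i, (x i : ℂ) * σ (b i)‖) ^ 2 =
      (∑ i, ∑ j, x i * (x j * ((T (placeOf σ) : ℂ) ^ 2 * σ (b i) * (starRingEnd ℂ) (σ (b j))))).re := by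
    intro σ
    rw [mul_pow, ← Complex.normSq_eq_norm_sq]
    rw [← Complex.ofReal_re (_ * _)]
    push_cast
    rw [← Complex.mul_conj, map_sum, Finset.sum_mul_sum, Finset.mul_sum]
    congr 1
    refine Finset.sum_congr rfl fun i _ => ?_
    rw [Finset.mul_sum]
    refine Finset.sum_congr rfl fun j _ => ?_
    simp
    ring
  simp only [h, dotProduct, Matrix.mulVec, gramPlace]
  simp only [← Complex.re_sum]
  rw [Finset.sum_comm]
  rw [Complex.re_sum]
  refine Finset.sum_congr rfl fun i _ => ?_
  rw [Finset.sum_comm, Complex.re_sum, Finset.mul_sum]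
  refine Finset.sum_congr rfl fun j _ => ?_
  rw [← Finset.mul_sum, ← Finset.mul_sum, Complex.re_ofReal_mul, Complex.re_ofReal_mul]
  ring

lemma dotProduct_gramPlace_int (T : InfinitePlace K → ℝ) (b : ι → K) (k : ι → ℤ) :
    (fun i => (k i : ℝ)) ⬝ᵥ (gramPlace T b).mulVec (fun i => (k i : ℝ)) =
      quadPlace T (∑ i, k i • b i) := by
  rw [dotProduct_gramPlace, quadPlace_eq_sum]
  refine Finset.sum_congr rfl fun σ _ => ?_
  congr 3
  simp [map_sum]

lemma gramPlace_mul_traceDual (T : InfinitePlace K → ℝ) (hT : ∀ w, 0 < T w)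
    (b : Module.Basis ι ℚ K) (e : ι ≃ (K →ₐ[ℚ] ℂ)) :
    gramPlace T b * gramPlace (fun w => (T w)⁻¹) b.traceDual = 1 := by
  set B := embPlace T b e
  set D := embPlace (fun w => (T w)⁻¹) b.traceDual e
  have h1 : B.transpose * D = 1 := by
    ext i j
    rw [Matrix.mul_apply]
    have h2 := b.trace_mul_traceDual i j
    have h3 := trace_eq_sum_embeddings ℂ (K := ℚ) (x := b i * b.traceDual j)
    rw [h2] at h3
    rw [Matrix.one_apply]
    have : (algebraMap ℚ ℂ) (if i = j then 1 else 0) = if i = j then 1 else 0 := by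
      split_ifs <;> simp
    rw [this] at h3
    rw [h3, ← e.sum_comp]
    refine Finset.sum_congr rfl fun l _ => ?_
    have : (T (placeOf (e l)) : ℂ) ≠ 0 := by exact_mod_cast (hT _).ne'
    simp only [B, D, embPlace, Matrix.transpose_apply, map_mul]
    push_cast
    field_simp
  have h2 : B.map (starRingEnd ℂ) * D.conjTranspose = 1 := by
    have h3 : D.transpose * B = 1 := by
      rw [← Matrix.transpose_inj, Matrix.transpose_mul, Matrix.transpose_transpose, h1,
        Matrix.transpose_one]
    have h4 := congrArg Matrix.conjTranspose (mul_eq_one_comm.mp h1)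
    rw [Matrix.conjTranspose_mul, Matrix.conjTranspose_one] at h4
    exact h4
  have hinj : Function.Injective fun M : Matrix ι ι ℝ => M.map ((↑) : ℝ → ℂ) :=
    Matrix.map_injective Complex.ofReal_injective
  apply hinj
  change (gramPlace T b * gramPlace (fun w => (T w)⁻¹) b.traceDual).map Complex.ofRealHom = (1 : Matrix ι ι ℝ).map Complex.ofRealHom
  rw [Matrix.map_mul]
  have g1 := gramPlace_map T b e
  have g2 := gramPlace_map (fun w => (T w)⁻¹) b.traceDual e
  have g2' : (gramPlace (fun w => (T w)⁻¹) b.traceDual).map Complex.ofRealHom = D.conjTranspose * D := by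
    have : (gramPlace (fun w => (T w)⁻¹) b.traceDual).map Complex.ofRealHom =
        ((gramPlace (fun w => (T w)⁻¹) b.traceDual).map ((↑) : ℝ → ℂ)).map (starRingEnd ℂ) := by
      ext; simp
    rw [this, g2, Matrix.map_mul]
    congr 1
    ext; simp [D]
  rw [g2']
  change (gramPlace T b).map ((↑) : ℝ → ℂ) * _ = _
  rw [g1, Matrix.mul_assoc, ← Matrix.mul_assoc _ D.conjTranspose, h2, Matrix.one_mul, h1]
  simp

lemma det_gramPlace (T : InfinitePlace K → ℝ) (b : Module.Basis ι ℚ K) (e : ι ≃ (K →ₐ[ℚ] ℂ)) :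
    (gramPlace T b).det = prodPlace T ^ 2 * |(Algebra.discr ℚ b : ℝ)| := by
  have h1 : embPlace T b e = Matrix.diagonal (fun i => (T (placeOf (e i)) : ℂ)) *
      (Algebra.embeddingsMatrixReindex ℚ ℂ b e).transpose := by
    ext i j
    rw [Matrix.diagonal_mul]
    rfl
  have h2 : (embPlace T b e).det =
      (prodPlace T : ℂ) * (Algebra.embeddingsMatrixReindex ℚ ℂ b e).det := by
    rw [h1, Matrix.det_mul, Matrix.det_diagonal, Matrix.det_transpose, prodPlace_eq_prod,
      ← e.prod_comp]
    push_cast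
    rfl
  have h3 := Algebra.discr_eq_det_embeddingsMatrixReindex_pow_two ℚ ℂ b e
  have h4 : (((gramPlace T b).det : ℝ) : ℂ) = ((prodPlace T ^ 2 * |(Algebra.discr ℚ b : ℝ)| : ℝ) : ℂ) := by
    have : (((gramPlace T b).det : ℝ) : ℂ) = ((gramPlace T b).map ((↑) : ℝ → ℂ)).det :=
      RingHom.map_det Complex.ofRealHom _
    rw [this, gramPlace_map T b e, Matrix.det_mul, Matrix.det_transpose]
    have : ((embPlace T b e).map (starRingEnd ℂ)).det = (starRingEnd ℂ) (embPlace T b e).det :=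
      (RingHom.map_det (starRingEnd ℂ) _).symm
    rw [this, Complex.mul_conj, h2, Complex.normSq_mul, Complex.normSq_ofReal, Complex.normSq_eq_norm_sq,
      ← norm_pow, ← h3]
    simp [pow_two]
  exact_mod_cast h4

lemma prodPlace_pos (T : InfinitePlace K → ℝ) (hT : ∀ w, 0 < T w) : 0 < prodPlace T :=
  Finset.prod_pos fun w _ => pow_pos (hT w) _

open scoped MatrixOrder Matrix.Norms.L2Operator in
lemma theta_basis (T : InfinitePlace K → ℝ) (hT : ∀ w, 0 < T w) (b : Module.Basis ι ℚ K) :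
    (Summable fun k : ι → ℤ => Real.exp (-Real.pi * quadPlace T (∑ i, k i • b i))) ∧
    ∑' k : ι → ℤ, Real.exp (-Real.pi * quadPlace T (∑ i, k i • b i)) =
      (√|(Algebra.discr ℚ b : ℝ)| * prodPlace T)⁻¹ *
      ∑' k : ι → ℤ, Real.exp (-Real.pi * quadPlace (fun w => (T w)⁻¹) (∑ i, k i • b.traceDual i)) := by
  have hcard : Fintype.card ι = Fintype.card (K →ₐ[ℚ] ℂ) := by
    rw [AlgHom.card, Module.finrank_eq_card_basis b]
  obtain ⟨e⟩ : Nonempty (ι ≃ (K →ₐ[ℚ] ℂ)) := ⟨Fintype.equivOfCardEq hcard⟩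
  have hmul := gramPlace_mul_traceDual T hT b e
  have hdet := det_gramPlace T b e
  have hps : (gramPlace T b).PosSemidef := by
    refine Matrix.PosSemidef.of_dotProduct_mulVec_nonneg ?_ ?_
    · ext i j
      rw [Matrix.conjTranspose_apply, star_trivial, gramPlace, gramPlace, Complex.re_sum,
        Complex.re_sum]
      refine Finset.sum_congr rfl fun σ _ => ?_
      rw [← Complex.conj_re]
      congr 1
      simp
      ring
    · intro x
      rw [star_trivial, dotProduct_gramPlace]
      exact Finset.sum_nonneg fun _ _ => sq_nonneg _
  obtain ⟨A, hA⟩ : ∃ A : Matrix ι ι ℝ, gramPlace T b = A.transpose * A := by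
    rw [← Matrix.nonneg_iff_posSemidef, CStarAlgebra.nonneg_iff_eq_star_mul_self] at hps
    obtain ⟨A, hA⟩ := hps
    exact ⟨A, hA.trans (by rw [Matrix.star_eq_conjTranspose, Matrix.conjTranspose_eq_transpose_of_trivial])⟩
  have hdetA : |A.det| = √|(Algebra.discr ℚ b : ℝ)| * prodPlace T := by
    rw [← Real.sqrt_sq_eq_abs, mul_comm, ← Real.sqrt_sq (prodPlace_pos T hT).le,
      ← Real.sqrt_mul (sq_nonneg _), ← hdet, hA, Matrix.det_mul, Matrix.det_transpose, pow_two]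
  have hu : IsUnit A.det := by
    have h1 := congrArg Matrix.det hmul
    rw [hA, Matrix.det_mul, Matrix.det_mul, Matrix.det_one] at h1
    rw [isUnit_iff_ne_zero]
    rintro h0
    rw [h0] at h1
    simp at h1
  have hQ : ∀ k : ι → ℤ, ∑ i, (A.mulVec (fun i => (k i : ℝ)) i) ^ 2 = quadPlace T (∑ i, k i • b i) := by
    intro k
    rw [← dotProduct_gramPlace_int, hA, ← Matrix.mulVec_mulVec, Matrix.dotProduct_mulVec,
      Matrix.vecMul_transpose]
    simp [dotProduct, pow_two]
  have hQ' : ∀ k : ι → ℤ, ∑ i, (A⁻¹.transpose.mulVec (fun i => (k i : ℝ)) i) ^ 2 =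
      quadPlace (fun w => (T w)⁻¹) (∑ i, k i • b.traceDual i) := by
    intro k
    have hinv : gramPlace (fun w => (T w)⁻¹) b.traceDual = A⁻¹ * A⁻¹.transpose := by
      rw [Matrix.transpose_nonsing_inv, ← Matrix.mul_inv_rev, ← hA]
      exact (Matrix.inv_eq_right_inv hmul).symm
    rw [← dotProduct_gramPlace_int, hinv, ← Matrix.mulVec_mulVec, Matrix.dotProduct_mulVec]
    rw [← Matrix.mulVec_transpose]
    simp [dotProduct, pow_two]
  have h := poisson_gauss A hu
  have h' := summable_gauss_mulVec A hu _ Real.pi_pos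
  simp only [hQ, hQ', hdetA] at h h'
  exact ⟨h', h⟩

end Theta

section ThetaIdeal

variable {K : Type} [Field K] [NumberField K]

/-- The group of invertible fractional ideals. -/
abbrev FracU (K : Type) [Field K] [NumberField K] := (FractionalIdeal (nonZeroDivisors (𝓞 K)) K)ˣ

/-- The theta series of a fractional ideal. -/
def thetaIdeal (J : FracU K) (T : InfinitePlace K → ℝ) : ENNReal :=
  ∑' α : {α : K // α ∈ (J : FractionalIdeal (nonZeroDivisors (𝓞 K)) K)},
    ENNReal.ofReal (Real.exp (-Real.pi * quadPlace T α.1))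

/-- The covolume of a fractional ideal. -/
def covolIdeal (J : FracU K) : ℝ :=
  √|(discr K : ℝ)| * (FractionalIdeal.absNorm (J : FractionalIdeal (nonZeroDivisors (𝓞 K)) K) : ℝ)

/-- The dual of a fractional ideal for the trace form. -/
def dualIdeal (J : FracU K) : FracU K :=
  Units.mk0 (FractionalIdeal.dual ℤ ℚ (J : FractionalIdeal (nonZeroDivisors (𝓞 K)) K))
    (FractionalIdeal.dual_ne_zero ℤ ℚ J.ne_zero)

lemma tsum_lattice {ι : Type*} [Fintype ι] (b : Module.Basis ι ℚ K) (S : Set K)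
    (hS : ∀ x, x ∈ Submodule.span ℤ (Set.range b) ↔ x ∈ S) (f : K → ENNReal) :
    ∑' k : ι → ℤ, f (∑ i, k i • b i) = ∑' x : {x // x ∈ S}, f x.1 := by
  have hmem : ∀ k : ι → ℤ, ∑ i, k i • b i ∈ S := fun k => (hS _).1
    (Submodule.sum_mem _ fun i _ => Submodule.smul_mem _ _ (Submodule.subset_span ⟨i, rfl⟩))
  let g : (ι → ℤ) → {x // x ∈ S} := fun k => ⟨∑ i, k i • b i, hmem k⟩
  have hg : Function.Bijective g := by
    constructor
    · intro k l h
      have h1 : ∑ i, (k i : ℚ) • b i = ∑ i, (l i : ℚ) • b i := by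
        have := congrArg Subtype.val h
        simpa only [g, Int.cast_smul_eq_zsmul] using this
      funext i
      have h2 := congrArg (fun x => b.repr x i) h1
      simp only [Module.Basis.repr_sum_self] at h2
      exact_mod_cast h2
    · rintro ⟨x, hx⟩
      obtain ⟨c, hc⟩ := (Submodule.mem_span_range_iff_exists_fun ℤ).1 ((hS x).2 hx)
      exact ⟨c, Subtype.ext hc⟩
  exact (Equiv.ofBijective g hg).tsum_eq (fun x : {x // x ∈ S} => f x.1)

lemma covol_eq (J : FracU K) :
    √|(Algebra.discr ℚ (basisOfFractionalIdeal K J) : ℝ)| = covolIdeal J := by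
  have e : (Module.Free.ChooseBasisIndex ℤ (𝓞 K)) ≃ (Module.Free.ChooseBasisIndex ℤ (J : FractionalIdeal (nonZeroDivisors (𝓞 K)) K)) := by
    apply Fintype.equivOfCardEq
    rw [← Module.finrank_eq_card_chooseBasisIndex, ← Module.finrank_eq_card_chooseBasisIndex]
    exact (fractionalIdeal_rank K J).symm
  have h1 := det_basisOfFractionalIdeal_eq_absNorm K J e
  set b := (basisOfFractionalIdeal K J).reindex e.symm
  have h2 := Algebra.discr_of_matrix_vecMul (A := ℚ) (B := K) (integralBasis K)
    ((integralBasis K).toMatrix b)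
  rw [Module.Basis.toMatrix_map_vecMul] at h2
  rw [← coe_discr] at h2
  have h3 : Algebra.discr ℚ b = Algebra.discr ℚ (basisOfFractionalIdeal K J) := by
    rw [Module.Basis.coe_reindex]
    exact Algebra.discr_reindex ℚ (basisOfFractionalIdeal K J) e.symm
  rw [← h3, h2]
  rw [Module.Basis.det_apply] at h1
  rw [covolIdeal, ← h1]
  push_cast
  rw [abs_mul, abs_pow, Real.sqrt_mul (by positivity), Real.sqrt_sq (abs_nonneg _), mul_comm]

lemma covolIdeal_pos (J : FracU K) : 0 < covolIdeal J := by
  rw [← covol_eq]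
  apply Real.sqrt_pos.2
  rw [abs_pos]
  exact_mod_cast Algebra.discr_not_zero_of_basis ℚ (basisOfFractionalIdeal K J)

lemma thetaIdeal_eq_ofReal {ι : Type*} [Fintype ι] (b : Module.Basis ι ℚ K) (J : FracU K)
    (T : InfinitePlace K → ℝ) (hT : ∀ w, 0 < T w)
    (hS : ∀ x, x ∈ Submodule.span ℤ (Set.range b) ↔
      x ∈ (J : FractionalIdeal (nonZeroDivisors (𝓞 K)) K)) :
    thetaIdeal J T = ENNReal.ofReal (∑' k : ι → ℤ, Real.exp (-Real.pi * quadPlace T (∑ i, k i • b i))) := by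
  rw [ENNReal.ofReal_tsum_of_nonneg (fun _ => (Real.exp_pos _).le) (theta_basis T hT b).1]
  exact (tsum_lattice b {x | x ∈ (J : FractionalIdeal (nonZeroDivisors (𝓞 K)) K)} hS
    fun x => ENNReal.ofReal (Real.exp (-Real.pi * quadPlace T x))).symm

lemma thetaIdeal_ne_top (J : FracU K) (T : InfinitePlace K → ℝ) (hT : ∀ w, 0 < T w) :
    thetaIdeal J T ≠ ⊤ := by
  rw [thetaIdeal_eq_ofReal (basisOfFractionalIdeal K J) J T hT fun x => mem_span_basisOfFractionalIdeal K]
  exact ENNReal.ofReal_ne_top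

lemma one_le_thetaIdeal (J : FracU K) (T : InfinitePlace K → ℝ) :
    1 ≤ thetaIdeal J T := by
  refine le_trans ?_ (ENNReal.le_tsum ⟨0, FractionalIdeal.zero_mem _⟩)
  simp [quadPlace]

lemma thetaIdeal_functional (J : FracU K) (T : InfinitePlace K → ℝ) (hT : ∀ w, 0 < T w) :
    thetaIdeal J T = ENNReal.ofReal (covolIdeal J * prodPlace T)⁻¹ *
      thetaIdeal (dualIdeal J) (fun w => (T w)⁻¹) := by
  have hd : ∀ x, x ∈ Submodule.span ℤ (Set.range (basisOfFractionalIdeal K J).traceDual) ↔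
      x ∈ (dualIdeal J : FractionalIdeal (nonZeroDivisors (𝓞 K)) K) := by
    intro x
    have h := Submodule.traceDual_span_of_basis (A := ℤ) (K := ℚ) (L := K) (B := 𝓞 K)
      (I := (J : FractionalIdeal (nonZeroDivisors (𝓞 K)) K).coeToSubmodule)
      (basisOfFractionalIdeal K J) (by
        ext x
        rw [mem_span_basisOfFractionalIdeal]
        rfl)
    rw [← h, ← FractionalIdeal.coe_dual ℤ ℚ J.ne_zero]
    rfl
  rw [thetaIdeal_eq_ofReal (basisOfFractionalIdeal K J) J T hT fun x => mem_span_basisOfFractionalIdeal K,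
    thetaIdeal_eq_ofReal _ (dualIdeal J) (fun w => (T w)⁻¹) (fun w => inv_pos.2 (hT w)) hd,
    (theta_basis T hT _).2, covol_eq, ENNReal.ofReal_mul]
  exact inv_nonneg.2 (mul_pos (covolIdeal_pos J) (prodPlace_pos T hT)).le

lemma dualIdeal_dualIdeal (J : FracU K) : dualIdeal (dualIdeal J) = J :=
  Units.ext (FractionalIdeal.dual_dual ℤ ℚ _)

lemma covolIdeal_mul_dual (J : FracU K) : covolIdeal J * covolIdeal (dualIdeal J) = 1 := by
  have h1 := thetaIdeal_functional J (fun _ => 1) (fun _ => one_pos)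
  have h2 := thetaIdeal_functional (dualIdeal J) (fun _ => 1) (fun _ => one_pos)
  simp only [prodPlace, inv_one, one_pow, Finset.prod_const_one, mul_one, dualIdeal_dualIdeal] at h1 h2
  rw [h2, ← mul_assoc, ← ENNReal.ofReal_mul (inv_nonneg.2 (covolIdeal_pos J).le)] at h1
  have h3 := congrArg ENNReal.toReal h1
  rw [ENNReal.toReal_mul, ENNReal.toReal_ofReal] at h3
  · have h4 : 0 < (thetaIdeal J fun _ => 1).toReal :=
      ENNReal.toReal_pos (zero_lt_one.trans_le (one_le_thetaIdeal J _)).ne'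
        (thetaIdeal_ne_top J _ fun _ => one_pos)
    rw [← mul_inv] at h3
    have h5 : (covolIdeal J * covolIdeal (dualIdeal J))⁻¹ = 1 := by
      have := mul_right_cancel₀ h4.ne' ((one_mul _).trans h3)
      exact this.symm
    exact inv_eq_one.1 h5
  · exact mul_nonneg (inv_nonneg.2 (covolIdeal_pos J).le) (inv_nonneg.2 (covolIdeal_pos _).le)

end ThetaIdeal

section Arch

open NumberField.Units NumberField.Units.dirichletUnitTheorem NumberField.InfinitePlace Module

set_option linter.unusedSectionVars false

variable {K : Type} [Field K] [NumberField K]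

/-- The point of `∏_w ℝ` with coordinate sum `u` and projection `l` to the trace zero space. -/
def archVec (u : ℝ) (l : logSpace K) (w : InfinitePlace K) : ℝ :=
  mult w * u / finrank ℚ K + if h : w = w₀ then -∑ v, l v else l ⟨w, h⟩

lemma archVec_add (u v : ℝ) (l m : logSpace K) :
    archVec (u + v) (l + m) = archVec u l + archVec v m := by
  funext w
  simp only [archVec, Pi.add_apply]
  split_ifs <;> simp [Finset.sum_add_distrib] <;> ring

lemma archVec_smul (c u : ℝ) (l : logSpace K) :
    archVec (c * u) (c • l) = c • archVec u l := by
  funext w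
  simp only [archVec, Pi.smul_apply, smul_eq_mul]
  split_ifs <;> simp [← Finset.mul_sum] <;> ring

lemma sum_mult_div : ∑ w : InfinitePlace K, (mult w : ℝ) / finrank ℚ K = 1 := by
  rw [← Finset.sum_div, ← Nat.cast_sum, sum_mult_eq, div_self]
  exact_mod_cast (finrank_pos (R := ℚ) (M := K)).ne'

lemma sum_archVec (u : ℝ) (l : logSpace K) : ∑ w, archVec u l w = u := by
  simp only [archVec]
  rw [Finset.sum_add_distrib]
  have h1 : ∑ w : InfinitePlace K, (mult w : ℝ) * u / finrank ℚ K = u := by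
    calc ∑ w : InfinitePlace K, (mult w : ℝ) * u / finrank ℚ K
        = (∑ w : InfinitePlace K, (mult w : ℝ) / finrank ℚ K) * u := by
          rw [Finset.sum_mul]
          exact Finset.sum_congr rfl fun w _ => by ring
      _ = u := by rw [sum_mult_div, one_mul]
  rw [h1, Fintype.sum_eq_add_sum_subtype_ne _ w₀]
  simp only [dite_true]
  have : ∑ w : {w : InfinitePlace K // w ≠ w₀}, (if h : w.1 = w₀ then -∑ v, l v else l ⟨w.1, h⟩) = ∑ v, l v :=
    Finset.sum_congr rfl fun w _ => by rw [dif_neg w.2]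
  rw [this]
  ring

lemma archVec_of (x : InfinitePlace K → ℝ) :
    archVec (∑ w, x w) (fun w => x w.1 - mult w.1 * (∑ v, x v) / finrank ℚ K) = x := by
  have key : ∀ w ≠ w₀, archVec (∑ w, x w) (fun w => x w.1 - mult w.1 * (∑ v, x v) / finrank ℚ K) w = x w := by
    intro w hw
    simp only [archVec]
    rw [dif_neg hw]
    ring
  funext w
  by_cases hw : w = w₀
  · have h := sum_archVec (∑ w, x w) (fun w => x w.1 - mult w.1 * (∑ v, x v) / finrank ℚ K)
    conv_rhs at h => rw [Fintype.sum_eq_add_sum_subtype_ne _ w₀]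
    rw [Fintype.sum_eq_add_sum_subtype_ne _ w₀, Finset.sum_congr rfl fun (v : {v // v ≠ w₀}) _ => key v.1 v.2] at h
    rw [hw]
    exact add_right_cancel h
  · exact key w hw

variable (K) in
/-- The linear equivalence underlying `archVec`. -/
def archEquiv : (ℝ × logSpace K) ≃ₗ[ℝ] (InfinitePlace K → ℝ) where
  toFun p := archVec p.1 p.2
  map_add' p q := archVec_add _ _ _ _
  map_smul' c p := archVec_smul _ _ _
  invFun x := (∑ w, x w, fun w => x w.1 - mult w.1 * (∑ v, x v) / finrank ℚ K)
  left_inv p := by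
    ext w
    · exact sum_archVec p.1 p.2
    · change archVec p.1 p.2 w.1 - mult w.1 * (∑ v, archVec p.1 p.2 v) / finrank ℚ K = p.2 w
      rw [sum_archVec]
      simp only [archVec]
      rw [dif_neg w.2]
      ring
  right_inv x := archVec_of x

/-- The scaling parameters attached to logarithmic coordinates. -/
def expPlace (x : InfinitePlace K → ℝ) (w : InfinitePlace K) : ℝ := Real.exp (x w / mult w)

lemma expPlace_pos (x : InfinitePlace K → ℝ) (w : InfinitePlace K) : 0 < expPlace x w := Real.exp_pos _

lemma prodPlace_expPlace (x : InfinitePlace K → ℝ) : prodPlace (expPlace x) = Real.exp (∑ w, x w) := by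
  rw [prodPlace, Real.exp_sum]
  refine Finset.prod_congr rfl fun w _ => ?_
  rw [expPlace, ← Real.exp_nat_mul]
  congr 1
  have : (mult w : ℝ) ≠ 0 := mult_coe_ne_zero
  field_simp

lemma expPlace_neg (x : InfinitePlace K → ℝ) : expPlace (-x) = fun w => (expPlace x w)⁻¹ := by
  funext w
  simp [expPlace, neg_div, Real.exp_neg]

/-- The archimedean Gaussian in logarithmic coordinates. -/
def gaussArch (x : InfinitePlace K → ℝ) : ℝ :=
  Real.exp (-Real.pi * quadPlace (expPlace x) (1 : K))

lemma gaussArch_eq_prod (x : InfinitePlace K → ℝ) :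
    gaussArch x = ∏ w : InfinitePlace K, Real.exp (-Real.pi * (mult w * Real.exp (2 * (x w / mult w)))) := by
  rw [gaussArch, quadPlace, Finset.mul_sum, Real.exp_sum]
  refine Finset.prod_congr rfl fun w _ => ?_
  rw [map_one, mul_one, expPlace, ← Real.exp_nat_mul]
  norm_num

lemma continuous_gaussArch : Continuous (gaussArch (K := K)) := by
  unfold gaussArch quadPlace expPlace
  fun_prop

/-- The logarithmic vector of a nonzero element. -/
def logPlace (α : K) (w : InfinitePlace K) : ℝ := mult w * Real.log (w α)

lemma sum_logPlace {α : K} (hα : α ≠ 0) :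
    ∑ w, logPlace α w = Real.log |(Algebra.norm ℚ α : ℝ)| := by
  have h := prod_eq_abs_norm α
  have h1 : (|(Algebra.norm ℚ α : ℝ)|) = ((|Algebra.norm ℚ α| : ℚ) : ℝ) := by push_cast; rfl
  rw [h1, ← h, Real.log_prod]
  · exact Finset.sum_congr rfl fun w _ => by rw [Real.log_pow, logPlace]
  · intro w _
    exact pow_ne_zero _ (by simpa using hα)

lemma exp_quadPlace (x : InfinitePlace K → ℝ) {α : K} (hα : α ≠ 0) :
    Real.exp (-Real.pi * quadPlace (expPlace x) α) = gaussArch (x + logPlace α) := by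
  rw [gaussArch]
  congr 2
  refine Finset.sum_congr rfl fun w _ => ?_
  have h1 : (mult w : ℝ) ≠ 0 := mult_coe_ne_zero
  have h2 : 0 < w α := pos_iff.2 hα
  rw [map_one, mul_one]
  congr 2
  rw [expPlace, expPlace, Pi.add_apply, add_div, Real.exp_add, logPlace, mul_div_cancel_left₀ _ h1,
    Real.exp_log h2]

/-- The trace zero part of `logPlace`. -/
def logPlace₀ (α : K) : logSpace K := fun w =>
  logPlace α w.1 - mult w.1 * Real.log |(Algebra.norm ℚ α : ℝ)| / finrank ℚ K

lemma logPlace_eq {α : K} (hα : α ≠ 0) :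
    logPlace α = archVec (Real.log |(Algebra.norm ℚ α : ℝ)|) (logPlace₀ α) := by
  conv_lhs => rw [← archVec_of (logPlace α)]
  rw [sum_logPlace hα]
  rfl

lemma exp_quadPlace_archVec (u : ℝ) (l : logSpace K) {α : K} (hα : α ≠ 0) :
    Real.exp (-Real.pi * quadPlace (expPlace (archVec u l)) α) =
      gaussArch (archVec (u + Real.log |(Algebra.norm ℚ α : ℝ)|) (l + logPlace₀ α)) := by
  rw [exp_quadPlace _ hα, logPlace_eq hα, archVec_add]

lemma abs_norm_unit (v : (𝓞 K)ˣ) : |(Algebra.norm ℚ ((v : 𝓞 K) : K) : ℝ)| = 1 := by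
  have h := NumberField.Units.norm K v
  have h1 : (Algebra.norm ℚ ((v : 𝓞 K) : K) : ℝ) = ((Algebra.norm ℚ ((v : 𝓞 K) : K) : ℚ) : ℝ) := rfl
  rw [← Rat.cast_abs, ← RingOfIntegers.coe_norm]
  exact_mod_cast congrArg (fun q : ℚ => (q : ℝ)) h

lemma logPlace₀_unit (v : (𝓞 K)ˣ) :
    logPlace₀ ((v : 𝓞 K) : K) = logEmbedding K (Additive.ofMul v) := by
  funext w
  rw [logEmbedding_component, logPlace₀, abs_norm_unit]
  simp [logPlace]

lemma logPlace₀_mul {α β : K} (hα : α ≠ 0) (hβ : β ≠ 0) :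
    logPlace₀ (α * β) = logPlace₀ α + logPlace₀ β := by
  funext w
  have h1 : (w.1 α) ≠ 0 := by simpa using hα
  have h2 : (w.1 β) ≠ 0 := by simpa using hβ
  have h3 : |(Algebra.norm ℚ α : ℝ)| ≠ 0 := by simpa using hα
  have h4 : |(Algebra.norm ℚ β : ℝ)| ≠ 0 := by simpa using hβ
  simp only [logPlace₀, logPlace, Pi.add_apply, map_mul, Rat.cast_mul, abs_mul]
  rw [Real.log_mul h1 h2, Real.log_mul h3 h4]
  ring

lemma tsum_units (g : logSpace K → ENNReal) :
    ∑' v : (𝓞 K)ˣ, g (logEmbedding K (Additive.ofMul v)) =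
      torsionOrder K * ∑' l : unitLattice K, g l := by
  have hsurj : ∀ l : unitLattice K, ∃ v : (𝓞 K)ˣ, logEmbedding K (Additive.ofMul v) = l := by
    rintro ⟨l, x, -, hx⟩
    exact ⟨x.toMul, hx⟩
  choose s hs using hsurj
  let φ : torsion K × unitLattice K → (𝓞 K)ˣ := fun p => p.1 * s p.2
  have hlog : ∀ p, logEmbedding K (Additive.ofMul (φ p)) = p.2 := by
    intro p
    have : logEmbedding K (Additive.ofMul (p.1 : (𝓞 K)ˣ)) = 0 := logEmbedding_eq_zero_iff.2 p.1.2
    rw [ofMul_mul, map_add, this, hs, zero_add]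
  have hφ : Function.Bijective φ := by
    constructor
    · intro p q h
      have h2 : p.2 = q.2 := Subtype.ext (by rw [← hlog p, ← hlog q, h])
      have h1 : (p.1 : (𝓞 K)ˣ) = q.1 := by
        have h' : (p.1 : (𝓞 K)ˣ) * s p.2 = q.1 * s q.2 := h
        rw [h2] at h'
        exact mul_right_cancel h'
      exact Prod.ext (Subtype.ext h1) h2
    · intro v
      let l : unitLattice K := ⟨logEmbedding K (Additive.ofMul v), Additive.ofMul v, trivial, rfl⟩
      have ht : v * (s l)⁻¹ ∈ torsion K := by
        rw [← logEmbedding_eq_zero_iff, ofMul_mul, map_add, ofMul_inv, map_neg, hs]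
        simp [l]
      exact ⟨(⟨_, ht⟩, l), by simp [φ]⟩
  rw [← (Equiv.ofBijective φ hφ).tsum_eq]
  simp only [Equiv.ofBijective_apply, hlog]
  have := Fintype.ofFinite (torsion K)
  rw [ENNReal.tsum_prod (f := fun (_ : torsion K) (l : unitLattice K) => g (l : logSpace K)), tsum_fintype, Finset.sum_const,
    Finset.card_univ, nsmul_eq_mul, torsionOrder, ← Nat.card_eq_fintype_card]

lemma tsum_units_lintegral {D : Set (logSpace K)} (hD : IsAddFundamentalDomain (unitLattice K) D volume)
    (g : logSpace K → ENNReal) (c : logSpace K) (ε : ℤˣ) :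
    ∑' v : (𝓞 K)ˣ, ∫⁻ l in D, g (ε • l + (logEmbedding K (Additive.ofMul v) + c)) =
      torsionOrder K * ∫⁻ l, g l := by
  rw [tsum_units fun x => ∫⁻ l in D, g (ε • l + (x + c))]
  congr 1
  have h1 : ∫⁻ l : logSpace K, g l = ∫⁻ l : logSpace K, g (ε • l + c) := by
    rw [← lintegral_add_right_eq_self g c]
    rcases Int.units_eq_one_or ε with rfl | rfl
    · simp
    · simp only [Units.neg_smul, one_smul]
      exact (lintegral_neg_eq_self (fun l => g (l + c)) ).symm
  have : VAddInvariantMeasure (unitLattice K) (logSpace K) volume :=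
    inferInstanceAs <| VAddInvariantMeasure (unitLattice K).toAddSubgroup (logSpace K) volume
  rw [h1, hD.lintegral_eq_tsum'']
  rcases Int.units_eq_one_or ε with rfl | rfl
  · refine tsum_congr fun l => lintegral_congr fun x => ?_
    congr 1
    rw [one_smul, one_smul, Submodule.vadd_def, vadd_eq_add]
    abel
  · rw [← (Equiv.neg (unitLattice K)).tsum_eq]
    refine tsum_congr fun l => lintegral_congr fun x => ?_
    congr 1
    rw [Equiv.neg_apply, Units.neg_smul, Units.neg_smul, one_smul, one_smul, Submodule.vadd_def, vadd_eq_add]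
    push_cast
    abel

end Arch

section Unfold

open NumberField.Units NumberField.Units.dirichletUnitTheorem NumberField.InfinitePlace Module
open scoped nonZeroDivisors

variable {K : Type} [Field K] [NumberField K]

/-- The class group, as a quotient of the fractional ideals of `K`. -/
abbrev FracCl (K : Type) [Field K] [NumberField K] := FracU K ⧸ (toPrincipalIdeal (𝓞 K) K).range

instance : Finite (FracCl K) := Finite.of_equiv _ (ClassGroup.equiv (R := 𝓞 K) K).toEquiv

/-- The integral Gaussian attached to the archimedean places, in the logarithmic variable. -/
def hArch (K : Type) [Field K] [NumberField K] (u : ℝ) : ENNReal :=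
  ∫⁻ l : logSpace K, ENNReal.ofReal (gaussArch (archVec u l))

/-- Nonzero integral ideals. -/
abbrev NzIdeal (K : Type) [Field K] [NumberField K] := {I : Ideal (𝓞 K) // I ≠ ⊥}

/-- A nonzero integral ideal as an invertible fractional ideal. -/
def idealU (I : NzIdeal K) : FracU K :=
  Units.mk0 (I.1 : FractionalIdeal (𝓞 K)⁰ K) (FractionalIdeal.coeIdeal_ne_zero.2 I.2)

lemma idealU_injective : Function.Injective (idealU (K := K)) := by
  intro I J h
  apply Subtype.ext
  exact FractionalIdeal.coeIdeal_injective (congrArg Units.val h)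

lemma mem_frac_iff (J : FracU K) (a : Kˣ) :
    (a : K) ∈ (J : FractionalIdeal (𝓞 K)⁰ K) ↔
      ∃ I : NzIdeal K, idealU I * J = toPrincipalIdeal (𝓞 K) K a := by
  rw [← FractionalIdeal.spanSingleton_le_iff_mem, ← coe_toPrincipalIdeal]
  constructor
  · intro h
    have h1 : ((toPrincipalIdeal (𝓞 K) K a * J⁻¹ : FracU K) : FractionalIdeal (𝓞 K)⁰ K) ≤ 1 := by
      rw [← Units.val_one, ← mul_inv_cancel J, Units.val_mul, Units.val_mul]
      exact mul_le_mul_left h _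
    obtain ⟨I, hI⟩ := FractionalIdeal.le_one_iff_exists_coeIdeal.1 h1
    have hI0 : I ≠ ⊥ := by
      rintro rfl
      rw [FractionalIdeal.coeIdeal_bot] at hI
      exact (toPrincipalIdeal (𝓞 K) K a * J⁻¹).ne_zero hI.symm
    refine ⟨⟨I, hI0⟩, ?_⟩
    have : idealU ⟨I, hI0⟩ = toPrincipalIdeal (𝓞 K) K a * J⁻¹ := Units.ext hI
    rw [this, inv_mul_cancel_right]
  · rintro ⟨I, hI⟩
    rw [← hI, Units.val_mul]
    calc ((idealU I : FracU K) : FractionalIdeal (𝓞 K)⁰ K) * J ≤ 1 * J :=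
          mul_le_mul_left FractionalIdeal.coeIdeal_le_one _
      _ = J := one_mul _

lemma principal_eq_iff (a b : Kˣ) : toPrincipalIdeal (𝓞 K) K a = toPrincipalIdeal (𝓞 K) K b ↔
    ∃ v : (𝓞 K)ˣ, (b : K) = ((v : 𝓞 K) : K) * a := by
  rw [← Units.val_inj, coe_toPrincipalIdeal, coe_toPrincipalIdeal]
  have h := FractionalIdeal.coeToSubmodule_inj (I := FractionalIdeal.spanSingleton (𝓞 K)⁰ (a : K))
    (J := FractionalIdeal.spanSingleton (𝓞 K)⁰ (b : K))
  rw [FractionalIdeal.coe_spanSingleton, FractionalIdeal.coe_spanSingleton] at h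
  rw [← h, Submodule.span_singleton_eq_span_singleton]
  constructor
  · rintro ⟨v, hv⟩
    exact ⟨v, by rw [← hv, Units.smul_def, Algebra.smul_def]⟩
  · rintro ⟨v, hv⟩
    exact ⟨v, by rw [hv, Units.smul_def, Algebra.smul_def]⟩

lemma tsum_split_zero (J : FracU K) (f : K → ENNReal) :
    ∑' α : {α : K // α ∈ (J : FractionalIdeal (𝓞 K)⁰ K)}, f α.1 =
      f 0 + ∑' a : Kˣ, if (a : K) ∈ (J : FractionalIdeal (𝓞 K)⁰ K) then f a else 0 := by
  have h1 := tsum_subtype {α : K | α ∈ (J : FractionalIdeal (𝓞 K)⁰ K)} f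
  have h2 : ∑' α : {α : K // α ∈ (J : FractionalIdeal (𝓞 K)⁰ K)}, f α.1 =
    ∑' x : K, ({α : K | α ∈ (J : FractionalIdeal (𝓞 K)⁰ K)}).indicator f x := h1
  have h3 : ({α : K | α ∈ (J : FractionalIdeal (𝓞 K)⁰ K)}).indicator f 0 = f 0 :=
    Set.indicator_of_mem (show (0 : K) ∈ (J : FractionalIdeal (𝓞 K)⁰ K) from FractionalIdeal.zero_mem _) f
  rw [h2, ENNReal.tsum_eq_add_tsum_ite 0, h3]
  congr 1
  have hinj : Function.Injective (fun a : Kˣ => (a : K)) := fun a b h => Units.ext h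
  rw [← hinj.tsum_eq]
  · refine tsum_congr fun a => ?_
    rw [if_neg a.ne_zero]
    rfl
  · intro x hx
    rw [Function.mem_support] at hx
    have : x ≠ 0 := by
      rintro rfl
      simp at hx
    exact ⟨Units.mk0 x this, rfl⟩

lemma tsum_class_units (J : FracCl K → FracU K)
    (hJ : Function.Bijective fun C => (QuotientGroup.mk (J C) : FracCl K))
    (F : FracCl K → Kˣ → ENNReal) :
    ∃ (c : NzIdeal K → FracCl K) (a : NzIdeal K → Kˣ),
      (∀ I, idealU I * J (c I) = toPrincipalIdeal (𝓞 K) K (a I)) ∧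
      ∑' C, ∑' b : Kˣ, (if (b : K) ∈ (J C : FractionalIdeal (𝓞 K)⁰ K) then F C b else 0) =
        ∑' I, ∑' v : (𝓞 K)ˣ, F (c I) (Units.map (algebraMap (𝓞 K) K).toMonoidHom v * a I) := by
  have hex : ∀ I : NzIdeal K, ∃ (C : FracCl K) (a : Kˣ),
      idealU I * J C = toPrincipalIdeal (𝓞 K) K a := by
    intro I
    obtain ⟨C, hC⟩ := hJ.2 (QuotientGroup.mk (idealU I))⁻¹
    have : (QuotientGroup.mk (idealU I * J C) : FracCl K) = 1 := by
      rw [QuotientGroup.mk_mul]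
      simp only at hC
      rw [hC, mul_inv_cancel]
    rw [QuotientGroup.eq_one_iff] at this
    obtain ⟨a, ha⟩ := this
    exact ⟨C, a, ha.symm⟩
  choose c a hca using hex
  refine ⟨c, a, hca, ?_⟩
  have hunit : ∀ v : (𝓞 K)ˣ, toPrincipalIdeal (𝓞 K) K (Units.map (algebraMap (𝓞 K) K).toMonoidHom v) = 1 := by
    intro v
    rw [← map_one (toPrincipalIdeal (𝓞 K) K), eq_comm, principal_eq_iff]
    exact ⟨v, by simp⟩
  let Ψ : NzIdeal K × (𝓞 K)ˣ → FracCl K × Kˣ := fun p =>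
    (c p.1, Units.map (algebraMap (𝓞 K) K).toMonoidHom p.2 * a p.1)
  have hΨinj : Function.Injective Ψ := by
    intro p q h
    have h1 : c p.1 = c q.1 := congrArg Prod.fst h
    have h2 : Units.map (algebraMap (𝓞 K) K).toMonoidHom p.2 * a p.1 =
      Units.map (algebraMap (𝓞 K) K).toMonoidHom q.2 * a q.1 := congrArg Prod.snd h
    have h3 := congrArg (toPrincipalIdeal (𝓞 K) K) h2
    rw [map_mul, map_mul, hunit, hunit, one_mul, one_mul, ← hca, ← hca, h1] at h3
    have h4 : p.1 = q.1 := idealU_injective (mul_right_cancel h3)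
    rw [h4] at h2
    have h5 := mul_right_cancel h2
    have h6 : p.2 = q.2 := by
      apply Units.ext
      apply FaithfulSMul.algebraMap_injective (𝓞 K) K
      exact congrArg Units.val h5
    exact Prod.ext h4 h6
  have hsupp : Function.support (fun p : FracCl K × Kˣ =>
      if (p.2 : K) ∈ (J p.1 : FractionalIdeal (𝓞 K)⁰ K) then F p.1 p.2 else 0) ⊆ Set.range Ψ := by
    rintro ⟨C, b⟩ hb
    rw [Function.mem_support] at hb
    have hb' : (b : K) ∈ (J C : FractionalIdeal (𝓞 K)⁰ K) := by
      by_contra h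
      exact hb (if_neg h)
    obtain ⟨I, hI⟩ := (mem_frac_iff _ _).1 hb'
    have hC : c I = C := by
      apply hJ.1
      have e1 : (QuotientGroup.mk (idealU I) : FracCl K) * QuotientGroup.mk (J (c I)) = 1 := by
        rw [← QuotientGroup.mk_mul, QuotientGroup.eq_one_iff, hca]
        exact ⟨_, rfl⟩
      have e2 : (QuotientGroup.mk (idealU I) : FracCl K) * QuotientGroup.mk (J C) = 1 := by
        rw [← QuotientGroup.mk_mul, QuotientGroup.eq_one_iff, hI]
        exact ⟨_, rfl⟩
      exact mul_left_cancel (e1.trans e2.symm)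
    have h7 := hca I
    rw [hC, hI, eq_comm, principal_eq_iff] at h7
    obtain ⟨v, hv⟩ := h7
    refine ⟨(I, v), ?_⟩
    exact Prod.ext hC (Units.ext hv.symm)
  rw [← ENNReal.tsum_prod, ← hΨinj.tsum_eq hsupp, ENNReal.tsum_prod']
  refine tsum_congr fun I => tsum_congr fun v => if_pos ?_
  rw [mem_frac_iff]
  refine ⟨I, ?_⟩
  rw [hca, map_mul, hunit, one_mul]

lemma absNorm_idealU (I : NzIdeal K) :
    FractionalIdeal.absNorm ((idealU I : FracU K) : FractionalIdeal (𝓞 K)⁰ K) = Ideal.absNorm I.1 :=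
  FractionalIdeal.coeIdeal_absNorm I.1

lemma thetaIdeal_split (J : FracU K) (T : InfinitePlace K → ℝ) :
    thetaIdeal J T = 1 + ∑' a : Kˣ, if (a : K) ∈ (J : FractionalIdeal (𝓞 K)⁰ K) then
      ENNReal.ofReal (Real.exp (-Real.pi * quadPlace T (a : K))) else 0 := by
  rw [thetaIdeal, tsum_split_zero J fun α => ENNReal.ofReal (Real.exp (-Real.pi * quadPlace T α))]
  simp [quadPlace]

instance : Countable Kˣ := by
  have : Countable K := (Module.finBasis ℚ K).equivFun.toEquiv.countable_iff.2 inferInstance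
  exact Function.Injective.countable (f := fun a : Kˣ => (a : K)) fun a b h => Units.ext h

lemma unfold_theta {D : Set (logSpace K)} (hD : IsAddFundamentalDomain (unitLattice K) D volume)
    (ε : ℤˣ) (J : FracCl K → FracU K)
    (hJ : Function.Bijective fun C => (QuotientGroup.mk (J C) : FracCl K)) (τ : ℝ) :
    ∑' C, ∫⁻ l in D, thetaIdeal (J C) (expPlace (archVec (τ - Real.log (covolIdeal (J C))) (ε • l))) =
      Nat.card (FracCl K) * volume D +
        torsionOrder K * ∑' I : NzIdeal K,
          hArch K (τ + Real.log (Ideal.absNorm I.1) - Real.log √|(discr K : ℝ)|) := by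
  have hmeas : ∀ u, Measurable fun l : logSpace K => gaussArch (archVec u (ε • l)) := by
    intro u
    apply Continuous.measurable
    refine continuous_gaussArch.comp ?_
    refine continuous_pi fun w => ?_
    unfold archVec
    split_ifs
    · fun_prop
    · fun_prop
  let F : FracCl K → Kˣ → ENNReal := fun C a => ∫⁻ l in D, ENNReal.ofReal (Real.exp (-Real.pi *
    quadPlace (expPlace (archVec (τ - Real.log (covolIdeal (J C))) (ε • l))) (a : K)))
  have h1 : ∀ C, ∫⁻ l in D, thetaIdeal (J C) (expPlace (archVec (τ - Real.log (covolIdeal (J C))) (ε • l))) =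
      volume D + ∑' a : Kˣ, if (a : K) ∈ (J C : FractionalIdeal (𝓞 K)⁰ K) then F C a else 0 := by
    intro C
    simp only [thetaIdeal_split]
    rw [lintegral_add_left measurable_const, setLIntegral_one, lintegral_tsum]
    · congr 1
      refine tsum_congr fun a => ?_
      split_ifs
      · rfl
      · simp
    · intro a
      split_ifs
      · refine Measurable.aemeasurable ?_
        refine ENNReal.measurable_ofReal.comp ?_
        apply Continuous.measurable
        unfold quadPlace expPlace
        refine Real.continuous_exp.comp (continuous_const.mul (continuous_finsetSum _ fun w _ => ?_))
        unfold archVec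
        split_ifs <;> fun_prop
      · exact aemeasurable_const
  simp only [h1]
  rw [ENNReal.tsum_add, ENNReal.tsum_const, ENat.card_eq_coe_natCard]
  congr 1
  obtain ⟨c, a, hca, hsum⟩ := tsum_class_units J hJ F
  rw [hsum, ← ENNReal.tsum_mul_left]
  refine tsum_congr fun I => ?_
  rw [hArch, ← tsum_units_lintegral hD _ (logPlace₀ (a I : K)) ε]
  refine tsum_congr fun v => lintegral_congr fun l => ?_
  have hv0 : ((v : 𝓞 K) : K) ≠ 0 := (Units.map (algebraMap (𝓞 K) K).toMonoidHom v).ne_zero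
  have hval : ((Units.map (algebraMap (𝓞 K) K).toMonoidHom v * a I : Kˣ) : K) = ((v : 𝓞 K) : K) * a I := rfl
  rw [exp_quadPlace_archVec _ _ (Units.ne_zero _), hval, logPlace₀_mul hv0 (a I).ne_zero, logPlace₀_unit]
  congr 3
  have hN := congrArg (fun x : FracU K => (FractionalIdeal.absNorm (x : FractionalIdeal (𝓞 K)⁰ K) : ℚ)) (hca I)
  simp only [Units.val_mul, map_mul, absNorm_idealU, coe_toPrincipalIdeal,
    FractionalIdeal.absNorm_span_singleton] at hN
  have hN' : (Ideal.absNorm I.1 : ℝ) * (FractionalIdeal.absNorm ((J (c I) : FracU K) : FractionalIdeal (𝓞 K)⁰ K) : ℝ) =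
      |(Algebra.norm ℚ (a I : K) : ℝ)| := by
    have := congrArg (fun q : ℚ => (q : ℝ)) hN
    push_cast at this
    exact this
  have hc := covolIdeal_pos (J (c I))
  have hpos : 0 < (Ideal.absNorm I.1 : ℝ) := by
    exact_mod_cast Nat.pos_of_ne_zero (Ideal.absNorm_ne_zero_iff_mem_nonZeroDivisors.2
      (mem_nonZeroDivisors_of_ne_zero I.2))
  rw [covolIdeal] at hc ⊢
  have hd : √|(discr K : ℝ)| ≠ 0 := left_ne_zero_of_mul hc.ne'
  have hJ0 := right_ne_zero_of_mul hc.ne'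
  rw [map_mul, Rat.cast_mul, abs_mul, abs_norm_unit, one_mul, ← hN', Real.log_mul hd hJ0,
    Real.log_mul hpos.ne' hJ0]
  ring

end Unfold

section Hecke

open NumberField.Units NumberField.Units.dirichletUnitTheorem NumberField.InfinitePlace Module
open scoped nonZeroDivisors

variable {K : Type} [Field K] [NumberField K]

variable (K) in
lemma exists_unit_domain : ∃ D : Set (logSpace K), IsAddFundamentalDomain (unitLattice K) D volume ∧
    volume D ≠ 0 ∧ volume D ≠ ⊤ := by
  let b := basisUnitLattice K
  refine ⟨ZSpan.fundamentalDomain (b.ofZLatticeBasis ℝ (unitLattice K)),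
    ZLattice.isAddFundamentalDomain b volume, ZSpan.measure_fundamentalDomain_ne_zero _,
    (ZSpan.fundamentalDomain_isBounded _).measure_lt_top.ne⟩

/-- The sum over nonzero ideals of the integrated Gaussian. -/
def thetaSum (K : Type) [Field K] [NumberField K] (τ : ℝ) : ENNReal :=
  ∑' I : NzIdeal K, hArch K (τ + Real.log (Ideal.absNorm I.1) - Real.log √|(discr K : ℝ)|)

lemma dual_class (J : FracU K) : dualIdeal J = J⁻¹ * dualIdeal 1 := by
  apply Units.ext
  rw [Units.val_mul, Units.val_inv_eq_inv_val]
  change FractionalIdeal.dual ℤ ℚ _ = _ * FractionalIdeal.dual ℤ ℚ _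
  rw [FractionalIdeal.dual_eq_mul_inv, Units.val_one, mul_comm]

lemma dual_bijective (J : FracCl K → FracU K)
    (hJ : Function.Bijective fun C => (QuotientGroup.mk (J C) : FracCl K)) :
    Function.Bijective fun C => (QuotientGroup.mk (dualIdeal (J C)) : FracCl K) := by
  have : (fun C => (QuotientGroup.mk (dualIdeal (J C)) : FracCl K)) =
      (Equiv.mulRight (QuotientGroup.mk (dualIdeal 1) : FracCl K)) ∘ (Equiv.inv (FracCl K)) ∘
        fun C => (QuotientGroup.mk (J C) : FracCl K) := by
    funext C
    simp only [Function.comp, Equiv.coe_mulRight, Equiv.inv_apply]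
    rw [dual_class, QuotientGroup.mk_mul, QuotientGroup.mk_inv]
  rw [this]
  exact (Equiv.bijective _).comp ((Equiv.bijective _).comp hJ)

variable (K) in
lemma thetaSum_functional : ∃ κ : ENNReal, κ ≠ 0 ∧ κ ≠ ⊤ ∧ ∀ τ : ℝ,
    κ + torsionOrder K * thetaSum K τ =
      ENNReal.ofReal (Real.exp (-τ)) * (κ + torsionOrder K * thetaSum K (-τ)) := by
  obtain ⟨D, hD, hD0, hDt⟩ := exists_unit_domain K
  refine ⟨Nat.card (FracCl K) * volume D, ?_, ?_, fun τ => ?_⟩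
  · refine mul_ne_zero ?_ hD0
    exact_mod_cast Nat.card_pos.ne'
  · exact ENNReal.mul_ne_top (ENNReal.natCast_ne_top _) hDt
  let J : FracCl K → FracU K := Quotient.out
  have hJ : Function.Bijective fun C => (QuotientGroup.mk (J C) : FracCl K) := by
    have : (fun C => (QuotientGroup.mk (J C) : FracCl K)) = id := by
      funext C
      exact Quotient.out_eq C
    rw [this]
    exact Function.bijective_id
  have h1 := unfold_theta hD 1 J hJ τ
  have h2 := unfold_theta hD (-1) (fun C => dualIdeal (J C)) (dual_bijective J hJ) (-τ)
  rw [thetaSum, thetaSum, ← h1, ← h2, ← ENNReal.tsum_mul_left]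
  refine tsum_congr fun C => ?_
  rw [← lintegral_const_mul']
  swap
  · exact ENNReal.ofReal_ne_top
  refine lintegral_congr fun l => ?_
  have hc := covolIdeal_pos (J C)
  have hcd : Real.log (covolIdeal (dualIdeal (J C))) = -Real.log (covolIdeal (J C)) := by
    rw [← Real.log_inv, eq_inv_of_mul_eq_one_right (covolIdeal_mul_dual (J C))]
  rw [one_smul, thetaIdeal_functional _ _ (expPlace_pos _), prodPlace_expPlace, sum_archVec,
    ← expPlace_neg]
  congr 2
  · rw [Real.exp_sub, Real.exp_log hc, mul_div_cancel₀ _ hc.ne', Real.exp_neg]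
  · rw [hcd, ← neg_one_smul ℝ (archVec _ l), ← archVec_smul]
    congr 2
    · ring
    · simp

lemma hArch_antitone : Antitone (hArch K) := by
  intro u v huv
  refine lintegral_mono fun l => ENNReal.ofReal_le_ofReal ?_
  unfold gaussArch quadPlace expPlace
  refine Real.exp_le_exp.2 (mul_le_mul_of_nonpos_left ?_ (by linarith [Real.pi_pos]))
  refine Finset.sum_le_sum fun w _ => ?_
  have : archVec u l w ≤ archVec v l w := by
    unfold archVec
    have := finrank_pos (R := ℚ) (M := K)
    gcongr
  gcongr

lemma thetaSum_antitone : Antitone (thetaSum K) := by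
  intro u v huv
  refine ENNReal.tsum_le_tsum fun I => hArch_antitone ?_
  linarith

end Hecke

section Mellin

open NumberField.Units NumberField.Units.dirichletUnitTheorem NumberField.InfinitePlace Module
open scoped nonZeroDivisors

variable {K : Type} [Field K] [NumberField K]

lemma integral_comp_exp_univ (g : ℝ → ℝ) :
    ∫ x, Real.exp x * g (Real.exp x) = ∫ t in Set.Ioi 0, g t := by
  have h := integral_image_eq_integral_abs_deriv_smul (s := Set.univ) (f := Real.exp) (f' := Real.exp)
    MeasurableSet.univ (fun x _ => (Real.hasDerivAt_exp x).hasDerivWithinAt)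
    Real.exp_injective.injOn g
  rw [Set.image_univ, Real.range_exp, Measure.restrict_univ] at h
  rw [h]
  simp

lemma integrable_comp_exp_univ (g : ℝ → ℝ) :
    Integrable (fun x => Real.exp x * g (Real.exp x)) ↔ IntegrableOn g (Set.Ioi 0) := by
  have h := integrableOn_image_iff_integrableOn_abs_deriv_smul (s := Set.univ) (f := Real.exp)
    (f' := Real.exp)
    MeasurableSet.univ (fun x _ => (Real.hasDerivAt_exp x).hasDerivWithinAt)
    Real.exp_injective.injOn g
  rw [Set.image_univ, Real.range_exp, integrableOn_univ] at h
  rw [h]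
  simp

lemma mellin_gauss_aux (σ n x : ℝ) :
    Real.exp (σ * x) * Real.exp (-Real.pi * (n * Real.exp (2 * (x / n)))) =
      Real.exp x * ((Real.exp x) ^ (σ - 1) * Real.exp (-(Real.pi * n) * (Real.exp x) ^ (2 / n))) := by
  rw [← Real.exp_mul, ← Real.exp_mul, show 2 * (x / n) = x * (2 / n) by ring,
    ← mul_assoc (Real.exp x), ← Real.exp_add x]
  congr 2
  · ring
  · ring

lemma integrable_mellin_gauss {σ n : ℝ} (hσ : 0 < σ) (hn : 0 < n) :
    Integrable fun x => Real.exp (σ * x) * Real.exp (-Real.pi * (n * Real.exp (2 * (x / n)))) := by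
  simp only [mellin_gauss_aux]
  rw [integrable_comp_exp_univ fun t => t ^ (σ - 1) * Real.exp (-(Real.pi * n) * t ^ (2 / n))]
  exact integrableOn_rpow_mul_exp_neg_mul_rpow (by linarith) (by positivity) (by positivity)

lemma integral_mellin_gauss {σ n : ℝ} (hσ : 0 < σ) (hn : 0 < n) :
    ∫ x, Real.exp (σ * x) * Real.exp (-Real.pi * (n * Real.exp (2 * (x / n)))) =
      (Real.pi * n) ^ (-(n * σ / 2)) * (n / 2) * Real.Gamma (n * σ / 2) := by
  simp only [mellin_gauss_aux]
  rw [integral_comp_exp_univ fun t => t ^ (σ - 1) * Real.exp (-(Real.pi * n) * t ^ (2 / n)),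
    _root_.integral_rpow_mul_exp_neg_mul_rpow (by positivity) (by linarith) (by positivity)]
  have : n ≠ 0 := hn.ne'
  rw [show -(σ - 1 + 1) / (2 / n) = -(n * σ / 2) by field_simp; ring,
    show (σ - 1 + 1) / (2 / n) = n * σ / 2 by field_simp; ring, one_div_div]

variable (K) in
lemma lintegral_hArch : ∃ c : ℝ, 0 < c ∧ ∀ σ : ℝ, 0 < σ →
    ∫⁻ u, hArch K u * ENNReal.ofReal (Real.exp (σ * u)) =
      ENNReal.ofReal (c * ∏ w : InfinitePlace K, ((Real.pi * mult w) ^ (-(mult w * σ / 2)) *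
        ((mult w : ℝ) / 2) * Real.Gamma (mult w * σ / 2))) := by
  let A : (ℝ × logSpace K) ≃L[ℝ] (InfinitePlace K → ℝ) := (archEquiv K).toContinuousLinearEquiv
  let μ : Measure (InfinitePlace K → ℝ) := Measure.map A ((volume : Measure ℝ).prod (volume : Measure (logSpace K)))
  have : μ.IsAddHaarMeasure := A.isAddHaarMeasure_map _
  have hμ : μ = μ.addHaarScalarFactor volume • volume := Measure.isAddLeftInvariant_eq_smul μ volume
  have hc0 : 0 < μ.addHaarScalarFactor volume := Measure.addHaarScalarFactor_pos_of_isAddHaarMeasure _ _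
  refine ⟨μ.addHaarScalarFactor volume, hc0, fun σ hσ => ?_⟩
  have hcont : ∀ u : ℝ, Continuous fun l : logSpace K => gaussArch (archVec u l) := by
    intro u
    exact continuous_gaussArch.comp (A.continuous.comp (by fun_prop : Continuous fun l : logSpace K => (u, l)))
  have hm : Continuous fun p : ℝ × logSpace K => gaussArch (archVec p.1 p.2) * Real.exp (σ * p.1) :=
    (continuous_gaussArch.comp A.continuous).mul (by fun_prop)
  have h1 : ∀ u, hArch K u * ENNReal.ofReal (Real.exp (σ * u)) =
      ∫⁻ l : logSpace K, ENNReal.ofReal (gaussArch (archVec u l) * Real.exp (σ * u)) := by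
    intro u
    rw [hArch, ← lintegral_mul_const _ (f := fun l => ENNReal.ofReal (gaussArch (archVec u l)))
      (ENNReal.measurable_ofReal.comp (hcont u).measurable)]
    refine lintegral_congr fun l => ?_
    rw [← ENNReal.ofReal_mul]
    exact (Real.exp_pos _).le
  simp only [h1]
  have hm' : Measurable fun p : ℝ × logSpace K =>
      ENNReal.ofReal (gaussArch (archVec p.1 p.2) * Real.exp (σ * p.1)) :=
    ENNReal.measurable_ofReal.comp hm.measurable
  rw [← lintegral_prod (μ := volume) (ν := volume) _ hm'.aemeasurable]
  let g : (InfinitePlace K → ℝ) → ℝ := fun x => ∏ w, (Real.exp (σ * x w) *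
    Real.exp (-Real.pi * (mult w * Real.exp (2 * (x w / mult w)))))
  have hg : ∀ p : ℝ × logSpace K, gaussArch (archVec p.1 p.2) * Real.exp (σ * p.1) = g (A p) := by
    intro p
    change _ = g (archVec p.1 p.2)
    simp only [g]
    rw [Finset.prod_mul_distrib, ← Real.exp_sum, ← Finset.mul_sum, sum_archVec, ← gaussArch_eq_prod,
      mul_comm]
  have hgc : Continuous g := by
    simp only [g]
    fun_prop
  simp only [hg]
  rw [← lintegral_map (μ := (volume : Measure ℝ).prod (volume : Measure (logSpace K))) (g := A) (f := fun x => ENNReal.ofReal (g x))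
    (ENNReal.measurable_ofReal.comp hgc.measurable) A.continuous.measurable]
  change ∫⁻ x, ENNReal.ofReal (g x) ∂μ = _
  have h2 : ∫⁻ x, ENNReal.ofReal (g x) ∂μ =
      μ.addHaarScalarFactor volume • ∫⁻ x, ENNReal.ofReal (g x) := by
    conv_lhs => rw [hμ]
    rw [lintegral_smul_measure]
  rw [h2, ENNReal.ofReal_mul NNReal.zero_le_coe, ENNReal.ofReal_coe_nnreal, ENNReal.smul_def,
    smul_eq_mul]
  congr 1
  have hint : Integrable g := Integrable.fintype_prod
    (f := fun (w : InfinitePlace K) x => (Real.exp (σ * x) *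
      Real.exp (-Real.pi * (mult w * Real.exp (2 * (x / mult w))))))
    fun w => integrable_mellin_gauss hσ (Nat.cast_pos.2 mult_pos)
  rw [← ofReal_integral_eq_lintegral_ofReal hint]
  · congr 1
    rw [integral_fintype_prod_volume_eq_prod (fun (w : InfinitePlace K) x => (Real.exp (σ * x) *
      Real.exp (-Real.pi * (mult w * Real.exp (2 * (x / mult w))))))]
    refine Finset.prod_congr rfl fun w _ => ?_
    rw [integral_mellin_gauss hσ (Nat.cast_pos.2 mult_pos)]
  · refine Filter.Eventually.of_forall fun x => ?_
    simp only [g, Pi.zero_apply]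
    positivity

/-- The product of archimedean Gamma factors of the Dedekind zeta function. -/
def gammaInf (K : Type) [Field K] [NumberField K] (s : ℂ) : ℂ :=
  Gammaℝ s ^ nrRealPlaces K * Gammaℂ s ^ nrComplexPlaces K

variable (K) in
lemma prod_mellin_gauss (σ : ℝ) :
    ((∏ w : InfinitePlace K, ((Real.pi * mult w) ^ (-(mult w * σ / 2)) *
        ((mult w : ℝ) / 2) * Real.Gamma (mult w * σ / 2)) : ℝ) : ℂ) =
      (1 / 2) ^ (nrRealPlaces K + nrComplexPlaces K) * gammaInf K σ := by
  have h1 : ∀ w : InfinitePlace K, (((Real.pi * mult w) ^ (-(mult w * σ / 2)) *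
        ((mult w : ℝ) / 2) * Real.Gamma (mult w * σ / 2) : ℝ) : ℂ) =
      if IsReal w then 1 / 2 * Gammaℝ σ else 1 / 2 * Gammaℂ σ := by
    intro w
    split_ifs with h
    · rw [mult, if_pos h, Gammaℝ_def, ofReal_mul, ofReal_mul, ofReal_cpow (by positivity),
        ← Complex.Gamma_ofReal]
      push_cast
      simp only [mul_one, one_mul, neg_div]
      ring
    · rw [mult, if_neg h, Gammaℂ_def, ofReal_mul, ofReal_mul, ofReal_cpow (by positivity),
        ← Complex.Gamma_ofReal]
      push_cast
      rw [show (2 : ℂ) * σ / 2 = σ by ring, mul_comm (Real.pi : ℂ) 2]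
      ring
  rw [ofReal_prod, Finset.prod_congr rfl fun w _ => h1 w, Finset.prod_ite, Finset.prod_const,
    Finset.prod_const, gammaInf, mul_pow, mul_pow, pow_add, ← Fintype.card_subtype,
    ← Fintype.card_subtype]
  simp only [not_isReal_iff_isComplex]
  ring

variable (K) in
lemma summable_norm_rpow {σ : ℝ} (hσ : 1 < σ) :
    Summable fun I : NzIdeal K => (Ideal.absNorm I.1 : ℝ) ^ (-σ) := by
  let a : ℕ → ℝ := fun n => Nat.card {I : Ideal (𝓞 K) // Ideal.absNorm I = n}
  have h1 : LSeriesSummable (fun n => (a n : ℂ)) σ := by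
    refine LSeriesSummable_of_sum_norm_bigO_and_nonneg (r := 1) ?_ (fun _ => Nat.cast_nonneg _)
      zero_le_one (by simpa)
    simp only [Real.rpow_one]
    have h2 : Tendsto (fun n : ℕ => (∑ k ∈ Finset.Icc 1 n, a k) / n) atTop (𝓝 (dedekindZeta_residue K)) := by
      refine ((Ideal.tendsto_norm_le_div_atTop₀ K).comp tendsto_natCast_atTop_atTop).congr fun n ↦ ?_
      simp only [Function.comp_apply, Nat.cast_le, a, ← Nat.cast_sum]
      congr
      rw [← add_left_inj 1, ← Ideal.card_norm_le_eq_card_norm_le_add_one,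
        show Finset.Icc 1 n = Finset.Ioc 0 n from Finset.Icc_succ_left_eq_Ioc _ _,
        show 1 = Nat.card {I : Ideal (𝓞 K) // Ideal.absNorm I = 0} by simp [Ideal.absNorm_eq_zero_iff],
        Finset.sum_Ioc_add_eq_sum_Icc (n.zero_le),
        ← Finset.card_preimage_eq_sum_card_image_eq (fun k _ ↦ Ideal.finite_setOfPred_absNorm_eq k)]
      simp [Set.coe_eq_subtype]
    refine Asymptotics.isBigO_of_div_tendsto_nhds ?_ _ h2
    filter_upwards [eventually_ne_atTop 0] with n hn h0
    exact absurd (by exact_mod_cast h0) hn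
  have h3 : Summable fun n : ℕ => a n * (n : ℝ) ^ (-σ) := by
    refine (h1.norm.of_nonneg_of_le (fun n => ?_) (fun n => ?_) :
      Summable fun n : ℕ => if n = 0 then 0 else a n * (n : ℝ) ^ (-σ)).congr_cofinite ?_
    · split_ifs
      · rfl
      · positivity
    · split_ifs with h
      · positivity
      · rw [LSeries.term_of_ne_zero h, norm_div, Complex.norm_natCast_cpow_of_pos (Nat.pos_of_ne_zero h),
          Real.rpow_neg (Nat.cast_nonneg _), ofReal_re, ← div_eq_mul_inv, Complex.norm_real,
          Real.norm_of_nonneg (Nat.cast_nonneg _)]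
    · refine Set.Finite.subset (Set.finite_singleton 0) fun n hn => ?_
      by_contra h
      exact hn (if_neg h)
  have hfin : ∀ n, Finite {I : Ideal (𝓞 K) // Ideal.absNorm I = n} := fun n =>
    (Ideal.finite_setOfPred_absNorm_eq n).to_subtype
  have hinj : ∀ n, Function.Injective (fun I : {I : NzIdeal K // Ideal.absNorm I.1 = n} =>
      (⟨I.1.1, I.2⟩ : {I : Ideal (𝓞 K) // Ideal.absNorm I = n})) := fun n I J h =>
    Subtype.ext (Subtype.ext (by simpa using h))
  have hfin' : ∀ n, Finite {I : NzIdeal K // Ideal.absNorm I.1 = n} := fun n =>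
    Finite.of_injective _ (hinj n)
  rw [← (Equiv.sigmaFiberEquiv fun I : NzIdeal K => Ideal.absNorm I.1).summable_iff]
  rw [summable_sigma_of_nonneg fun p => by simp only [Function.comp]; positivity]
  have hval : ∀ n (I : {I : NzIdeal K // Ideal.absNorm I.1 = n}),
      ((fun I : NzIdeal K => (Ideal.absNorm I.1 : ℝ) ^ (-σ)) ∘
        (Equiv.sigmaFiberEquiv fun I : NzIdeal K => Ideal.absNorm I.1)) ⟨n, I⟩ = (n : ℝ) ^ (-σ) := by
    rintro n ⟨I, rfl⟩
    rfl
  refine ⟨fun n => ?_, ?_⟩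
  · exact Summable.of_finite
  · refine h3.of_nonneg_of_le (fun n => tsum_nonneg fun I => by rw [hval]; positivity) fun n => ?_
    simp only [hval, tsum_const, nsmul_eq_mul]
    gcongr
    exact Nat.cast_le.2 (Nat.card_le_card_of_injective _ (hinj n))

end Mellin

section HeckeZeta

open NumberField.Units NumberField.Units.dirichletUnitTheorem NumberField.InfinitePlace Module

variable {K : Type} [Field K] [NumberField K]

lemma absNorm_pos (I : NzIdeal K) : 0 < Ideal.absNorm I.1 :=
  Nat.pos_of_ne_zero (Ideal.absNorm_ne_zero_iff_mem_nonZeroDivisors.2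
    (mem_nonZeroDivisors_of_ne_zero I.2))

instance : Countable (NzIdeal K) := by
  have h : ∀ n, Finite {I : NzIdeal K // Ideal.absNorm I.1 = n} := fun n => by
    have : Finite {I : Ideal (𝓞 K) // Ideal.absNorm I = n} :=
      (Ideal.finite_setOfPred_absNorm_eq n).to_subtype
    exact Finite.of_injective (fun I : {I : NzIdeal K // Ideal.absNorm I.1 = n} =>
      (⟨I.1.1, I.2⟩ : {I : Ideal (𝓞 K) // Ideal.absNorm I = n})) fun I J h =>
        Subtype.ext (Subtype.ext (by simpa using h))
  exact (Equiv.sigmaFiberEquiv fun I : NzIdeal K => Ideal.absNorm I.1).symm.injective.countable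

variable (K) in
lemma lintegral_thetaSum : ∃ c : ℝ, 0 < c ∧ ∀ σ : ℝ, 1 < σ →
    ∃ B : ℝ, 0 ≤ B ∧ (B : ℂ) = c * (√|(discr K : ℝ)| : ℂ) ^ (σ : ℂ) * gammaInf K σ *
      ∑' I : NzIdeal K, (Ideal.absNorm I.1 : ℂ) ^ (-(σ : ℂ)) ∧
    ∫⁻ u, thetaSum K u * ENNReal.ofReal (Real.exp (σ * u)) = ENNReal.ofReal B := by
  obtain ⟨c, hc, h⟩ := lintegral_hArch K
  refine ⟨c * (1 / 2) ^ (nrRealPlaces K + nrComplexPlaces K), by positivity, fun σ hσ => ?_⟩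
  set d : ℝ := √|(discr K : ℝ)| with hd_def
  have hd : 0 < d := Real.sqrt_pos_of_pos (abs_pos.mpr (Int.cast_ne_zero.mpr (discr_ne_zero K)))
  set P : ℝ := ∏ w : InfinitePlace K, ((Real.pi * mult w) ^ (-(mult w * σ / 2)) *
        ((mult w : ℝ) / 2) * Real.Gamma (mult w * σ / 2)) with hP
  have hP0 : 0 ≤ P := by
    refine Finset.prod_nonneg fun w _ => ?_
    have : 0 < Real.Gamma (mult w * σ / 2) := Real.Gamma_pos_of_pos (by
      have : 0 < (mult w : ℝ) := Nat.cast_pos.2 mult_pos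
      positivity)
    positivity
  have hs := summable_norm_rpow (K := K) hσ
  refine ⟨c * P * (d ^ σ * ∑' I : NzIdeal K, (Ideal.absNorm I.1 : ℝ) ^ (-σ)), ?_, ?_, ?_⟩
  · have : 0 ≤ ∑' I : NzIdeal K, (Ideal.absNorm I.1 : ℝ) ^ (-σ) := tsum_nonneg fun I => by positivity
    positivity
  · have hp := prod_mellin_gauss K σ
    rw [← hP] at hp
    push_cast
    rw [hp, ofReal_cpow hd.le]
    have : ∀ I : NzIdeal K, (((Ideal.absNorm I.1 : ℝ) ^ (-σ) : ℝ) : ℂ) = (Ideal.absNorm I.1 : ℂ) ^ (-(σ : ℂ)) := by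
      intro I
      rw [ofReal_cpow (Nat.cast_nonneg _)]
      push_cast
      rfl
    simp only [this]
    ring
  · simp only [thetaSum, ← hd_def, ← ENNReal.tsum_mul_right]
    rw [lintegral_tsum]
    · have h1 : ∀ I : NzIdeal K, ∫⁻ u, hArch K (u + Real.log (Ideal.absNorm I.1) - Real.log d) *
          ENNReal.ofReal (Real.exp (σ * u)) =
          ENNReal.ofReal (c * P) * ENNReal.ofReal (d ^ σ * (Ideal.absNorm I.1 : ℝ) ^ (-σ)) := by
        intro I
        have hN : (0 : ℝ) < Ideal.absNorm I.1 := Nat.cast_pos.2 (absNorm_pos I)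
        rw [← h σ (by linarith), ← lintegral_mul_const',
          ← lintegral_add_right_eq_self (fun u => hArch K u * ENNReal.ofReal (Real.exp (σ * u)) *
            ENNReal.ofReal (d ^ σ * (Ideal.absNorm I.1 : ℝ) ^ (-σ)))
            (Real.log (Ideal.absNorm I.1) - Real.log d)]
        · refine lintegral_congr fun u => ?_
          rw [mul_assoc, ← ENNReal.ofReal_mul (Real.exp_pos _).le, add_sub_assoc]
          congr 2
          rw [Real.rpow_def_of_pos hd, Real.rpow_def_of_pos hN, ← Real.exp_add, ← Real.exp_add]
          congr 1
          ring
        · exact ENNReal.ofReal_ne_top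
      simp only [h1]
      rw [ENNReal.tsum_mul_left, ENNReal.ofReal_mul (mul_nonneg hc.le hP0), ← tsum_mul_left,
        ENNReal.ofReal_tsum_of_nonneg]
      · intro I
        positivity
      · exact hs.mul_left _
    · intro I
      refine Measurable.aemeasurable ?_
      refine Measurable.mul ?_ (by fun_prop)
      exact hArch_antitone.measurable.comp (by fun_prop)

lemma thetaSum_le {σ : ℝ} (hσ : 1 < σ) : ∃ M : ℝ, 0 ≤ M ∧ ∀ τ : ℝ,
    thetaSum K τ ≤ ENNReal.ofReal (M * Real.exp (-(σ * τ))) := by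
  obtain ⟨c, -, h⟩ := lintegral_thetaSum K
  obtain ⟨B, hB0, -, hB⟩ := h σ hσ
  refine ⟨B * Real.exp σ, by positivity, fun τ => ?_⟩
  have h1 : thetaSum K τ * ENNReal.ofReal (Real.exp (σ * (τ - 1))) ≤ ENNReal.ofReal B := by
    rw [← hB]
    calc thetaSum K τ * ENNReal.ofReal (Real.exp (σ * (τ - 1)))
        = ∫⁻ u in Set.Icc (τ - 1) τ, thetaSum K τ * ENNReal.ofReal (Real.exp (σ * (τ - 1))) := by
          simp
      _ ≤ ∫⁻ u in Set.Icc (τ - 1) τ, thetaSum K u * ENNReal.ofReal (Real.exp (σ * u)) := by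
          refine setLIntegral_mono' measurableSet_Icc fun u hu => ?_
          refine mul_le_mul' (thetaSum_antitone hu.2) (ENNReal.ofReal_le_ofReal (Real.exp_le_exp.2 ?_))
          exact mul_le_mul_of_nonneg_left hu.1 (by linarith)
      _ ≤ _ := setLIntegral_le_lintegral _ _
  calc thetaSum K τ = thetaSum K τ * ENNReal.ofReal (Real.exp (σ * (τ - 1))) *
        ENNReal.ofReal (Real.exp (-(σ * (τ - 1)))) := by
        rw [mul_assoc, ← ENNReal.ofReal_mul (Real.exp_pos _).le, ← Real.exp_add, add_neg_cancel,
          Real.exp_zero, ENNReal.ofReal_one, mul_one]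
    _ ≤ ENNReal.ofReal B * ENNReal.ofReal (Real.exp (-(σ * (τ - 1)))) := by gcongr
    _ = _ := by
        rw [← ENNReal.ofReal_mul hB0, mul_assoc, ← Real.exp_add]
        congr 3
        ring

lemma thetaSum_ne_top (τ : ℝ) : thetaSum K τ ≠ ⊤ := by
  obtain ⟨M, -, h⟩ := thetaSum_le (K := K) one_lt_two
  exact ne_top_of_le_ne_top ENNReal.ofReal_ne_top (h τ)

/-- The real-valued theta series of `K`, without its constant term. -/
def thetaRe (K : Type) [Field K] [NumberField K] (t : ℝ) : ℝ :=
  torsionOrder K * (thetaSum K (Real.log t)).toReal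

lemma thetaRe_antitoneOn : AntitoneOn (thetaRe K) (Set.Ioi 0) := by
  intro a ha b hb hab
  refine mul_le_mul_of_nonneg_left ?_ (Nat.cast_nonneg _)
  exact ENNReal.toReal_mono (thetaSum_ne_top _) (thetaSum_antitone (Real.log_le_log ha hab))

lemma thetaRe_le {σ : ℝ} (hσ : 1 < σ) : ∃ M : ℝ, 0 ≤ M ∧ ∀ t : ℝ, 0 < t →
    thetaRe K t ≤ M * t ^ (-σ) := by
  obtain ⟨M, hM, h⟩ := thetaSum_le (K := K) hσ
  refine ⟨torsionOrder K * M, by positivity, fun t ht => ?_⟩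
  rw [thetaRe, mul_assoc]
  refine mul_le_mul_of_nonneg_left ?_ (Nat.cast_nonneg _)
  refine ENNReal.toReal_le_of_le_ofReal (by positivity) ((h _).trans_eq ?_)
  rw [Real.rpow_def_of_pos ht]
  congr 3
  ring

lemma thetaRe_nonneg (t : ℝ) : 0 ≤ thetaRe K t := mul_nonneg (Nat.cast_nonneg _) ENNReal.toReal_nonneg

variable (K) in
lemma thetaRe_functional : ∃ κ : ℝ, 0 < κ ∧ ∀ t : ℝ, 0 < t →
    κ + thetaRe K (1 / t) = t * (κ + thetaRe K t) := by
  obtain ⟨κ, h0, ht, h⟩ := thetaSum_functional K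
  refine ⟨κ.toReal, ENNReal.toReal_pos h0 ht, fun t htp => ?_⟩
  have h1 := congrArg ENNReal.toReal (h (-Real.log t))
  have h2 : ∀ τ, torsionOrder K * thetaSum K τ ≠ ⊤ := fun τ =>
    ENNReal.mul_ne_top (ENNReal.natCast_ne_top _) (thetaSum_ne_top _)
  rw [ENNReal.toReal_mul, ENNReal.toReal_add ht (h2 _), ENNReal.toReal_add ht (h2 _), neg_neg,
    Real.exp_log htp, ENNReal.toReal_ofReal htp.le, ENNReal.toReal_mul, ENNReal.toReal_mul] at h1
  rw [thetaRe, thetaRe, one_div, Real.log_inv]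
  simpa using h1

/-- The functional equation pair of the theta series of `K`. -/
def thetaPair {κ : ℝ} (h : ∀ t : ℝ, 0 < t → κ + thetaRe K (1 / t) = t * (κ + thetaRe K t)) :
    WeakFEPair ℂ :=
  have hint : LocallyIntegrableOn (fun t => ((κ + thetaRe K t : ℝ) : ℂ)) (Set.Ioi 0) := by
    rw [locallyIntegrableOn_iff isOpen_Ioi.isLocallyClosed]
    intro k hk hkc
    refine Integrable.ofReal ?_
    refine AntitoneOn.integrableOn_isCompact hkc fun a ha b hb hab => ?_
    have := thetaRe_antitoneOn (K := K) (hk ha) (hk hb) hab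
    change κ + _ ≤ κ + _
    linarith
  have htop : ∀ r : ℝ, (fun t => ((κ + thetaRe K t : ℝ) : ℂ) - (κ : ℂ)) =O[atTop] fun t => t ^ r := by
    intro r
    obtain ⟨M, hM, hM'⟩ := thetaRe_le (K := K) (lt_max_of_lt_left one_lt_two : 1 < max 2 (-r))
    refine Asymptotics.IsBigO.of_bound M ?_
    filter_upwards [eventually_ge_atTop 1] with t ht
    have ht0 : 0 < t := by linarith
    rw [ofReal_add, add_sub_cancel_left, Complex.norm_real, Real.norm_of_nonneg (thetaRe_nonneg _),
      Real.norm_of_nonneg (by positivity)]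
    refine (hM' t ht0).trans ?_
    gcongr
    linarith [le_max_right 2 (-r)]
  { f := fun t => ((κ + thetaRe K t : ℝ) : ℂ)
    g := fun t => ((κ + thetaRe K t : ℝ) : ℂ)
    k := 1
    ε := 1
    f₀ := κ
    g₀ := κ
    hf_int := hint
    hg_int := hint
    hk := one_pos
    hε := one_ne_zero
    h_feq := by
      intro t ht
      rw [h t ht]
      simp
    hf_top := htop
    hg_top := htop }

lemma thetaPair_symm {κ : ℝ} (h : ∀ t : ℝ, 0 < t → κ + thetaRe K (1 / t) = t * (κ + thetaRe K t)) :
    (thetaPair h).symm = thetaPair h := by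
  simp [WeakFEPair.symm, thetaPair]

end HeckeZeta

section HeckeInterface

open NumberField.Units NumberField.InfinitePlace Module

variable {K : Type} [Field K] [NumberField K]

/-- The reciprocal of the product of archimedean Gamma factors. -/
def gammaInv (K : Type) [Field K] [NumberField K] (s : ℂ) : ℂ :=
  (Gammaℝ s)⁻¹ ^ nrRealPlaces K * (Gammaℂ s)⁻¹ ^ nrComplexPlaces K

lemma differentiable_gammaInv : Differentiable ℂ (gammaInv K) :=
  (differentiable_Gammaℝ_inv.pow _).mul (Complex.differentiable_Gammaℂ_inv.pow _)

lemma gammaInf_mul_inv {s : ℂ} (hs : 0 < s.re) : gammaInf K s * gammaInv K s = 1 := by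
  have h1 : Gammaℝ s ≠ 0 := Gammaℝ_ne_zero_of_re_pos hs
  have h2 : Gammaℂ s ≠ 0 := by
    have hpi : (2 * Real.pi : ℂ) ≠ 0 := by exact_mod_cast (mul_pos two_pos Real.pi_pos).ne'
    rw [Gammaℂ_def]
    exact mul_ne_zero (mul_ne_zero two_ne_zero (by simp [cpow_eq_zero_iff, hpi]))
      (Complex.Gamma_ne_zero_of_re_pos hs)
  rw [gammaInf, gammaInv, inv_pow, inv_pow]
  field_simp

lemma thetaPair_bound {κ : ℝ} (h : ∀ t : ℝ, 0 < t → κ + thetaRe K (1 / t) = t * (κ + thetaRe K t))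
    (a b : ℝ) : ∃ B, 0 ≤ B ∧ ∀ s : ℂ, a ≤ s.re → s.re ≤ b → ‖(thetaPair h).Λ₀ s‖ ≤ B := by
  have hM : ∀ s : ℂ, MellinConvergent (thetaPair h).f_modif s := fun s =>
    ((thetaPair h).isStrongFEPair_toStrongFEPair.hasMellin s).1
  have hi : ∀ c : ℝ, IntegrableOn (fun t : ℝ => t ^ (c - 1) * ‖(thetaPair h).f_modif t‖) (Set.Ioi 0) := by
    intro c
    refine IntegrableOn.congr_fun (μ := volume) (f := fun t : ℝ => ‖(t : ℂ) ^ ((c : ℂ) - 1) • (thetaPair h).f_modif t‖)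
      (hM c).norm (fun t ht => ?_)
      measurableSet_Ioi
    simp only [norm_smul]
    rw [norm_cpow_eq_rpow_re_of_pos ht]
    simp
  refine ⟨∫ t in Set.Ioi (0 : ℝ), (t ^ (a - 1) * ‖(thetaPair h).f_modif t‖ +
    t ^ (b - 1) * ‖(thetaPair h).f_modif t‖), ?_, fun s ha hb => ?_⟩
  · refine setIntegral_nonneg measurableSet_Ioi fun t ht => ?_
    have := le_of_lt (Set.mem_Ioi.1 ht)
    positivity
  rw [WeakFEPair.Λ₀, mellin]
  refine norm_integral_le_of_norm_le ((hi a).add (hi b)) ?_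
  filter_upwards [ae_restrict_mem measurableSet_Ioi] with t ht
  rw [norm_smul, norm_cpow_eq_rpow_re_of_pos ht, ← add_mul]
  refine mul_le_mul_of_nonneg_right ?_ (norm_nonneg _)
  have ht0 : 0 < t := ht
  rw [sub_re, one_re]
  rcases le_total t 1 with h1 | h1
  · have := Real.rpow_le_rpow_of_exponent_ge ht0 h1 (show a - 1 ≤ s.re - 1 by linarith)
    have := Real.rpow_nonneg ht0.le (b - 1)
    linarith
  · have := Real.rpow_le_rpow_of_exponent_le h1 (show s.re - 1 ≤ b - 1 by linarith)
    have := Real.rpow_nonneg ht0.le (a - 1)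
    linarith

/-- Hecke's theorem: continuation, functional equation and growth of the completed zeta function. -/
theorem hecke_completed (Z : ℂ → ℂ) (hZ : IsDedekindZeta K Z) :
    ∃ (E : ℂ → ℂ) (q : ℝ), 0 < q ∧ Differentiable ℂ E ∧ (∀ s, E (1 - s) = E s) ∧ E 0 ≠ 0 ∧
      (∀ s ≠ 1, E s * gammaInv K s = s * (1 - s) * (q : ℂ) ^ s * Z s) ∧
      ∃ C, 0 ≤ C ∧ ∀ s : ℂ, -1 ≤ s.re → s.re ≤ 2 → ‖E s‖ ≤ C * (1 + ‖s‖) ^ 2 := by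
  obtain ⟨κ, hκ, hfe⟩ := thetaRe_functional K
  obtain ⟨c, hc, hmel⟩ := lintegral_thetaSum K
  set P := thetaPair hfe with hP
  have hd : 0 < √|(discr K : ℝ)| :=
    Real.sqrt_pos_of_pos (abs_pos.mpr (Int.cast_ne_zero.mpr (discr_ne_zero K)))
  set d : ℝ := √|(discr K : ℝ)| with hd_def
  have hw : 0 < (torsionOrder K : ℝ) := Nat.cast_pos.2 (torsionOrder_pos K)
  have hval : ∀ σ : ℝ, 1 < σ → P.Λ σ = torsionOrder K * (c * (d : ℂ) ^ (σ : ℂ) * gammaInf K σ * Z σ) := by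
    intro σ hσ
    obtain ⟨B, hB0, hBval, hB⟩ := hmel σ hσ
    rw [hZ.2 σ (by simpa), ← hBval, ← (P.hasMellin (s := σ) (by simpa [hP, thetaPair] using hσ)).2]
    have h1 : ∀ t ∈ Set.Ioi (0 : ℝ), (t : ℂ) ^ ((σ : ℂ) - 1) • (P.f t - P.f₀) =
        ((t ^ (σ - 1) * thetaRe K t : ℝ) : ℂ) := by
      intro t ht
      simp only [hP, thetaPair, smul_eq_mul]
      push_cast
      rw [ofReal_cpow (le_of_lt ht)]
      push_cast
      ring
    rw [mellin, setIntegral_congr_fun measurableSet_Ioi h1, integral_complex_ofReal]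
    rw [← integral_comp_exp_univ]
    have h2 : ∀ u : ℝ, Real.exp u * (Real.exp u ^ (σ - 1) * thetaRe K (Real.exp u)) =
        torsionOrder K * (thetaSum K u * ENNReal.ofReal (Real.exp (σ * u))).toReal := by
      intro u
      rw [thetaRe, Real.log_exp, ENNReal.toReal_mul, ENNReal.toReal_ofReal (Real.exp_pos _).le,
        ← Real.exp_mul, show σ * u = u + u * (σ - 1) by ring, Real.exp_add]
      ring
    simp only [h2]
    rw [integral_const_mul, integral_toReal, hB, ENNReal.toReal_ofReal hB0]
    · push_cast
      rfl
    · exact (thetaSum_antitone.measurable.mul (by fun_prop)).aemeasurable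
    · refine Filter.Eventually.of_forall fun u => ?_
      exact ENNReal.mul_lt_top (thetaSum_ne_top u).lt_top ENNReal.ofReal_lt_top
  let A : ℂ := torsionOrder K * c
  have hA : A ≠ 0 := by
    have : (A : ℂ) = ((torsionOrder K * c : ℝ) : ℂ) := by push_cast; rfl
    rw [this]
    exact_mod_cast (mul_pos hw hc).ne'
  obtain ⟨B, hB0, hB⟩ := thetaPair_bound hfe (-1) 2
  have hsymm : ∀ s, P.Λ₀ (1 - s) = P.Λ₀ s := by
    intro s
    have := P.functional_equation₀ s
    rw [thetaPair_symm] at this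
    simpa [hP, thetaPair] using this
  refine ⟨fun s => (s * (1 - s) * P.Λ₀ s - κ) / A, d, hd, ?_, ?_, ?_, ?_, ?_⟩
  · have := P.differentiable_Λ₀
    fun_prop
  · intro s
    simp only [hsymm]
    ring
  · simp only [zero_mul, zero_sub, ne_eq, div_eq_zero_iff, neg_eq_zero, ofReal_eq_zero, hA, hκ.ne',
      or_self, not_false_eq_true]
  · have key : ∀ σ : ℝ, 1 < σ → ((σ : ℂ) * (1 - σ) * P.Λ₀ σ - κ) / A * gammaInv K σ =
        σ * (1 - σ) * (d : ℂ) ^ (σ : ℂ) * Z σ := by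
      intro σ hσ
      have h1 : (σ : ℂ) ≠ 0 := by exact_mod_cast (by linarith : σ ≠ 0)
      have h2 : (1 : ℂ) - σ ≠ 0 := by
        rw [sub_ne_zero]
        exact_mod_cast hσ.ne
      have h3 : (σ : ℂ) * (1 - σ) * P.Λ₀ σ - κ = σ * (1 - σ) * P.Λ σ := by
        rw [P.Λ₀_eq]
        simp only [hP, thetaPair, smul_eq_mul, ofReal_one]
        field_simp
        ring
      have h4 := gammaInf_mul_inv (K := K) (s := σ) (by simp; linarith)
      rw [h3, hval σ hσ, div_mul_eq_mul_div, div_eq_iff hA]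
      simp only [A]
      linear_combination (σ * (1 - σ) * torsionOrder K * c * (d : ℂ) ^ (σ : ℂ) * Z σ) * h4
    have hconn : IsPreconnected ({1}ᶜ : Set ℂ) :=
      (isConnected_compl_singleton_of_one_lt_rank (by simp) 1).isPreconnected
    have hEq := AnalyticOnNhd.eqOn_of_preconnected_of_frequently_eq (𝕜 := ℂ) (z₀ := (2 : ℂ))
      (U := ({1}ᶜ : Set ℂ))
      (f := fun s => (s * (1 - s) * P.Λ₀ s - κ) / A * gammaInv K s)
      (g := fun s => s * (1 - s) * (d : ℂ) ^ s * Z s) ?_ ?_ hconn (by simp) ?_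
    · intro s hs
      exact hEq hs
    · refine DifferentiableOn.analyticOnNhd (fun s _ => ?_) isOpen_compl_singleton
      have h1 := P.differentiable_Λ₀
      have h2 := differentiable_gammaInv (K := K)
      exact Differentiable.differentiableAt (by fun_prop) |>.differentiableWithinAt
    · refine DifferentiableOn.analyticOnNhd (fun s hs => ?_) isOpen_compl_singleton
      have h1 := hZ.1 s hs
      have h2 : DifferentiableAt ℂ (fun s : ℂ => (d : ℂ) ^ s) s :=
        differentiableAt_id.const_cpow (Or.inl (by exact_mod_cast hd.ne'))
      exact DifferentiableAt.differentiableWithinAt (by fun_prop)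
    · have ht : Tendsto (fun x : ℝ => (x : ℂ)) (𝓝[>] 2) (𝓝[≠] 2) := by
        refine tendsto_nhdsWithin_of_tendsto_nhds_of_eventually_within _ ?_ ?_
        · exact (Complex.continuous_ofReal.tendsto' 2 2 (by simp)).mono_left nhdsWithin_le_nhds
        · filter_upwards [self_mem_nhdsWithin] with x hx
          have hx' : (2 : ℝ) < x := hx
          have : (x : ℂ) ≠ 2 := by exact_mod_cast hx'.ne'
          exact this
      refine ht.frequently (Filter.Eventually.frequently ?_)
      filter_upwards [self_mem_nhdsWithin] with x hx
      have hx' : (2 : ℝ) < x := hx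
      exact key x (by linarith)
  · refine ⟨(B + κ) / ‖A‖, by positivity, fun s h1 h2 => ?_⟩
    rw [norm_div, div_mul_eq_mul_div]
    gcongr
    have hb := hB s h1 h2
    calc ‖s * (1 - s) * P.Λ₀ s - κ‖ ≤ ‖s * (1 - s) * P.Λ₀ s‖ + ‖(κ : ℂ)‖ := norm_sub_le _ _
      _ = ‖s‖ * ‖1 - s‖ * ‖P.Λ₀ s‖ + κ := by
          rw [norm_mul, norm_mul, Complex.norm_real, Real.norm_of_nonneg hκ.le]
      _ ≤ (1 + ‖s‖) * (1 + ‖s‖) * B + κ * (1 + ‖s‖) ^ 2 := by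
          have h3 : ‖1 - s‖ ≤ 1 + ‖s‖ := (norm_sub_le _ _).trans (by simp)
          have h4 : (1 : ℝ) ≤ (1 + ‖s‖) ^ 2 := one_le_pow₀ (by linarith [norm_nonneg s])
          have h5 : ‖s‖ ≤ 1 + ‖s‖ := by linarith
          have h6 : κ ≤ κ * (1 + ‖s‖) ^ 2 := le_mul_of_one_le_right hκ.le h4
          gcongr
      _ = (B + κ) * (1 + ‖s‖) ^ 2 := by ring

end HeckeInterface

section Moebius

open UniqueFactorizationMonoid

variable {K : Type} [Field K] [NumberField K]

lemma moebiusK_eq (I : Ideal (𝓞 K)) :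
    moebiusK K I = if Squarefree I then (-1) ^ (normalizedFactors I).card else 0 := by
  rw [moebiusK, factors_eq_normalizedFactors]

lemma abs_moebiusK_le (I : Ideal (𝓞 K)) : |(moebiusK K I : ℝ)| ≤ 1 := by
  rw [moebiusK]
  split_ifs <;> simp

/-- Squarefree divisors correspond to sets of prime divisors. -/
def sqfreeEquiv {J : Ideal (𝓞 K)} (hJ : J ≠ ⊥) :
    {I : Ideal (𝓞 K) // I ∣ J ∧ Squarefree I} ≃ (normalizedFactors J).toFinset.powerset where
  toFun I := ⟨(normalizedFactors I.1).toFinset, by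
    rw [Finset.mem_powerset]
    exact Multiset.toFinset_subset.2 (Multiset.subset_of_le
      ((dvd_iff_normalizedFactors_le_normalizedFactors (ne_zero_of_dvd_ne_zero hJ I.2.1) hJ).1 I.2.1))⟩
  invFun S := ⟨S.1.val.prod, by
    have hS := Finset.mem_powerset.1 S.2
    have hp : ∀ p ∈ S.1.val, Prime p := fun p hp =>
      prime_of_normalized_factor p (Multiset.mem_toFinset.1 (hS hp))
    have h0 : S.1.val.prod ≠ 0 := Multiset.prod_ne_zero fun h => (hp 0 h).ne_zero rfl
    have hf := normalizedFactors_prod_of_prime hp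
    refine ⟨(dvd_iff_normalizedFactors_le_normalizedFactors h0 hJ).2 ?_, ?_⟩
    · rw [hf, Multiset.le_iff_subset S.1.nodup]
      exact fun p hp => Multiset.mem_toFinset.1 (hS hp)
    · rw [squarefree_iff_nodup_normalizedFactors h0, hf]
      exact S.1.nodup⟩
  left_inv I := by
    ext1
    have h0 := ne_zero_of_dvd_ne_zero hJ I.2.1
    have := (squarefree_iff_nodup_normalizedFactors h0).1 I.2.2
    simp only [Multiset.toFinset_val, this.dedup]
    exact Ideal.prod_normalizedFactors_eq_self h0
  right_inv S := by
    ext1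
    have hS := Finset.mem_powerset.1 S.2
    have hp : ∀ p ∈ S.1.val, Prime p := fun p hp =>
      prime_of_normalized_factor p (Multiset.mem_toFinset.1 (hS hp))
    simp only [normalizedFactors_prod_of_prime hp, Finset.val_toFinset]

lemma tsum_moebiusK_dvd {J : Ideal (𝓞 K)} (hJ : J ≠ ⊥) :
    ∑' I : {I : Ideal (𝓞 K) // I ∣ J}, (moebiusK K I.1 : ℂ) = if J = ⊤ then 1 else 0 := by
  have h1 : ∑' I : {I : Ideal (𝓞 K) // I ∣ J}, (moebiusK K I.1 : ℂ) =
      ∑' I : {I : Ideal (𝓞 K) // I ∣ J ∧ Squarefree I}, (moebiusK K I.1 : ℂ) := by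
    have e1 := tsum_subtype {I : Ideal (𝓞 K) | I ∣ J} (fun I => (moebiusK K I : ℂ))
    have e2 := tsum_subtype {I : Ideal (𝓞 K) | I ∣ J ∧ Squarefree I} (fun I => (moebiusK K I : ℂ))
    refine (e1.trans ?_).trans e2.symm
    congr 1
    funext I
    by_cases h : Squarefree I
    · simp [Set.indicator, h]
    · simp [Set.indicator, h, moebiusK]
  rw [h1, ← (sqfreeEquiv hJ).symm.tsum_eq]
  have h2 : ∀ S : (normalizedFactors J).toFinset.powerset,
      (moebiusK K ((sqfreeEquiv hJ).symm S).1 : ℂ) = (-1) ^ S.1.card := by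
    intro S
    have hS := Finset.mem_powerset.1 S.2
    have hp : ∀ p ∈ S.1.val, Prime p := fun p hp =>
      prime_of_normalized_factor p (Multiset.mem_toFinset.1 (hS hp))
    rw [moebiusK_eq, if_pos ((sqfreeEquiv hJ).symm S).2.2]
    simp only [sqfreeEquiv, Equiv.coe_fn_symm_mk, normalizedFactors_prod_of_prime hp]
    simp
  simp only [h2]
  rw [tsum_fintype, Finset.sum_coe_sort (normalizedFactors J).toFinset.powerset
    (fun S => (-1 : ℂ) ^ S.card)]
  have h3 := congrArg (Int.cast : ℤ → ℂ)
    (Finset.sum_powerset_neg_one_pow_card (x := (normalizedFactors J).toFinset))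
  push_cast at h3
  rw [h3]
  have h4 : (normalizedFactors J).toFinset = ∅ ↔ J = ⊤ := by
    rw [Multiset.toFinset_eq_empty, normalizedFactors_eq_zero_iff (show J ≠ 0 from hJ),
      Ideal.isUnit_iff]
  simp only [h4]

/-- Pairs of nonzero ideals as an ideal with a divisor. -/
def pairEquiv : NzIdeal K × NzIdeal K ≃ Σ J : NzIdeal K, {I : Ideal (𝓞 K) // I ∣ J.1} where
  toFun p := ⟨⟨p.1.1 * p.2.1, mul_ne_zero p.1.2 p.2.2⟩, ⟨p.1.1, dvd_mul_right _ _⟩⟩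
  invFun q := (⟨q.2.1, ne_zero_of_dvd_ne_zero q.1.2 q.2.2⟩,
    ⟨q.2.2.choose, fun h => q.1.2 (by rw [q.2.2.choose_spec, h]; exact mul_zero _)⟩)
  left_inv p := by
    have h := (dvd_mul_right p.1.1 p.2.1).choose_spec
    have := mul_left_cancel₀ (show p.1.1 ≠ 0 from p.1.2) h
    ext1
    · rfl
    · exact Subtype.ext this.symm
  right_inv q := by
    obtain ⟨⟨J, hJ⟩, ⟨I, hI⟩⟩ := q
    have h := hI.choose_spec
    refine Sigma.ext (Subtype.ext h.symm) ?_
    simp only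
    congr 1
    · funext I'
      rw [← h]
    · exact proof_irrel_heq _ _

lemma summable_norm_cpow {s : ℂ} (hs : 1 < s.re) :
    Summable fun I : NzIdeal K => ‖(Ideal.absNorm I.1 : ℂ) ^ (-s)‖ := by
  refine (summable_norm_rpow K hs).congr fun I => ?_
  rw [← ofReal_natCast, norm_cpow_eq_rpow_re_of_pos (by exact_mod_cast absNorm_pos I), neg_re]

lemma norm_moebiusK_mul_le (I : NzIdeal K) (s : ℂ) :
    ‖(moebiusK K I.1 : ℂ) * (Ideal.absNorm I.1 : ℂ) ^ (-s)‖ ≤ (Ideal.absNorm I.1 : ℝ) ^ (-s.re) := by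
  rw [norm_mul, ← ofReal_natCast, norm_cpow_eq_rpow_re_of_pos (by exact_mod_cast absNorm_pos I),
    neg_re]
  refine mul_le_of_le_one_left (by positivity) ?_
  have := abs_moebiusK_le I.1
  rwa [← Real.norm_eq_abs, ← Complex.norm_real, ofReal_intCast] at this

lemma summable_moebiusK {s : ℂ} (hs : 1 < s.re) :
    Summable fun I : NzIdeal K => ‖(moebiusK K I.1 : ℂ) * (Ideal.absNorm I.1 : ℂ) ^ (-s)‖ :=
  Summable.of_nonneg_of_le (fun _ => norm_nonneg _) (fun I => norm_moebiusK_mul_le I s)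
    (summable_norm_rpow K hs)

/-- The Dirichlet series of `1 / ζ_K`. -/
lemma tsum_moebiusK_mul {s : ℂ} (hs : 1 < s.re) :
    (∑' I : NzIdeal K, (moebiusK K I.1 : ℂ) * (Ideal.absNorm I.1 : ℂ) ^ (-s)) *
      ∑' I : NzIdeal K, (Ideal.absNorm I.1 : ℂ) ^ (-s) = 1 := by
  rw [tsum_mul_tsum_of_summable_norm (summable_moebiusK hs) (summable_norm_cpow hs),
    ← pairEquiv.symm.tsum_eq]
  have hsum := summable_mul_of_summable_norm (summable_moebiusK (K := K) hs)
    (summable_norm_cpow (K := K) hs)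
  rw [← pairEquiv.symm.summable_iff] at hsum
  have h1 : ∀ q : Σ J : NzIdeal K, {I : Ideal (𝓞 K) // I ∣ J.1},
      (moebiusK K (pairEquiv.symm q).1.1 : ℂ) * (Ideal.absNorm (pairEquiv.symm q).1.1 : ℂ) ^ (-s) *
        (Ideal.absNorm (pairEquiv.symm q).2.1 : ℂ) ^ (-s) =
      (Ideal.absNorm q.1.1 : ℂ) ^ (-s) * moebiusK K q.2.1 := by
    intro q
    obtain ⟨p, rfl⟩ := pairEquiv.surjective q
    rw [Equiv.symm_apply_apply]
    simp only [pairEquiv, Equiv.coe_fn_mk, map_mul]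
    push_cast
    rw [natCast_mul_natCast_cpow]
    ring
  have hsum' : Summable fun q : Σ J : NzIdeal K, {I : Ideal (𝓞 K) // I ∣ J.1} =>
      (Ideal.absNorm q.1.1 : ℂ) ^ (-s) * (moebiusK K q.2.1 : ℂ) := hsum.congr h1
  rw [tsum_congr h1, hsum'.tsum_sigma]
  simp only [tsum_mul_left]
  rw [tsum_eq_single (⟨⊤, top_ne_bot⟩ : NzIdeal K)]
  · rw [tsum_moebiusK_dvd top_ne_bot]
    simp
  · intro J hJ
    rw [tsum_moebiusK_dvd J.2, if_neg fun h => hJ (Subtype.ext h), mul_zero]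

end Moebius

section Mertens

variable {K : Type} [Field K] [NumberField K]

/-- The normalised step function at `n`. -/
def stepWt (n x : ℝ) : ℝ := if n < x then 1 else if n = x then 1 / 2 else 0

lemma stepWt_nonneg (n x : ℝ) : 0 ≤ stepWt n x := by
  rw [stepWt]; split_ifs <;> norm_num

lemma stepWt_le_one (n x : ℝ) : stepWt n x ≤ 1 := by
  rw [stepWt]; split_ifs <;> norm_num

lemma stepWt_le {n x σ : ℝ} (hn : 0 < n) (hx : 0 < x) (hσ : 0 ≤ σ) :
    stepWt n x ≤ x ^ σ * n ^ (-σ) := by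
  rcases le_or_gt n x with h | h
  · refine (stepWt_le_one n x).trans ?_
    rw [Real.rpow_neg hn.le, ← div_eq_mul_inv, one_le_div (Real.rpow_pos_of_pos hn σ)]
    exact Real.rpow_le_rpow hn.le h hσ
  · rw [stepWt, if_neg h.not_gt, if_neg h.ne']
    positivity

lemma measurable_stepWt (n : ℝ) : Measurable (stepWt n) := by
  refine Measurable.ite measurableSet_Ioi measurable_const ?_
  exact Measurable.ite (measurableSet_eq (a := n) |>.congr (by ext; simp [eq_comm])) measurable_const
    measurable_const

lemma mertensK_eq_tsum (x : ℝ) :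
    mertensK K x = ∑' I : NzIdeal K, (moebiusK K I.1 : ℝ) * stepWt (Ideal.absNorm I.1) x := by
  have h := tsum_subtype {I : Ideal (𝓞 K) | I ≠ ⊥}
    (fun I => (moebiusK K I : ℝ) * stepWt (Ideal.absNorm I) x)
  refine Eq.trans ?_ h.symm
  rw [mertensK]
  congr 1
  funext I
  by_cases hI : I = ⊥
  · simp [hI]
  · by_cases h1 : (Ideal.absNorm I : ℝ) < x <;> by_cases h2 : (Ideal.absNorm I : ℝ) = x <;>
      simp [Set.indicator, hI, stepWt, h1, h2, div_eq_mul_inv]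

lemma abs_mertens_term_le {σ x : ℝ} (hx : 0 < x) (hσ : 0 ≤ σ) (I : NzIdeal K) :
    ‖(moebiusK K I.1 : ℝ) * stepWt (Ideal.absNorm I.1) x‖ ≤
      x ^ σ * (Ideal.absNorm I.1 : ℝ) ^ (-σ) := by
  rw [norm_mul, Real.norm_eq_abs, Real.norm_of_nonneg (stepWt_nonneg _ _)]
  refine (mul_le_of_le_one_left (stepWt_nonneg _ _) (abs_moebiusK_le I.1)).trans ?_
  exact stepWt_le (by exact_mod_cast absNorm_pos I) hx hσ

lemma summable_mertens_term {x : ℝ} (hx : 0 < x) :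
    Summable fun I : NzIdeal K => (moebiusK K I.1 : ℝ) * stepWt (Ideal.absNorm I.1) x :=
  Summable.of_norm_bounded ((summable_norm_rpow K (σ := 2) (by norm_num)).mul_left (x ^ (2 : ℝ)))
    fun I => abs_mertens_term_le hx (by norm_num) I

variable (K) in
lemma abs_mertensK_le {σ : ℝ} (hσ : 1 < σ) :
    ∃ B, 0 ≤ B ∧ ∀ x : ℝ, 0 < x → |mertensK K x| ≤ B * x ^ σ := by
  refine ⟨∑' I : NzIdeal K, (Ideal.absNorm I.1 : ℝ) ^ (-σ), tsum_nonneg fun _ => by positivity,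
    fun x hx => ?_⟩
  rw [mertensK_eq_tsum, mul_comm, ← tsum_mul_left]
  exact tsum_of_norm_bounded ((summable_norm_rpow K hσ).mul_left (x ^ σ)).hasSum
    fun I => abs_mertens_term_le hx (by linarith) I

lemma mertensK_eq_zero {x : ℝ} (hx : x < 1) : mertensK K x = 0 := by
  rw [mertensK_eq_tsum]
  have : ∀ I : NzIdeal K, (moebiusK K I.1 : ℝ) * stepWt (Ideal.absNorm I.1) x = 0 := by
    intro I
    have h1 : (1 : ℝ) ≤ Ideal.absNorm I.1 := by exact_mod_cast absNorm_pos I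
    rw [stepWt, if_neg (by linarith), if_neg (by linarith), mul_zero]
  simp [this]

lemma measurable_mertensK_exp : Measurable fun u : ℝ => mertensK K (Real.exp u) := by
  refine measurable_of_tendsto_metrizable' (atTop : Filter (Finset (NzIdeal K)))
    (f := fun S u => ∑ I ∈ S, (moebiusK K I.1 : ℝ) * stepWt (Ideal.absNorm I.1) (Real.exp u)) ?_ ?_
  · intro S
    exact Finset.measurable_fun_sum S fun I _ =>
      ((measurable_stepWt _).comp Real.measurable_exp).const_mul _
  · rw [tendsto_pi_nhds]
    intro u
    rw [mertensK_eq_tsum]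
    exact (summable_mertens_term (Real.exp_pos u)).hasSum

lemma stepWt_eventually_eq {x : ℝ} :
    ∀ᶠ s in 𝓝 x, ∀ n : ℕ, (n : ℝ) ≠ x → stepWt n s = stepWt n x := by
  have h1 : (⌈x⌉ : ℝ) - 1 < x := by linarith [Int.ceil_lt_add_one x]
  have h2 : x < (⌊x⌋ : ℝ) + 1 := Int.lt_floor_add_one x
  filter_upwards [Ioo_mem_nhds h1 h2] with s hs n hn
  rcases lt_or_gt_of_ne hn with h | h
  · have h3 : ((n : ℤ) : ℝ) < ⌈x⌉ := lt_of_lt_of_le (by exact_mod_cast h) (Int.le_ceil x)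
    have h4 : (n : ℝ) ≤ ⌈x⌉ - 1 := by
      have : (n : ℤ) ≤ ⌈x⌉ - 1 := Int.le_sub_one_of_lt (by exact_mod_cast h3)
      exact_mod_cast this
    rw [stepWt, stepWt, if_pos h, if_pos (by linarith [hs.1])]
  · have h3 : (⌊x⌋ : ℝ) < (n : ℤ) := lt_of_le_of_lt (Int.floor_le x) (by exact_mod_cast h)
    have h4 : (⌊x⌋ : ℝ) + 1 ≤ n := by
      have : ⌊x⌋ + 1 ≤ (n : ℤ) := Int.add_one_le_of_lt (by exact_mod_cast h3)
      exact_mod_cast this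
    rw [stepWt, stepWt, if_neg h.not_gt, if_neg h.ne', if_neg (by linarith [hs.2]),
      if_neg (by linarith [hs.2])]

/-- The jump of the Mertens function at `x`. -/
def mertensJump (K : Type) [Field K] [NumberField K] (x : ℝ) : ℝ :=
  ∑' I : NzIdeal K, if (Ideal.absNorm I.1 : ℝ) = x then (moebiusK K I.1 : ℝ) else 0

variable (K) in
lemma finite_absNorm_eq (x : ℝ) : {I : NzIdeal K | (Ideal.absNorm I.1 : ℝ) = x}.Finite := by
  have := Ideal.finite_setOfPred_absNorm_le (S := 𝓞 K) ⌈x⌉₊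
  refine Set.Finite.of_injOn (f := Subtype.val) ?_ Subtype.val_injective.injOn this
  intro I hI
  have h1 : (Ideal.absNorm I.1 : ℝ) ≤ ⌈x⌉₊ := by
    rw [show (Ideal.absNorm I.1 : ℝ) = x from hI]
    exact Nat.le_ceil x
  exact_mod_cast h1

lemma mertensK_local {x : ℝ} (hx : 0 < x) :
    ∀ᶠ s in 𝓝 x, mertensK K s = mertensK K x + (stepWt x s - 1 / 2) * mertensJump K x := by
  filter_upwards [stepWt_eventually_eq (x := x), eventually_gt_nhds hx] with s hs hs0
  have hsum : Summable fun I : NzIdeal K =>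
      if (Ideal.absNorm I.1 : ℝ) = x then (moebiusK K I.1 : ℝ) else 0 := by
    refine summable_of_hasFiniteSupport ((finite_absNorm_eq K x).subset fun I hI => ?_)
    by_contra h
    exact hI (if_neg h)
  rw [mertensK_eq_tsum, mertensK_eq_tsum, mertensJump, ← tsum_mul_left,
    ← (summable_mertens_term hx).tsum_add (hsum.mul_left _)]
  refine tsum_congr fun I => ?_
  by_cases h : (Ideal.absNorm I.1 : ℝ) = x
  · rw [if_pos h, h]
    have : stepWt x x = 1 / 2 := by simp [stepWt]
    rw [this]
    ring
  · rw [if_neg h, hs _ h]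
    ring

lemma mertensK_symm_limit {y : ℝ} :
    ∀ᶠ h in 𝓝 (0 : ℝ), mertensK K (Real.exp (y + h)) + mertensK K (Real.exp (y - h)) =
      2 * mertensK K (Real.exp y) := by
  have h1 := mertensK_local (K := K) (Real.exp_pos y)
  have t1 : Tendsto (fun h : ℝ => Real.exp (y + h)) (𝓝 0) (𝓝 (Real.exp y)) :=
    Continuous.tendsto' (by fun_prop) _ _ (by simp)
  have t2 : Tendsto (fun h : ℝ => Real.exp (y - h)) (𝓝 0) (𝓝 (Real.exp y)) :=
    Continuous.tendsto' (by fun_prop) _ _ (by simp)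
  filter_upwards [t1.eventually h1, t2.eventually h1] with h e1 e2
  rw [e1, e2]
  have : stepWt (Real.exp y) (Real.exp (y + h)) + stepWt (Real.exp y) (Real.exp (y - h)) = 1 := by
    simp only [stepWt, Real.exp_lt_exp, Real.exp_eq_exp]
    rcases lt_trichotomy h 0 with h0 | h0 | h0
    · rw [if_neg (by linarith), if_neg (by linarith), if_pos (by linarith)]; norm_num
    · subst h0; norm_num
    · rw [if_pos (by linarith), if_neg (by linarith), if_neg (by linarith)]; norm_num
  linear_combination mertensJump K (Real.exp y) * this

variable (K) in
/-- The number of prime ideals dividing an ideal is small compared with its norm. -/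
lemma abs_mertensJump_le : ∃ B, 0 ≤ B ∧ ∀ x : ℝ, 0 < x → |mertensJump K x| ^ 4 ≤ B * x := by
  set d := Module.finrank ℚ K with hd
  have hd0 : d ≠ 0 := (Module.finrank_pos (R := ℚ) (M := K)).ne'
  set P : ℕ := 2 ^ (4 * d) with hP
  have hfin := Ideal.finite_setOfPred_absNorm_le (S := 𝓞 K) P
  set c := hfin.toFinset.card with hc
  refine ⟨(2 ^ (4 * c) : ℕ), Nat.cast_nonneg _, fun x hx => ?_⟩
  by_cases hex : ∃ I : NzIdeal K, (Ideal.absNorm I.1 : ℝ) = x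
  swap
  · have : mertensJump K x = 0 := by
      rw [mertensJump]
      have : ∀ I : NzIdeal K, (if (Ideal.absNorm I.1 : ℝ) = x then (moebiusK K I.1 : ℝ) else 0) = 0 :=
        fun I => if_neg fun h => hex ⟨I, h⟩
      simp [this]
    rw [this, abs_zero, zero_pow four_ne_zero]
    positivity
  obtain ⟨I₀, hI₀⟩ := hex
  set n := Ideal.absNorm I₀.1 with hn
  have hn0 : n ≠ 0 := (absNorm_pos I₀).ne'
  set J : Ideal (𝓞 K) := Ideal.span {(n : 𝓞 K)} with hJdef
  have hJ : J ≠ ⊥ := by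
    rw [hJdef, Ne, Ideal.span_singleton_eq_bot]
    exact_mod_cast hn0
  have hNJ : Ideal.absNorm J = n ^ d := by
    rw [hJdef, Ideal.absNorm_span_natCast, RingOfIntegers.rank]
  set T := (UniqueFactorizationMonoid.normalizedFactors J).toFinset with hT
  have hTpos : ∀ p ∈ T, 1 ≤ Ideal.absNorm p := fun p hp => by
    have := (UniqueFactorizationMonoid.prime_of_normalized_factor p (Multiset.mem_toFinset.1 hp)).ne_zero
    exact absNorm_pos ⟨p, this⟩
  have hprod : ∏ p ∈ T, Ideal.absNorm p ≤ n ^ d := by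
    have hdvd := ((sqfreeEquiv hJ).symm ⟨T, Finset.mem_powerset_self T⟩).2.1
    have h1 : Ideal.absNorm ((sqfreeEquiv hJ).symm ⟨T, Finset.mem_powerset_self T⟩).1 =
        ∏ p ∈ T, Ideal.absNorm p := by
      simp only [sqfreeEquiv, Equiv.coe_fn_symm_mk]
      rw [map_multiset_prod]
      rfl
    rw [← h1, ← hNJ]
    exact Nat.le_of_dvd (absNorm_pos ⟨J, hJ⟩) (map_dvd Ideal.absNorm hdvd)
  have hpow : P ^ T.card ≤ P ^ c * n ^ d := by
    calc P ^ T.card = ∏ p ∈ T, P := by rw [Finset.prod_const]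
      _ ≤ ∏ p ∈ T, ((if p ∈ hfin.toFinset then P else 1) * Ideal.absNorm p) := by
          refine Finset.prod_le_prod' fun p hp => ?_
          split_ifs with h
          · exact Nat.le_mul_of_pos_right _ (hTpos p hp)
          · rw [one_mul]
            simp only [Set.Finite.mem_toFinset, Set.mem_ofPred_eq, not_le] at h
            exact h.le
      _ = (∏ p ∈ T, if p ∈ hfin.toFinset then P else 1) * ∏ p ∈ T, Ideal.absNorm p :=
          Finset.prod_mul_distrib
      _ ≤ P ^ c * n ^ d := by
          refine Nat.mul_le_mul ?_ hprod
          rw [Finset.prod_ite, Finset.prod_const, Finset.prod_const_one, mul_one]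
          refine Nat.pow_le_pow_right (by positivity) (Finset.card_le_card fun p hp => ?_)
          exact (Finset.mem_filter.1 hp).2
  have hpow' : (2 ^ T.card) ^ 4 ≤ 2 ^ (4 * c) * n := by
    refine (Nat.pow_le_pow_iff_left hd0).1 ?_
    calc ((2 ^ T.card) ^ 4) ^ d = P ^ T.card := by
          rw [hP, ← pow_mul, ← pow_mul, ← pow_mul]
          ring_nf
      _ ≤ P ^ c * n ^ d := hpow
      _ = (2 ^ (4 * c) * n) ^ d := by
          rw [hP, mul_pow, ← pow_mul, ← pow_mul]
          ring_nf
  have hjump : |mertensJump K x| ≤ 2 ^ T.card := by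
    set S := (finite_absNorm_eq K x).toFinset.filter fun I => Squarefree I.1 with hS
    have h1 : mertensJump K x = ∑ I ∈ S, (moebiusK K I.1 : ℝ) := by
      rw [mertensJump, tsum_eq_sum (s := S)]
      · refine Finset.sum_congr rfl fun I hI => ?_
        have := (Finset.mem_filter.1 hI).1
        rw [Set.Finite.mem_toFinset] at this
        exact if_pos this
      · intro I hI
        split_ifs with h
        · have : ¬ Squarefree I.1 := fun h2 => hI (Finset.mem_filter.2 ⟨by simpa using h, h2⟩)
          simp [moebiusK, this]
        · rfl
    have h2 : |mertensJump K x| ≤ S.card := by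
      rw [h1]
      refine (Finset.abs_sum_le_sum_abs _ _).trans ?_
      refine (Finset.sum_le_card_nsmul S _ 1 fun I _ => abs_moebiusK_le I.1).trans ?_
      simp
    refine h2.trans ?_
    have h3 : S.card ≤ 2 ^ T.card := by
      rw [← Finset.card_powerset, ← Fintype.card_coe T.powerset, ← Fintype.card_coe S]
      refine Fintype.card_le_of_injective (fun I : S => sqfreeEquiv hJ ⟨I.1.1, ?_, ?_⟩) ?_
      · have hI := (Finset.mem_filter.1 I.2).1
        rw [Set.Finite.mem_toFinset] at hI
        have hI' : (Ideal.absNorm I.1.1 : ℝ) = x := hI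
        have : Ideal.absNorm I.1.1 = n := by exact_mod_cast hI'.trans hI₀.symm
        rw [Ideal.dvd_iff_le, hJdef, Ideal.span_singleton_le_iff_mem, ← this]
        exact Ideal.absNorm_mem _
      · exact (Finset.mem_filter.1 I.2).2
      · intro I I' h
        have := (sqfreeEquiv hJ).injective h
        exact Subtype.ext (Subtype.ext (Subtype.mk.inj this))
    exact_mod_cast h3
  calc |mertensJump K x| ^ 4 ≤ (2 ^ T.card) ^ 4 := by gcongr
    _ ≤ (2 ^ (4 * c) : ℕ) * (n : ℝ) := by exact_mod_cast hpow'
    _ = _ := by rw [hI₀]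

/-- The Mertens function in logarithmic scale. -/
def mertensLog (K : Type) [Field K] [NumberField K] (u : ℝ) : ℝ :=
  Real.exp (-u / 2) * mertensK K (Real.exp u)

lemma laplace_stepWt {N : ℝ} (hN : 1 ≤ N) {s : ℂ} (hs : 0 < s.re) :
    IntegrableOn (fun u : ℝ => (stepWt N (Real.exp u) : ℂ) * cexp (-s * u)) (Set.Ioi 0) ∧
    ∫ u in Set.Ioi (0 : ℝ), (stepWt N (Real.exp u) : ℂ) * cexp (-s * u) = (N : ℂ) ^ (-s) / s := by
  have hN0 : 0 < N := by linarith
  have hl : 0 ≤ Real.log N := Real.log_nonneg hN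
  have h1 : (fun u : ℝ => (stepWt N (Real.exp u) : ℂ) * cexp (-s * u)) =ᵐ[volume.restrict (Set.Ioi 0)]
      (Set.Ioi (Real.log N)).indicator fun u : ℝ => cexp (-s * u) := by
    have : ∀ᵐ u : ℝ, u ≠ Real.log N := by simp [ae_iff]
    filter_upwards [ae_restrict_of_ae this] with u hu
    by_cases h : Real.log N < u
    · rw [Set.indicator_of_mem (Set.mem_Ioi.2 h), stepWt, if_pos ((Real.log_lt_iff_lt_exp hN0).1 h)]
      simp
    · have h2 : u < Real.log N := lt_of_le_of_ne (not_lt.1 h) hu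
      have h3 := (Real.lt_log_iff_exp_lt hN0).1 h2
      rw [Set.indicator_of_notMem (by simpa using h2.le), stepWt, if_neg h3.not_gt, if_neg h3.ne']
      simp
  have hi : IntegrableOn (fun u : ℝ => cexp (-s * u)) (Set.Ioi (Real.log N)) :=
    integrableOn_exp_mul_complex_Ioi (by simpa) _
  constructor
  · refine Integrable.congr ?_ h1.symm
    exact (hi.integrable_indicator measurableSet_Ioi).integrableOn
  · rw [integral_congr_ae h1, integral_indicator measurableSet_Ioi,
      Measure.restrict_restrict measurableSet_Ioi,
      Set.inter_eq_left.2 (Set.Ioi_subset_Ioi hl), integral_exp_mul_complex_Ioi (by simpa),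
      cpow_def_of_ne_zero (by exact_mod_cast hN0.ne'), ← ofReal_log hN0.le]
    have : s ≠ 0 := fun h => by simp [h] at hs
    field_simp

lemma laplace_mertensK {s : ℂ} (hs : 1 < s.re) :
    IntegrableOn (fun u : ℝ => (mertensK K (Real.exp u) : ℂ) * cexp (-s * u)) (Set.Ioi 0) ∧
    ∫ u in Set.Ioi (0 : ℝ), (mertensK K (Real.exp u) : ℂ) * cexp (-s * u) =
      (∑' I : NzIdeal K, (moebiusK K I.1 : ℂ) * (Ideal.absNorm I.1 : ℂ) ^ (-s)) / s := by
  have hs0 : 0 < s.re := by linarith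
  have h1 : ∀ I : NzIdeal K, (1 : ℝ) ≤ Ideal.absNorm I.1 := fun I => by exact_mod_cast absNorm_pos I
  constructor
  · obtain ⟨B, hB0, hB⟩ := abs_mertensK_le K (σ := (1 + s.re) / 2) (by linarith)
    have hi : IntegrableOn (fun u : ℝ => B * Real.exp (-((s.re - 1) / 2) * u)) (Set.Ioi 0) :=
      (integrableOn_exp_mul_Ioi (by linarith) 0).const_mul B
    refine Integrable.mono' hi ?_ (Filter.Eventually.of_forall fun u => ?_)
    · exact ((measurable_ofReal.comp measurable_mertensK_exp).mul (by fun_prop)).aestronglyMeasurable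
    · rw [norm_mul, Complex.norm_exp, Complex.norm_real, Real.norm_eq_abs]
      have h2 := hB _ (Real.exp_pos u)
      calc |mertensK K (Real.exp u)| * Real.exp (-s * u).re
          ≤ (B * Real.exp u ^ ((1 + s.re) / 2)) * Real.exp (-s * u).re := by gcongr
        _ = B * Real.exp (-((s.re - 1) / 2) * u) := by
          rw [← Real.exp_mul, mul_assoc, ← Real.exp_add]
          congr 2
          simp
          ring
  · have h2 : ∀ u : ℝ, (mertensK K (Real.exp u) : ℂ) * cexp (-s * u) =
        ∑' I : NzIdeal K, (moebiusK K I.1 : ℂ) *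
          ((stepWt (Ideal.absNorm I.1) (Real.exp u) : ℂ) * cexp (-s * u)) := by
      intro u
      rw [mertensK_eq_tsum, ofReal_tsum, ← tsum_mul_right]
      refine tsum_congr fun I => ?_
      push_cast
      ring
    simp only [h2]
    have hnorm : ∀ I : NzIdeal K, ∫ u in Set.Ioi (0 : ℝ), ‖(moebiusK K I.1 : ℂ) *
        ((stepWt (Ideal.absNorm I.1) (Real.exp u) : ℂ) * cexp (-s * u))‖ ≤
        (Ideal.absNorm I.1 : ℝ) ^ (-s.re) / s.re := by
      intro I
      have h3 := laplace_stepWt (h1 I) (s := (s.re : ℂ)) (by simpa)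
      have h4 : ∀ u : ℝ, ‖(stepWt (Ideal.absNorm I.1) (Real.exp u) : ℂ) * cexp (-s * u)‖ =
          stepWt (Ideal.absNorm I.1) (Real.exp u) * Real.exp (-s.re * u) := by
        intro u
        rw [norm_mul, Complex.norm_exp, Complex.norm_real, Real.norm_of_nonneg (stepWt_nonneg _ _)]
        simp
      have h5 : ∫ u in Set.Ioi (0 : ℝ), stepWt (Ideal.absNorm I.1) (Real.exp u) *
          Real.exp (-s.re * u) = (Ideal.absNorm I.1 : ℝ) ^ (-s.re) / s.re := by
        have := h3.2
        rw [← ofReal_inj, ← integral_complex_ofReal]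
        push_cast
        rw [ofReal_cpow (Nat.cast_nonneg _)]
        push_cast
        exact_mod_cast this
      have h6 : ‖(moebiusK K I.1 : ℂ)‖ ≤ 1 := by
        have := abs_moebiusK_le I.1
        rwa [← Real.norm_eq_abs, ← Complex.norm_real, ofReal_intCast] at this
      simp only [norm_mul (moebiusK K I.1 : ℂ), h4]
      rw [integral_const_mul, h5]
      exact mul_le_of_le_one_left (by positivity) h6
    have := hasSum_integral_of_summable_integral_norm
      (μ := volume.restrict (Set.Ioi (0 : ℝ))) (F := fun (I : NzIdeal K) u => (moebiusK K I.1 : ℂ) *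
        ((stepWt (Ideal.absNorm I.1) (Real.exp u) : ℂ) * cexp (-s * u)))
      (fun I => (laplace_stepWt (h1 I) hs0).1.const_mul _)
      (Summable.of_nonneg_of_le (fun I => integral_nonneg fun u => norm_nonneg _) hnorm
        ((summable_norm_rpow K hs).div_const _))
    rw [← this.tsum_eq, ← tsum_div_const]
    refine tsum_congr fun I => ?_
    rw [integral_const_mul, (laplace_stepWt (h1 I) hs0).2]
    push_cast
    ring

end Mertens

section LimitPoints

variable {K : Type} [Field K] [NumberField K]

lemma mertensLog_log {x : ℝ} (hx : 0 < x) : mertensLog K (Real.log x) = mertensK K x / √x := by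
  rw [mertensLog, Real.exp_log hx, show -Real.log x / 2 = -(Real.log x / 2) by ring, Real.exp_neg,
    Real.exp_half, Real.exp_log hx]
  ring

variable (K) in
lemma mertensLog_slow {δ : ℝ} (hδ : 0 < δ) :
    ∀ᶠ u in atTop, ∀ᶠ s in 𝓝 u, |mertensLog K s - mertensLog K u| < δ := by
  obtain ⟨B, hB0, hB⟩ := abs_mertensJump_le K
  have ht : Tendsto (fun u : ℝ => B * Real.exp (-u)) atTop (𝓝 (B * 0)) :=
    (Real.tendsto_exp_neg_atTop_nhds_zero).const_mul B
  rw [mul_zero] at ht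
  filter_upwards [ht.eventually_lt_const (pow_pos hδ 4)] with u hu
  have hJ : Real.exp (-u / 2) * |mertensJump K (Real.exp u)| < δ := by
    refine lt_of_pow_lt_pow_left₀ 4 hδ.le (lt_of_le_of_lt ?_ hu)
    rw [mul_pow, ← Real.exp_nat_mul]
    calc Real.exp ((4 : ℕ) * (-u / 2)) * |mertensJump K (Real.exp u)| ^ 4
        ≤ Real.exp ((4 : ℕ) * (-u / 2)) * (B * Real.exp u) := by
          gcongr
          exact hB _ (Real.exp_pos u)
      _ = B * Real.exp (-u) := by
          rw [show -u = (4 : ℕ) * (-u / 2) + u by push_cast; ring, Real.exp_add]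
          ring_nf
  have hb : Tendsto (fun s : ℝ => Real.exp (-s / 2) * |mertensJump K (Real.exp u)| +
      |Real.exp (-s / 2) - Real.exp (-u / 2)| * |mertensK K (Real.exp u)|) (𝓝 u)
      (𝓝 (Real.exp (-u / 2) * |mertensJump K (Real.exp u)|)) :=
    Continuous.tendsto' (by fun_prop) _ _ (by simp)
  have h1 := Real.continuous_exp.continuousAt.eventually (mertensK_local (K := K) (Real.exp_pos u))
  filter_upwards [hb.eventually_lt_const hJ, h1] with s hs h2
  refine lt_of_le_of_lt ?_ hs
  rw [mertensLog, mertensLog, h2]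
  have h3 : |stepWt (Real.exp u) (Real.exp s) - 1 / 2| ≤ 1 := by
    have := stepWt_nonneg (Real.exp u) (Real.exp s)
    have := stepWt_le_one (Real.exp u) (Real.exp s)
    rw [abs_le]; constructor <;> linarith
  calc _ = |Real.exp (-s / 2) * ((stepWt (Real.exp u) (Real.exp s) - 1 / 2) *
        mertensJump K (Real.exp u)) + (Real.exp (-s / 2) - Real.exp (-u / 2)) *
        mertensK K (Real.exp u)| := by congr 1; ring
    _ ≤ _ := by
      refine (abs_add_le _ _).trans ?_
      rw [abs_mul, abs_mul, abs_mul, Real.abs_exp]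
      gcongr
      exact mul_le_of_le_one_left (abs_nonneg _) h3

/-- Since the jumps are small, a value that is not a limit point is eventually avoided on one side. -/
lemma one_sided_of_not_limit {V : ℝ}
    (h : ¬ ∃ t : ℕ → ℝ, Tendsto t atTop atTop ∧
      Tendsto (fun j : ℕ => mertensK K (t j) / Real.sqrt (t j)) atTop (𝓝 V)) :
    ∃ σ δ : ℝ, (σ = 1 ∨ σ = -1) ∧ 0 < δ ∧ ∀ᶠ u in atTop, σ * mertensLog K u ≤ σ * V - δ := by
  have h1 : ∃ δ > 0, ∀ᶠ u in atTop, δ ≤ |mertensLog K u - V| := by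
    by_contra! hc
    apply h
    have h2 : ∀ n : ℕ, ∃ u : ℝ, (n : ℝ) ≤ u ∧ |mertensLog K u - V| < 1 / ((n : ℝ) + 1) := by
      intro n
      obtain ⟨u, hu, hu'⟩ := ((hc (1 / ((n : ℝ) + 1)) (by positivity)).and_eventually
        (eventually_ge_atTop (n : ℝ))).exists
      exact ⟨u, hu', hu⟩
    choose u hu1 hu2 using h2
    refine ⟨fun n => Real.exp (u n), Real.tendsto_exp_atTop.comp
      (tendsto_atTop_mono hu1 tendsto_natCast_atTop_atTop), ?_⟩
    have h3 : ∀ n, mertensK K (Real.exp (u n)) / √(Real.exp (u n)) = mertensLog K (u n) := fun n => by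
      rw [← mertensLog_log (Real.exp_pos _), Real.log_exp]
    simp only [h3]
    rw [tendsto_iff_norm_sub_tendsto_zero]
    exact squeeze_zero (fun _ => norm_nonneg _) (fun n => (hu2 n).le) tendsto_one_div_add_atTop_nhds_zero_nat
  obtain ⟨δ, hδ, hev⟩ := h1
  obtain ⟨U, hU⟩ := eventually_atTop.1 (hev.and (mertensLog_slow K (show 0 < 2 * δ by positivity)))
  set S : ℝ → ℝ := fun u => if V < mertensLog K u then 1 else -1 with hS
  have hcont : ContinuousOn S (Set.Ici U) := by
    intro u hu
    have h2 := (hU u hu).1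
    have h3 := (hU u hu).2
    have h4 : ∀ᶠ s in 𝓝[Set.Ici U] u, S s = S u := by
      filter_upwards [nhdsWithin_le_nhds h3, self_mem_nhdsWithin] with s hs hs'
      have h5 := (hU s hs').1
      have h6 : V < mertensLog K s ↔ V < mertensLog K u := by
        rw [abs_lt] at hs
        constructor
        · intro hlt
          rw [abs_of_pos (by linarith)] at h5
          by_contra hle
          rw [abs_of_nonpos (by linarith)] at h2
          linarith
        · intro hlt
          rw [abs_of_pos (by linarith)] at h2
          by_contra hle
          rw [abs_of_nonpos (by linarith)] at h5
          linarith
      simp only [hS, h6]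
    exact tendsto_const_nhds.congr' (h4.mono fun _ h => h.symm)
  have hconst : ∀ u, U ≤ u → S u = S U := by
    intro u hu
    by_contra hne
    have hiv := isPreconnected_Ici.image S hcont
    have h0 : (0 : ℝ) ∈ S '' Set.Ici U := by
      refine hiv.ordConnected.out (x := min (S u) (S U)) (y := max (S u) (S U)) ?_ ?_ ⟨?_, ?_⟩
      · rcases min_choice (S u) (S U) with h | h <;> rw [h]
        exacts [⟨u, hu, rfl⟩, ⟨U, le_refl U, rfl⟩]
      · rcases max_choice (S u) (S U) with h | h <;> rw [h]
        exacts [⟨u, hu, rfl⟩, ⟨U, le_refl U, rfl⟩]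
      · simp only [hS] at hne ⊢
        split_ifs at hne ⊢ <;> first | exact absurd rfl hne | norm_num
      · simp only [hS] at hne ⊢
        split_ifs at hne ⊢ <;> first | exact absurd rfl hne | norm_num
    obtain ⟨v, -, hv⟩ := h0
    simp only [hS] at hv
    split_ifs at hv <;> norm_num at hv
  by_cases hV : V < mertensLog K U
  · refine ⟨-1, δ, Or.inr rfl, hδ, eventually_atTop.2 ⟨U, fun u hu => ?_⟩⟩
    have h2 := hconst u hu
    have h3 := (hU u hu).1
    simp only [hS, if_pos hV] at h2
    have h4 : V < mertensLog K u := by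
      by_contra h
      rw [if_neg h] at h2
      norm_num at h2
    rw [abs_of_pos (by linarith)] at h3
    linarith
  · refine ⟨1, δ, Or.inl rfl, hδ, eventually_atTop.2 ⟨U, fun u hu => ?_⟩⟩
    have h2 := hconst u hu
    have h3 := (hU u hu).1
    simp only [hS, if_neg hV] at h2
    have h4 : ¬ V < mertensLog K u := by
      intro h
      rw [if_pos h] at h2
      norm_num at h2
    rw [abs_of_nonpos (by linarith)] at h3
    linarith

end LimitPoints

section Landau

lemma eqOn_of_eventuallyEq_real {U : Set ℂ} (hU : IsOpen U) (hc : IsPreconnected U) {f g : ℂ → ℂ}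
    (hf : DifferentiableOn ℂ f U) (hg : DifferentiableOn ℂ g U) {t : ℝ} (ht : (t : ℂ) ∈ U)
    (h : ∀ᶠ s : ℝ in 𝓝 t, f s = g s) : Set.EqOn f g U := by
  refine (hf.analyticOnNhd hU).eqOn_of_preconnected_of_frequently_eq (hg.analyticOnNhd hU) hc ht ?_
  have h1 : Tendsto (fun s : ℝ => (s : ℂ)) (𝓝[≠] t) (𝓝[≠] (t : ℂ)) :=
    tendsto_nhdsWithin_of_tendsto_nhds_of_eventually_within _
      ((Complex.continuous_ofReal.tendsto t).mono_left nhdsWithin_le_nhds)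
      (eventually_mem_nhdsWithin.mono fun s hs => by simpa using hs)
  exact h1.frequently (h.filter_mono nhdsWithin_le_nhds).frequently

/-- Landau's lemma: the Laplace transform of a positive measure is singular at its abscissa. -/
lemma landau_laplace (μ : Measure ℝ) (hpos : ∀ᵐ u ∂μ, 0 ≤ u) {a : ℝ}
    (hint : ∀ t > a, Integrable (fun u => Real.exp (-t * u)) μ) {Φ : ℂ → ℂ}
    (hΦ : AnalyticAt ℂ Φ a) (heq : ∀ᶠ t : ℝ in 𝓝[>] a, Φ t = ∫ u, cexp (-t * u) ∂μ) :
    ∃ t < a, Integrable (fun u => Real.exp (-t * u)) μ := by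
  obtain ⟨r, hr, hdiff⟩ : ∃ r > 0, DifferentiableOn ℂ Φ (Metric.ball (a : ℂ) r) := by
    obtain ⟨r, hr, h⟩ := Metric.eventually_nhds_iff_ball.1 hΦ.eventually_analyticAt
    exact ⟨r, hr, fun z hz => (h z hz).differentiableAt.differentiableWithinAt⟩
  obtain ⟨δ, rfl⟩ : ∃ δ, r = 2 * δ := ⟨r / 2, by ring⟩
  have hδ : 0 < δ := by linarith
  set X : ℝ → ℝ := fun u => -u with hX
  have hXint : ∀ t, t ∈ ProbabilityTheory.integrableExpSet X μ ↔
      Integrable (fun u => Real.exp (-t * u)) μ := fun t => by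
    rw [ProbabilityTheory.integrableExpSet, Set.mem_ofPred_eq]
    simp only [hX, mul_neg, neg_mul]
  have hsub : ∀ t > a, t ∈ interior (ProbabilityTheory.integrableExpSet X μ) := fun t ht =>
    mem_interior.2 ⟨Set.Ioi a, fun s hs => (hXint s).2 (hint s hs), isOpen_Ioi, ht⟩
  set G := ProbabilityTheory.complexMGF X μ with hG
  set U : Set ℂ := Metric.ball (a : ℂ) (2 * δ) ∩ {z | a < z.re} with hU
  have hUo : IsOpen U := Metric.isOpen_ball.inter (isOpen_lt continuous_const continuous_re)
  have hUc : IsPreconnected U :=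
    ((convex_ball _ _).inter (convex_halfSpace_re_gt a)).isPreconnected
  have hGr : ∀ t : ℝ, G t = ∫ u, cexp (-t * u) ∂μ := fun t => by
    simp only [hG, ProbabilityTheory.complexMGF, hX]
    refine integral_congr_ae (ae_of_all _ fun u => ?_)
    simp
  obtain ⟨η, hη, hη'⟩ := mem_nhdsGT_iff_exists_Ioo_subset.1 heq
  have hη0 : 0 < η - a := sub_pos.2 hη
  have hEq : Set.EqOn Φ G U := by
    refine eqOn_of_eventuallyEq_real hUo hUc (hdiff.mono Set.inter_subset_left) (fun z hz =>
      (ProbabilityTheory.analyticAt_complexMGF (hsub _ hz.2)).differentiableAt.differentiableWithinAt)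
      (t := a + min (η - a) δ / 2) ⟨?_, ?_⟩ ?_
    · have : 0 < min (η - a) δ := lt_min hη0 hδ
      have : min (η - a) δ ≤ δ := min_le_right _ _
      rw [Metric.mem_ball, dist_eq_norm, ← Complex.ofReal_sub, Complex.norm_real, Real.norm_eq_abs,
        abs_of_nonneg (by linarith)]
      linarith
    · have : 0 < min (η - a) δ := lt_min hη0 hδ
      simpa using this
    · have : 0 < min (η - a) δ := lt_min hη0 hδ
      have : min (η - a) δ ≤ η - a := min_le_left _ _
      filter_upwards [Ioo_mem_nhds (show a < a + min (η - a) δ / 2 by linarith)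
        (show a + min (η - a) δ / 2 < η by linarith)] with s hs
      rw [hGr]
      exact hη' hs
  set c : ℝ := a + δ / 2 with hc
  have hcU : (c : ℂ) ∈ U := by
    refine ⟨?_, ?_⟩
    · rw [Metric.mem_ball, dist_eq_norm, ← Complex.ofReal_sub, Complex.norm_real, Real.norm_eq_abs,
        hc, abs_of_nonneg (by linarith)]
      linarith
    · simp only [Set.mem_ofPred_eq, ofReal_re, hc]
      linarith
  have hball : Metric.ball (c : ℂ) δ ⊆ Metric.ball (a : ℂ) (2 * δ) := by
    refine Metric.ball_subset_ball' ?_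
    rw [dist_eq_norm, ← Complex.ofReal_sub, Complex.norm_real, Real.norm_eq_abs, hc,
      abs_of_nonneg (by linarith)]
    linarith
  set h : ℝ := 3 * δ / 4 with hh
  have hs := Complex.hasSum_taylorSeries_on_ball (hdiff.mono hball)
    (z := ((c - h : ℝ) : ℂ)) (by
      rw [Metric.mem_ball, dist_eq_norm, ← Complex.ofReal_sub, Complex.norm_real, Real.norm_eq_abs,
        abs_of_nonpos (by linarith)]
      linarith)
  have hderiv : ∀ n, iteratedDeriv n Φ c = ∫ u, ((X u) ^ n : ℂ) * cexp (c * X u) ∂μ := fun n => by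
    rw [(Filter.EventuallyEq.iteratedDeriv_eq n
      (Filter.eventuallyEq_of_mem (hUo.mem_nhds hcU) hEq) : iteratedDeriv n Φ c = _)]
    exact ProbabilityTheory.iteratedDeriv_complexMGF (by simpa using hsub c (by linarith)) n
  have hint2 : ∀ n : ℕ, Integrable (fun u => u ^ n * Real.exp (-c * u)) μ := fun n => by
    have := ProbabilityTheory.integrable_pow_mul_exp_of_mem_interior_integrableExpSet
      (hsub c (by linarith)) n
    refine (this.norm).congr' (by fun_prop) ?_
    filter_upwards [hpos] with u hu
    simp [hX, abs_of_nonneg hu]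
  set A : ℕ → ℝ := fun n => ∫ u, (n.factorial : ℝ)⁻¹ * h ^ n * (u ^ n * Real.exp (-c * u)) ∂μ with hA
  have hterm : ∀ n, ((n.factorial : ℂ)⁻¹ • (((c - h : ℝ) : ℂ) - c) ^ n • iteratedDeriv n Φ c) =
      (A n : ℂ) := fun n => by
    rw [hderiv, hA, ← integral_complex_ofReal, smul_eq_mul, smul_eq_mul, ← mul_assoc,
      ← integral_const_mul]
    refine integral_congr_ae (ae_of_all _ fun u => ?_)
    simp only [hX]
    push_cast
    rw [show (c : ℂ) - h - c = -h by ring, neg_pow (h : ℂ), neg_pow (u : ℂ)]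
    rw [show (c : ℂ) * -u = -c * u by ring]
    have : ((-1 : ℂ) ^ n) * (-1) ^ n = 1 := by rw [← mul_pow]; simp
    linear_combination ((n.factorial : ℂ)⁻¹ * (h : ℂ) ^ n * (u : ℂ) ^ n * cexp (-c * u)) * this
  have hA_sum : Summable A := by
    have := hs.summable
    simp only [hterm] at this
    exact_mod_cast this
  have hnn : ∀ n, ∀ᵐ u ∂μ, 0 ≤ (n.factorial : ℝ)⁻¹ * h ^ n * (u ^ n * Real.exp (-c * u)) := fun n => by
    filter_upwards [hpos] with u hu
    have : 0 ≤ h := by linarith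
    positivity
  refine ⟨c - h, by linarith, ?_, ?_⟩
  · fun_prop
  · rw [hasFiniteIntegral_iff_enorm]
    have h1 : ∫⁻ u, ‖Real.exp (-(c - h) * u)‖ₑ ∂μ = ∫⁻ u, ∑' n : ℕ,
        ENNReal.ofReal ((n.factorial : ℝ)⁻¹ * h ^ n * (u ^ n * Real.exp (-c * u))) ∂μ := by
      refine lintegral_congr_ae ?_
      filter_upwards [ae_all_iff.2 hnn] with u hu
      have hsum : HasSum (fun n : ℕ => (n.factorial : ℝ)⁻¹ * h ^ n * (u ^ n * Real.exp (-c * u)))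
          (Real.exp (-(c - h) * u)) := by
        have h2 := (NormedSpace.expSeries_div_hasSum_exp (h * u)).mul_right (Real.exp (-c * u))
        rw [← Real.exp_eq_exp_ℝ, ← Real.exp_add] at h2
        rw [show h * u + -c * u = -(c - h) * u by ring] at h2
        refine (funext fun n => ?_ : (fun n : ℕ => (n.factorial : ℝ)⁻¹ * h ^ n *
          (u ^ n * Real.exp (-c * u))) = _) ▸ h2
        rw [mul_pow]; ring
      rw [← ENNReal.ofReal_tsum_of_nonneg hu hsum.summable, hsum.tsum_eq,
        Real.enorm_eq_ofReal (Real.exp_pos _).le]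
    rw [h1, lintegral_tsum (fun n => by fun_prop)]
    have h3 : ∀ n, ∫⁻ u, ENNReal.ofReal ((n.factorial : ℝ)⁻¹ * h ^ n *
        (u ^ n * Real.exp (-c * u))) ∂μ = ENNReal.ofReal (A n) := fun n =>
      (ofReal_integral_eq_lintegral_ofReal ((hint2 n).const_mul _) (hnn n)).symm
    simp only [h3]
    exact hA_sum.tsum_ofReal_lt_top

end Landau

section OneSided

lemma integrableOn_cexp_neg {z : ℂ} (hz : 0 < z.re) :
    IntegrableOn (fun u : ℝ => cexp (-z * u)) (Set.Ioi 0) :=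
  integrableOn_exp_mul_complex_Ioi (by simpa using hz) 0

lemma integral_cexp_neg {z : ℂ} (hz : 0 < z.re) :
    ∫ u : ℝ in Set.Ioi 0, cexp (-z * u) = 1 / z := by
  rw [integral_exp_mul_complex_Ioi (by simpa using hz) 0]
  simp

variable {m : ℝ → ℝ} {L B σ : ℝ}

lemma integral_one_sided {z : ℂ} (hz : 0 < z.re)
    (hi : IntegrableOn (fun u : ℝ => (m u : ℂ) * cexp (-z * u)) (Set.Ioi 0)) :
    ∫ u : ℝ in Set.Ioi 0, ((L + B * Real.exp (-u) - σ * m u : ℝ) : ℂ) * cexp (-z * u) =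
      L / z + B / (z + 1) - σ * ∫ u : ℝ in Set.Ioi 0, (m u : ℂ) * cexp (-z * u) := by
  have hz1 : 0 < (z + 1).re := by simp; linarith
  have h1 := (integrableOn_cexp_neg hz).const_mul (L : ℂ)
  have h2 := (integrableOn_cexp_neg hz1).const_mul (B : ℂ)
  have h3 := hi.const_mul (σ : ℂ)
  rw [div_eq_mul_one_div, div_eq_mul_one_div (B : ℂ), ← integral_cexp_neg hz,
    ← integral_cexp_neg hz1, ← integral_const_mul, ← integral_const_mul, ← integral_const_mul,
    ← integral_add h1 h2, ← integral_sub (by exact h1.add h2) h3]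
  refine integral_congr_ae (ae_of_all _ fun u => ?_)
  simp only
  rw [show -(z + 1) * u = -u + -z * u by ring, Complex.exp_add]
  push_cast
  ring

lemma integrableOn_mul_cexp (hm : Measurable m) {z : ℂ} :
    IntegrableOn (fun u : ℝ => (m u : ℂ) * cexp (-z * u)) (Set.Ioi 0) ↔
      IntegrableOn (fun u : ℝ => m u * Real.exp (-z.re * u)) (Set.Ioi 0) := by
  rw [IntegrableOn, IntegrableOn, ← integrable_norm_iff (by fun_prop),
    ← integrable_norm_iff (f := fun u : ℝ => m u * Real.exp (-z.re * u)) (by fun_prop)]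
  refine integrable_congr (ae_of_all _ fun u => ?_)
  simp [Complex.norm_exp]

lemma integrableOn_one_sided (hσ : σ = 1 ∨ σ = -1) {t : ℝ} (ht : 0 < t) :
    IntegrableOn (fun u : ℝ => (L + B * Real.exp (-u) - σ * m u) * Real.exp (-t * u)) (Set.Ioi 0) ↔
      IntegrableOn (fun u : ℝ => m u * Real.exp (-t * u)) (Set.Ioi 0) := by
  have e1 : ∀ t : ℝ, 0 < t → IntegrableOn (fun u : ℝ => Real.exp (-t * u)) (Set.Ioi 0) := fun t ht =>
    exp_neg_integrableOn_Ioi 0 ht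
  have hs : σ * σ = 1 := by rcases hσ with rfl | rfl <;> norm_num
  have h0 := ((e1 t ht).const_mul L).add ((e1 (t + 1) (by linarith)).const_mul B)
  constructor
  · intro h
    refine ((h0.sub h).const_mul σ).congr (ae_of_all _ fun u => ?_)
    simp only [Pi.add_apply, Pi.sub_apply]
    rw [show -(t + 1) * u = -u + -t * u by ring, Real.exp_add]
    linear_combination (m u * Real.exp (-t * u)) * hs
  · intro h
    refine (h0.sub (h.const_mul σ)).congr (ae_of_all _ fun u => ?_)
    simp only [Pi.add_apply, Pi.sub_apply]
    rw [show -(t + 1) * u = -u + -t * u by ring, Real.exp_add]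
    ring

/-- A one-sided bound and regularity on the positive axis force convergence on `Re z > 0`. -/
lemma landau_one_sided (hm : Measurable m) (hσ : σ = 1 ∨ σ = -1)
    (hp : ∀ u, 0 < u → σ * m u ≤ L + B * Real.exp (-u))
    (hint : ∀ t : ℝ, 1 / 2 < t → IntegrableOn (fun u : ℝ => m u * Real.exp (-t * u)) (Set.Ioi 0))
    {D N : ℂ → ℂ} (hD : Differentiable ℂ D) (hN : Differentiable ℂ N)
    (heq : ∀ z : ℂ, 1 / 2 < z.re → D z * ∫ u : ℝ in Set.Ioi 0, (m u : ℂ) * cexp (-z * u) = N z)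
    (hD0 : ∀ t : ℝ, 0 < t → D t ≠ 0) :
    (∀ t : ℝ, 0 < t → IntegrableOn (fun u : ℝ => m u * Real.exp (-t * u)) (Set.Ioi 0)) ∧
    ∀ z : ℂ, 0 < z.re → D z * ∫ u : ℝ in Set.Ioi 0, (m u : ℂ) * cexp (-z * u) = N z := by
  have hs : σ * σ = 1 := by rcases hσ with rfl | rfl <;> norm_num
  set p : ℝ → ℝ := fun u => L + B * Real.exp (-u) - σ * m u with hpd
  have hpm : Measurable p := by fun_prop
  set μ : Measure ℝ := (volume.restrict (Set.Ioi 0)).withDensity (fun u => ((p u).toNNReal : ENNReal))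
    with hμ
  have hμpos : ∀ᵐ u ∂μ, 0 ≤ u := by
    refine (withDensity_absolutelyContinuous _ _).ae_le ?_
    filter_upwards [ae_restrict_mem measurableSet_Ioi] with u hu using le_of_lt hu
  have hμint : ∀ t : ℝ, Integrable (fun u => Real.exp (-t * u)) μ ↔
      IntegrableOn (fun u => p u * Real.exp (-t * u)) (Set.Ioi 0) := fun t => by
    rw [hμ, integrable_withDensity_iff_integrable_smul hpm.real_toNNReal]
    refine integrable_congr ?_
    filter_upwards [ae_restrict_mem measurableSet_Ioi] with u hu
    rw [NNReal.smul_def, Real.coe_toNNReal _ (by linarith [hp u hu]), smul_eq_mul]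
  have hμQ : ∀ z : ℂ, ∫ u, cexp (-z * u) ∂μ = ∫ u in Set.Ioi 0, (p u : ℂ) * cexp (-z * u) := fun z => by
    rw [hμ, integral_withDensity_eq_integral_smul hpm.real_toNNReal]
    refine integral_congr_ae ?_
    filter_upwards [ae_restrict_mem measurableSet_Ioi] with u hu
    rw [NNReal.smul_def, Real.coe_toNNReal _ (by linarith [hp u hu]), real_smul]
  set X : ℝ → ℝ := fun u => -u with hX
  set Q := ProbabilityTheory.complexMGF X μ with hQ
  have hQz : ∀ z, Q z = ∫ u, cexp (-z * u) ∂μ := fun z => by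
    simp only [hQ, ProbabilityTheory.complexMGF, hX]
    refine integral_congr_ae (ae_of_all _ fun u => ?_)
    simp
  have hXint : ∀ t, t ∈ ProbabilityTheory.integrableExpSet X μ ↔
      Integrable (fun u => Real.exp (-t * u)) μ := fun t => by
    rw [ProbabilityTheory.integrableExpSet, Set.mem_ofPred_eq]
    simp only [hX, mul_neg, neg_mul]
  have hcont : ∀ a : ℝ, 0 ≤ a → (∀ t > a, Integrable (fun u => Real.exp (-t * u)) μ) →
      ∀ z : ℂ, a < z.re → D z * ∫ u : ℝ in Set.Ioi 0, (m u : ℂ) * cexp (-z * u) = N z := by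
    intro a ha h
    have hmint : ∀ z : ℂ, a < z.re → IntegrableOn (fun u : ℝ => (m u : ℂ) * cexp (-z * u)) (Set.Ioi 0) :=
      fun z hz => (integrableOn_mul_cexp hm).2 ((integrableOn_one_sided hσ (by linarith)).1
        ((hμint _).1 (h _ hz)))
    set I : ℂ → ℂ := fun z => σ * (L / z + B / (z + 1) - Q z) with hI
    have hIeq : ∀ z : ℂ, a < z.re → I z = ∫ u : ℝ in Set.Ioi 0, (m u : ℂ) * cexp (-z * u) := by
      intro z hz
      have h2 := integral_one_sided (m := m) (L := L) (B := B) (σ := σ) (by linarith) (hmint z hz)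
      simp only [hI]
      rw [hQz, hμQ, h2]
      have : (σ : ℂ) * σ = 1 := by exact_mod_cast hs
      linear_combination (∫ u : ℝ in Set.Ioi 0, (m u : ℂ) * cexp (-z * u)) * this
    have hUo : IsOpen {z : ℂ | a < z.re} := isOpen_lt continuous_const continuous_re
    have hQd : DifferentiableOn ℂ Q {z : ℂ | a < z.re} := fun z hz =>
      (ProbabilityTheory.analyticAt_complexMGF (mem_interior.2 ⟨Set.Ioi a, fun s hs =>
        (hXint s).2 (h s hs), isOpen_Ioi, hz⟩)).differentiableAt.differentiableWithinAt
    have hId : DifferentiableOn ℂ I {z : ℂ | a < z.re} := by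
      intro z hz
      have hz' : a < z.re := hz
      have hz0 : z ≠ 0 := fun h => by rw [h] at hz'; simp at hz'; linarith
      have hz1 : z + 1 ≠ 0 := fun h => by
        have := congrArg Complex.re h
        simp at this; linarith
      exact (((((differentiableAt_const _).div differentiableAt_id hz0).add
        ((differentiableAt_const _).div (differentiableAt_id.add_const (1 : ℂ)) hz1)).differentiableWithinAt).sub
        (hQd z hz)).const_mul _
    have hE := eqOn_of_eventuallyEq_real hUo (convex_halfSpace_re_gt a).isPreconnected
      (hD.differentiableOn.mul hId) hN.differentiableOn (t := a + 1) (by simp)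
      (by
        filter_upwards [Ioi_mem_nhds (show max a (1 / 2) < a + 1 from max_lt (by linarith) (by linarith))]
          with s hs
        have hs' := max_lt_iff.1 (Set.mem_Ioi.1 hs)
        simp only [Pi.mul_apply]
        rw [hIeq _ (by simpa using hs'.1)]
        exact heq _ (by simpa using hs'.2))
    intro z hz
    rw [← hIeq z hz]
    exact hE hz
  have hlarge : ∀ t : ℝ, 1 / 2 < t → Integrable (fun u => Real.exp (-t * u)) μ := fun t ht =>
    (hμint t).2 ((integrableOn_one_sided hσ (by linarith)).2 (hint t ht))
  have hmono : ∀ s t : ℝ, s ≤ t → Integrable (fun u => Real.exp (-s * u)) μ →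
      Integrable (fun u => Real.exp (-t * u)) μ := fun s t hst h => by
    refine h.mono' (by fun_prop) ?_
    filter_upwards [hμpos] with u hu
    rw [Real.norm_eq_abs, Real.abs_exp, Real.exp_le_exp]
    nlinarith
  have hall : ∀ t : ℝ, 0 < t → Integrable (fun u => Real.exp (-t * u)) μ := by
    by_contra! hc
    obtain ⟨t0, ht0, hnot⟩ := hc
    set S : Set ℝ := {t | Integrable (fun u => Real.exp (-t * u)) μ} with hS
    have hne : S.Nonempty := ⟨1, hlarge 1 (by norm_num)⟩
    have hlb : ∀ s ∈ S, t0 ≤ s := fun s hs => by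
      by_contra! hlt
      exact hnot (hmono s t0 hlt.le hs)
    have hbdd : BddBelow S := ⟨t0, hlb⟩
    set a := sInf S with ha
    have hat : t0 ≤ a := le_csInf hne hlb
    have ha0 : 0 < a := lt_of_lt_of_le ht0 hat
    have hgt : ∀ t > a, Integrable (fun u => Real.exp (-t * u)) μ := fun t ht => by
      obtain ⟨s, hs, hst⟩ := exists_lt_of_csInf_lt hne ht
      exact hmono s t hst.le hs
    set Φ : ℂ → ℂ := fun z => L / z + B / (z + 1) - σ * (N z / D z) with hΦ
    have hDa := hD0 a ha0
    obtain ⟨t, hta, hti⟩ := landau_laplace μ hμpos hgt (Φ := Φ) (by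
      have hz0 : (a : ℂ) ≠ 0 := by exact_mod_cast ha0.ne'
      have hz1 : (a : ℂ) + 1 ≠ 0 := by
        have : a + 1 ≠ 0 := by linarith
        exact_mod_cast this
      have hDan : AnalyticAt ℂ D a := hD.analyticAt _
      have hNan : AnalyticAt ℂ N a := hN.analyticAt _
      exact ((analyticAt_const.div analyticAt_id hz0).add (analyticAt_const.div
        (analyticAt_id.add analyticAt_const) hz1)).sub (analyticAt_const.mul (hNan.div hDan hDa))) (by
      filter_upwards [self_mem_nhdsWithin] with t ht
      have ht' : a < t := ht
      have ht0' : 0 < t := by linarith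
      have h1 := hcont a ha0.le hgt t (by simpa using ht')
      rw [hμQ, integral_one_sided (by simpa using ht0') ((integrableOn_mul_cexp hm).2
        ((integrableOn_one_sided hσ (by simpa using ht0')).1 ((hμint _).1 (by simpa using hgt t ht)))), hΦ]
      simp only
      rw [← h1, mul_div_cancel_left₀ _ (hD0 t ht0')])
    exact absurd (csInf_le hbdd hti) (not_le.2 hta)
  refine ⟨fun t ht => (integrableOn_one_sided hσ ht).1 ((hμint t).1 (hall t ht)), fun z hz =>
    hcont 0 le_rfl hall z hz⟩

lemma norm_laplace_one_sided_le (hσ : σ = 1 ∨ σ = -1) (hB : 0 ≤ B)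
    (hp : ∀ u, 0 < u → σ * m u ≤ L + B * Real.exp (-u)) {z : ℂ} (hz : 0 < z.re)
    (hint : IntegrableOn (fun u : ℝ => m u * Real.exp (-z.re * u)) (Set.Ioi 0)) :
    ‖∫ u : ℝ in Set.Ioi 0, (m u : ℂ) * cexp (-z * u)‖ ≤ 2 * (|L| + B) / z.re +
      ‖∫ u : ℝ in Set.Ioi 0, (m u : ℂ) * cexp (-(z.re : ℂ) * u)‖ := by
  have hs : |σ| = 1 := by rcases hσ with rfl | rfl <;> norm_num
  have he := exp_neg_integrableOn_Ioi 0 hz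
  have h1 : ∫ u : ℝ in Set.Ioi 0, (m u : ℂ) * cexp (-(z.re : ℂ) * u) =
      ((∫ u : ℝ in Set.Ioi 0, m u * Real.exp (-z.re * u) : ℝ) : ℂ) := by
    rw [← integral_complex_ofReal]
    refine integral_congr_ae (ae_of_all _ fun u => ?_)
    push_cast
    rfl
  have h2 : ∫ u : ℝ in Set.Ioi 0, Real.exp (-z.re * u) = 1 / z.re := by
    rw [integral_exp_mul_Ioi (by linarith) 0]
    simp
  rw [h1, Complex.norm_real, Real.norm_eq_abs]
  have h3 : ∀ᵐ u ∂(volume.restrict (Set.Ioi (0 : ℝ))), ‖(m u : ℂ) * cexp (-z * u)‖ ≤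
      2 * (|L| + B) * Real.exp (-z.re * u) + -σ * (m u * Real.exp (-z.re * u)) := by
    filter_upwards [ae_restrict_mem measurableSet_Ioi] with u hu
    have hu' : (0 : ℝ) < u := hu
    have h4 := hp u hu
    have h5 : B * Real.exp (-u) ≤ B := mul_le_of_le_one_right hB (Real.exp_le_one_iff.2 (by linarith))
    have h6 := le_abs_self L
    have h8 := abs_nonneg L
    have h7 : |m u| ≤ 2 * (|L| + B) - σ * m u := by
      rcases hσ with rfl | rfl <;> rw [abs_le] <;> constructor <;> linarith
    rw [norm_mul, Complex.norm_real, Complex.norm_exp, Real.norm_eq_abs]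
    simp only [neg_mul, neg_re, mul_re, ofReal_re, ofReal_im, mul_zero, sub_zero]
    nlinarith [Real.exp_pos (-(z.re * u)), mul_le_mul_of_nonneg_right h7 (Real.exp_pos (-(z.re * u))).le]
  refine (norm_integral_le_of_norm_le ((he.const_mul _).add (hint.const_mul _)) h3).trans ?_
  have h9 := integral_add (he.const_mul (2 * (|L| + B))) (hint.const_mul (-σ))
  simp only [Pi.add_apply] at h9 ⊢
  rw [h9, integral_const_mul, integral_const_mul, h2]
  gcongr
  · rw [mul_one_div]
  · refine (le_abs_self _).trans ?_
    rw [abs_mul, abs_neg, hs, one_mul]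

end OneSided

section Setup

variable (K : Type) [Field K] [NumberField K]

/-- The function `1 / (s ζ_K(s))` in terms of the completed zeta function `E`. -/
def mertensQuot (E : ℂ → ℂ) (q : ℝ) (s : ℂ) : ℂ := (1 - s) * (q : ℂ) ^ s / (E s * gammaInv K s)

/-- The analytic input on `1 / (s ζ_K(s))` that the explicit formula rests on. -/
structure HeckeData (E : ℂ → ℂ) (q : ℝ) : Prop where
  q_pos : 0 < q
  diff : Differentiable ℂ E
  symm : ∀ s, E (1 - s) = E s
  growth : ∃ C, 0 ≤ C ∧ ∀ s, -1 ≤ s.re → s.re ≤ 2 → ‖E s‖ ≤ C * (1 + ‖s‖) ^ 2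
  re_of_zero : ∀ s, E s = 0 → s.re = 1 / 2
  deriv_ne : ∀ s, E s = 0 → deriv E s ≠ 0
  bound : ∃ C, 0 ≤ C ∧ ∀ s : ℂ, 1 / 2 < s.re → s.re ≤ 2 →
    ‖mertensQuot K E q s‖ ≤ C / (s.re - 1 / 2)
  series : ∀ s : ℂ, 1 < s.re →
    mertensQuot K E q s = (∑' I : NzIdeal K, (moebiusK K I.1 : ℂ) * (Ideal.absNorm I.1 : ℂ) ^ (-s)) / s

variable {K}

lemma gammaInv_ne_zero {s : ℂ} (hs : 0 < s.re) : gammaInv K s ≠ 0 :=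
  right_ne_zero_of_mul (by rw [gammaInf_mul_inv hs]; exact one_ne_zero)

lemma measurable_mertensLog : Measurable (mertensLog K) :=
  (by fun_prop : Measurable fun u : ℝ => Real.exp (-u / 2)).mul measurable_mertensK_exp

lemma mertensLog_mul_cexp (z : ℂ) (u : ℝ) : (mertensLog K u : ℂ) * cexp (-z * u) =
    (mertensK K (Real.exp u) : ℂ) * cexp (-(z + 1 / 2) * u) := by
  rw [mertensLog]
  push_cast
  rw [show -(z + 1 / 2) * u = -u / 2 + -z * u by ring, Complex.exp_add]
  ring

lemma heckeData_of_one_sided {Z : ℂ → ℂ} (hZ : IsDedekindZeta K Z) (hRH : ZetaRH Z)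
    (hsimple : ∀ ρ : ℂ, Z ρ = 0 → 0 < ρ.re → ρ.re < 1 → deriv Z ρ ≠ 0)
    {σ L B : ℝ} (hσ : σ = 1 ∨ σ = -1) (hB : 0 ≤ B)
    (hp : ∀ u, 0 < u → σ * mertensLog K u ≤ L + B * Real.exp (-u)) :
    ∃ (E : ℂ → ℂ) (q : ℝ), HeckeData K E q ∧
      ∀ s : ℂ, s ≠ 0 → s ≠ 1 → 1 / (s * Z s) = mertensQuot K E q s := by
  obtain ⟨E, q, hq, hE, hsymm, hE0, hEZ, hgrowth⟩ := hecke_completed Z hZ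
  have hqs : ∀ s : ℂ, (q : ℂ) ^ s ≠ 0 := fun s => by
    rw [Ne, Complex.cpow_eq_zero_iff]
    exact fun h => hq.ne' (by exact_mod_cast h.1)
  have hE1 : E 1 ≠ 0 := by
    have := hsymm 0
    rw [sub_zero] at this
    rw [this]; exact hE0
  have hser : ∀ s : ℂ, 1 < s.re → mertensQuot K E q s =
      (∑' I : NzIdeal K, (moebiusK K I.1 : ℂ) * (Ideal.absNorm I.1 : ℂ) ^ (-s)) / s := by
    intro s hs
    have hs1 : s ≠ 1 := fun h => by rw [h] at hs; simp at hs
    have hs0 : s ≠ 0 := fun h => by rw [h] at hs; simp at hs; linarith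
    have h1 := tsum_moebiusK_mul (K := K) hs
    rw [← hZ.2 s hs] at h1
    have hZ0 : Z s ≠ 0 := right_ne_zero_of_mul (by rw [h1]; exact one_ne_zero)
    rw [mertensQuot, hEZ s hs1, eq_div_of_mul_eq hZ0 h1]
    have := sub_ne_zero.2 hs1.symm
    have := hqs s
    field_simp
  have hint : ∀ t : ℝ, 1 / 2 < t →
      IntegrableOn (fun u : ℝ => mertensLog K u * Real.exp (-t * u)) (Set.Ioi 0) := by
    intro t ht
    have h1 := (laplace_mertensK (K := K) (s := (t : ℂ) + 1 / 2) (by simp; linarith)).1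
    simp only [← mertensLog_mul_cexp] at h1
    simpa using (integrableOn_mul_cexp measurable_mertensLog).1 h1
  have hZE : ∀ s : ℂ, 0 < s.re → s ≠ 1 → E s = 0 → Z s = 0 := by
    intro s hs hs1 h
    have h1 := hEZ s hs1
    rw [h, zero_mul] at h1
    have hs0 : s ≠ 0 := fun h => by rw [h] at hs; simp at hs
    simpa [hs0, hqs s, sub_ne_zero.2 hs1.symm] using h1.symm
  set D : ℂ → ℂ := fun z => E (z + 1 / 2) * gammaInv K (z + 1 / 2) with hD
  set N : ℂ → ℂ := fun z => (1 - (z + 1 / 2)) * (q : ℂ) ^ (z + 1 / 2) with hN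
  have hDd : Differentiable ℂ D := by
    have h1 : Differentiable ℂ fun z : ℂ => z + 1 / 2 := by fun_prop
    exact (hE.comp h1).mul (differentiable_gammaInv.comp h1)
  have hNd : Differentiable ℂ N := by
    intro z
    refine DifferentiableAt.mul (by fun_prop) (DifferentiableAt.const_cpow (by fun_prop) (Or.inl ?_))
    exact_mod_cast hq.ne'
  have hne1 : ∀ s : ℂ, 1 < s.re → E s ≠ 0 := by
    intro s hs h
    have h1 := hZE s (by linarith) (fun h => by rw [h] at hs; simp at hs) h
    have h2 := tsum_moebiusK_mul (K := K) hs
    rw [← hZ.2 s hs, h1, mul_zero] at h2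
    exact zero_ne_one h2
  have hNz : ∀ z : ℂ, N z = 0 → z + 1 / 2 = 1 := by
    intro z h
    have := (mul_eq_zero.1 h).resolve_right (hqs _)
    linear_combination -this
  obtain ⟨hint', hDI⟩ := landau_one_sided (m := mertensLog K) (L := L) (B := B) measurable_mertensLog hσ
    hp hint hDd hNd (fun z hz => by
      have hz1 : 1 < (z + 1 / 2).re := by simp; linarith
      have h1 := hser (z + 1 / 2) hz1
      have h2 := (laplace_mertensK (K := K) hz1).2
      simp only [mertensLog_mul_cexp]
      rw [h2, ← h1, mertensQuot, hD, hN]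
      have := hne1 _ hz1
      have := gammaInv_ne_zero (K := K) (s := z + 1 / 2) (by linarith)
      exact mul_div_cancel₀ _ (mul_ne_zero (hne1 _ hz1) this)) (fun t ht => by
      refine mul_ne_zero ?_ (gammaInv_ne_zero (by simp; linarith))
      rcases lt_trichotomy t (1 / 2) with h | h | h
      · intro hE'
        have h1 := hZE _ (by simp; linarith) (fun h' => by
          have := congrArg Complex.re h'
          simp at this; linarith) hE'
        have := hRH _ h1 (by simp; linarith) (by simp; linarith)
        simp at this
        linarith
      · rw [h]
        norm_num
        exact hE1
      · exact hne1 _ (by simp; linarith))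
  have hright : ∀ s : ℂ, 1 / 2 < s.re → E s ≠ 0 := by
    intro s hs h
    have h1 := hDI (s - 1 / 2) (by simp; linarith)
    rw [hD] at h1
    simp only [sub_add_cancel, h, zero_mul] at h1
    have h2 := hNz _ h1.symm
    rw [sub_add_cancel] at h2
    rw [h2] at h
    exact hE1 h
  have hre : ∀ s, E s = 0 → s.re = 1 / 2 := by
    intro s hs
    rcases lt_trichotomy s.re (1 / 2) with h | h | h
    · refine absurd ((hsymm s).trans hs) (hright _ ?_)
      simp; linarith
    · exact h
    · exact absurd hs (hright _ h)
  have hderiv : ∀ s, E s = 0 → deriv E s ≠ 0 := by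
    intro s hs h
    have hsr := hre s hs
    have hs0 : s ≠ 0 := fun h => by rw [h] at hsr; norm_num at hsr
    have hs1 : s ≠ 1 := fun h => by rw [h] at hsr; norm_num at hsr
    have hZs := hZE s (by linarith) hs1 hs
    have hdZ := hsimple s hZs (by linarith) (by linarith)
    have h1 : HasDerivAt (fun w => E w * gammaInv K w) 0 s := by
      have := (hE s).hasDerivAt.mul (differentiable_gammaInv (K := K) s).hasDerivAt
      rw [h, hs, zero_mul, zero_mul, add_zero] at this
      exact this
    have h2 : HasDerivAt (fun w => (w * (1 - w) * (q : ℂ) ^ w) * Z w)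
        ((s * (1 - s) * (q : ℂ) ^ s) * deriv Z s) s := by
      have h3 : DifferentiableAt ℂ (fun w : ℂ => w * (1 - w) * (q : ℂ) ^ w) s := by
        refine DifferentiableAt.mul (by fun_prop)
          (DifferentiableAt.const_cpow differentiableAt_id (Or.inl ?_))
        exact_mod_cast hq.ne'
      have := h3.hasDerivAt.mul (hZ.1 s hs1).hasDerivAt
      rw [hZs, mul_zero, zero_add] at this
      exact this
    have h4 : (fun w => E w * gammaInv K w) =ᶠ[𝓝 s] (fun w => (w * (1 - w) * (q : ℂ) ^ w) * Z w) :=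
      (isOpen_ne.eventually_mem hs1).mono fun w hw => hEZ w hw
    have h5 := (h1.congr_of_eventuallyEq h4.symm).unique h2
    exact mul_ne_zero (mul_ne_zero (mul_ne_zero hs0 (sub_ne_zero.2 hs1.symm)) (hqs s)) hdZ h5.symm
  have hD0 : ∀ t : ℝ, 0 < t → D t ≠ 0 := fun t ht =>
    mul_ne_zero (hright _ (by simp [ht])) (gammaInv_ne_zero (by simp; linarith))
  obtain ⟨C0, hC0, hC0'⟩ : ∃ C, 0 ≤ C ∧ ∀ t : ℝ, 0 < t → t ≤ 3 / 2 → ‖N t / D t‖ ≤ C / t := by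
    by_cases h0 : D 0 = 0
    · have hdD : deriv D 0 ≠ 0 := by
        have h1 : HasDerivAt D (deriv E (1 / 2) * gammaInv K (1 / 2)) 0 := by
          have hEh : E (1 / 2) = 0 := by
            have := (mul_eq_zero.1 h0).resolve_right (gammaInv_ne_zero (by norm_num))
            simpa using this
          have h2 : HasDerivAt (fun z : ℂ => z + 1 / 2) 1 0 := (hasDerivAt_id _).add_const _
          have h3 := (hE (1 / 2)).hasDerivAt.mul (differentiable_gammaInv (K := K) (1 / 2)).hasDerivAt
          rw [hEh, zero_mul, add_zero] at h3
          have h4 := HasDerivAt.comp (h₂ := fun w => E w * gammaInv K w) (0 : ℂ) (by rw [zero_add]; exact h3) h2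
          rw [mul_one] at h4
          exact h4
        rw [h1.deriv]
        refine mul_ne_zero (hderiv _ ?_) (gammaInv_ne_zero (by norm_num))
        have := (mul_eq_zero.1 h0).resolve_right (gammaInv_ne_zero (by norm_num))
        simpa using this
      have hds : Continuous (dslope D 0) :=
        continuous_iff_continuousAt.2 fun z => by
          rcases eq_or_ne z 0 with rfl | hz
          · exact continuousAt_dslope_same.2 (hDd 0)
          · exact (continuousAt_dslope_of_ne hz).2 (hDd z).continuousAt
      have hds0 : ∀ t : ℝ, 0 ≤ t → dslope D 0 t ≠ 0 := by
        intro t ht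
        rcases ht.eq_or_lt with rfl | ht
        · simpa using hdD
        · rw [dslope_of_ne _ (by exact_mod_cast ht.ne'), slope_def_field, h0, sub_zero, sub_zero]
          exact div_ne_zero (hD0 t ht) (by exact_mod_cast ht.ne')
      have hc : ContinuousOn (fun t : ℝ => N t / dslope D 0 t) (Set.Icc 0 (3 / 2)) :=
        ContinuousOn.div (hNd.continuous.comp continuous_ofReal).continuousOn
          (hds.comp continuous_ofReal).continuousOn fun t ht => hds0 t ht.1
      obtain ⟨C, hC⟩ := isCompact_Icc.exists_bound_of_continuousOn hc
      refine ⟨C, (norm_nonneg _).trans (hC 0 ⟨le_rfl, by norm_num⟩), fun t ht ht' => ?_⟩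
      have h1 := hC t ⟨ht.le, ht'⟩
      rw [dslope_of_ne _ (by exact_mod_cast ht.ne'), slope_def_field, h0, sub_zero, sub_zero,
        div_div_eq_mul_div, norm_div, norm_mul, Complex.norm_real, Real.norm_eq_abs, abs_of_pos ht] at h1
      rw [norm_div, le_div_iff₀ ht, div_mul_eq_mul_div]
      exact h1
    · have hc : ContinuousOn (fun t : ℝ => N t / D t) (Set.Icc 0 (3 / 2)) :=
        ContinuousOn.div (hNd.continuous.comp continuous_ofReal).continuousOn
          (hDd.continuous.comp continuous_ofReal).continuousOn fun t ht => by
            rcases ht.1.eq_or_lt with rfl | ht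
            · simpa using h0
            · exact hD0 t ht
      obtain ⟨C, hC⟩ := isCompact_Icc.exists_bound_of_continuousOn hc
      have hC0 := (norm_nonneg _).trans (hC 0 ⟨le_rfl, by norm_num⟩)
      refine ⟨C * (3 / 2), by positivity, fun t ht ht' => (hC t ⟨ht.le, ht'⟩).trans ?_⟩
      rw [le_div_iff₀ ht]
      gcongr
  refine ⟨E, q, ⟨hq, hE, hsymm, hgrowth, hre, hderiv, ⟨2 * (|L| + B) + C0, by positivity, ?_⟩,
    hser⟩, ?_⟩
  · intro s hs hs2
    have hz : 0 < (s - 1 / 2).re := by simp; linarith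
    have hI : ∀ z : ℂ, 0 < z.re → ∫ u : ℝ in Set.Ioi 0, (mertensLog K u : ℂ) * cexp (-z * u) = N z / D z :=
      fun z hz => eq_div_of_mul_eq (mul_ne_zero (hright _ (by simp [hz])) (gammaInv_ne_zero
        (by simp; linarith))) (by rw [mul_comm]; exact hDI z hz)
    have h1 := norm_laplace_one_sided_le hσ hB hp hz (hint' _ hz)
    rw [hI _ hz, hI _ (by simpa using hz)] at h1
    have h2 := hC0' _ hz (by simp; linarith)
    have h3 : N (s - 1 / 2) / D (s - 1 / 2) = mertensQuot K E q s := by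
      simp only [hN, hD, mertensQuot, sub_add_cancel]
    have h4 : (s - 1 / 2).re = s.re - 1 / 2 := by simp
    rw [h3] at h1
    rw [h4] at h1 h2
    rw [add_div]
    linarith
  · intro s hs0 hs1
    rw [mertensQuot, hEZ s hs1]
    have := sub_ne_zero.2 hs1.symm
    have := hqs s
    by_cases hZ0 : Z s = 0
    · simp [hZ0]
    · field_simp

end Setup

section GammaBounds

lemma norm_cos_le_exp (z : ℂ) : ‖Complex.cos z‖ ≤ Real.exp |z.im| := by
  rw [Complex.cos, norm_div, RCLike.norm_ofNat, div_le_iff₀ two_pos]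
  refine (norm_add_le _ _).trans ?_
  rw [Complex.norm_exp, Complex.norm_exp]
  have h1 : (z * I).re ≤ |z.im| := by simp [neg_le_abs]
  have h2 : (-z * I).re ≤ |z.im| := by simp [le_abs_self]
  linarith [Real.exp_le_exp.2 h1, Real.exp_le_exp.2 h2]

lemma norm_sin_le_exp (z : ℂ) : ‖Complex.sin z‖ ≤ Real.exp |z.im| := by
  rw [Complex.sin, norm_div, RCLike.norm_ofNat, div_le_iff₀ two_pos, norm_mul, norm_I, mul_one]
  refine (norm_sub_le _ _).trans ?_
  rw [Complex.norm_exp, Complex.norm_exp]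
  have h1 : (z * I).re ≤ |z.im| := by simp [neg_le_abs]
  have h2 : (-z * I).re ≤ |z.im| := by simp [le_abs_self]
  linarith [Real.exp_le_exp.2 h1, Real.exp_le_exp.2 h2]

lemma norm_Gamma_le {s : ℂ} (hs : 0 < s.re) : ‖Complex.Gamma s‖ ≤ Real.Gamma s.re := by
  rw [Complex.Gamma_eq_integral hs, Real.Gamma_eq_integral hs, Complex.GammaIntegral]
  refine norm_integral_le_of_norm_le (Real.GammaIntegral_convergent hs) ?_
  filter_upwards [ae_restrict_mem measurableSet_Ioi] with x hx
  rw [norm_mul, Complex.norm_real, Complex.norm_cpow_eq_rpow_re_of_pos hx]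
  simp

lemma exists_norm_Gamma_le {a : ℝ} (ha : 0 < a) (b : ℝ) :
    ∃ C, 0 ≤ C ∧ ∀ s : ℂ, a ≤ s.re → s.re ≤ b → ‖Complex.Gamma s‖ ≤ C := by
  have hc : ContinuousOn Real.Gamma (Set.Icc a b) := fun x hx =>
    (Real.differentiableAt_Gamma fun m => by
      have : 0 < x := lt_of_lt_of_le ha hx.1
      have : (0 : ℝ) ≤ m := Nat.cast_nonneg m
      linarith).continuousAt.continuousWithinAt
  obtain ⟨C, hC⟩ := isCompact_Icc.exists_bound_of_continuousOn hc
  refine ⟨max C 0, le_max_right _ _, fun s h1 h2 => ?_⟩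
  refine (norm_Gamma_le (lt_of_lt_of_le ha h1)).trans ((le_abs_self _).trans ?_)
  exact (hC _ ⟨h1, h2⟩).trans (le_max_left _ _)

lemma exists_norm_Gamma_le_of_im (a b : ℝ) :
    ∃ C, 0 ≤ C ∧ ∀ s : ℂ, a ≤ s.re → s.re ≤ b → 1 ≤ |s.im| → ‖Complex.Gamma s‖ ≤ C := by
  obtain ⟨n, hn⟩ := exists_nat_gt (-a)
  induction n generalizing a b with
  | zero =>
    obtain ⟨C, hC0, hC⟩ := exists_norm_Gamma_le (show 0 < a by simp at hn; linarith) b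
    exact ⟨C, hC0, fun s h1 h2 _ => hC s h1 h2⟩
  | succ n ih =>
    obtain ⟨C, hC0, hC⟩ := ih (a + 1) (b + 1) (by push_cast at hn; linarith)
    refine ⟨C, hC0, fun s h1 h2 h3 => ?_⟩
    have h4 := hC (s + 1) (by simp; linarith) (by simp; linarith) (by simpa using h3)
    have h5 : 1 ≤ ‖s‖ := h3.trans (Complex.abs_im_le_norm s)
    rw [Complex.Gamma_add_one s (by rintro rfl; simp at h5; linarith), norm_mul] at h4
    exact (le_mul_of_one_le_left (norm_nonneg _) h5).trans h4

lemma exists_norm_inv_Gamma_le {a b : ℝ} (hb : b < 1) (ha : 0 < a) :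
    ∃ C, 0 ≤ C ∧ ∀ s : ℂ, a ≤ s.re → s.re ≤ b →
      ‖(Complex.Gamma s)⁻¹‖ ≤ C * Real.exp (Real.pi * |s.im|) := by
  obtain ⟨C, hC0, hC⟩ := exists_norm_Gamma_le (show 0 < 1 - b by linarith) (1 - a)
  refine ⟨C, hC0, fun s h1 h2 => ?_⟩
  have h3 := Complex.Gamma_mul_Gamma_one_sub s
  have hG : Complex.Gamma s ≠ 0 := Complex.Gamma_ne_zero_of_re_pos (by linarith)
  have hG1 : Complex.Gamma (1 - s) ≠ 0 := Complex.Gamma_ne_zero_of_re_pos (by simp; linarith)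
  have hpi : (Real.pi : ℂ) ≠ 0 := by exact_mod_cast Real.pi_ne_zero
  have hsin : Complex.sin (Real.pi * s) ≠ 0 := by
    intro h
    rw [h, div_zero] at h3
    exact (mul_ne_zero hG hG1) h3
  have h4 : (Complex.Gamma s)⁻¹ = Complex.Gamma (1 - s) * Complex.sin (Real.pi * s) / Real.pi := by
    rw [eq_div_iff hsin] at h3
    rw [inv_eq_iff_eq_inv, inv_div, eq_div_iff (mul_ne_zero hG1 hsin)]
    linear_combination h3
  rw [h4, norm_div, norm_mul, Complex.norm_real, Real.norm_eq_abs, abs_of_pos Real.pi_pos,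
    div_le_iff₀ Real.pi_pos]
  have h5 := hC (1 - s) (by simp; linarith) (by simp; linarith)
  have h6 := norm_sin_le_exp (Real.pi * s)
  have h7 : ((Real.pi : ℂ) * s).im = Real.pi * s.im := by simp
  rw [h7, abs_mul, abs_of_pos Real.pi_pos] at h6
  calc _ ≤ C * Real.exp (Real.pi * |s.im|) := by gcongr
    _ ≤ _ := le_mul_of_one_le_right (by positivity) (by linarith [Real.pi_gt_three])

variable (K : Type) [Field K] [NumberField K]

/-- The ratio of Gamma factors in the functional equation. -/
def gammaChi (s : ℂ) : ℂ :=
  (Gammaℂ s * Complex.cos (Real.pi * s / 2)) ^ NumberField.InfinitePlace.nrRealPlaces K *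
  ((Gammaℂ s * Complex.cos (Real.pi * s / 2)) * (Gammaℂ s * Complex.sin (Real.pi * s / 2))) ^
    NumberField.InfinitePlace.nrComplexPlaces K

lemma gammaInv_one_sub {s : ℂ} (hs : ∀ n : ℕ, s ≠ -n) :
    gammaInv K (1 - s) = gammaChi K s * gammaInv K s := by
  rw [gammaInv, gammaInv, gammaChi, ← Gammaℝ_mul_Gammaℝ_add_one (1 - s),
    show 1 - s + 1 = 2 - s by ring, mul_inv, inv_Gammaℝ_one_sub hs, inv_Gammaℝ_two_sub hs]
  have : (Gammaℂ s)⁻¹ = (Gammaℝ s)⁻¹ * (Gammaℝ (s + 1))⁻¹ := by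
    rw [← mul_inv, Gammaℝ_mul_Gammaℝ_add_one]
  rw [this]
  simp only [mul_pow]
  ring

lemma norm_gammaChi_le {s : ℂ} {β : ℝ} (h : ‖Gammaℂ s‖ * Real.exp (Real.pi / 2 * |s.im|) ≤ β) :
    ‖gammaChi K s‖ ≤ β ^ Module.finrank ℚ K := by
  have h7 : ((Real.pi : ℂ) * s / 2).im = Real.pi / 2 * s.im := by
    rw [show (Real.pi : ℂ) * s / 2 = ((Real.pi / 2 : ℝ) : ℂ) * s by push_cast; ring]
    simp
  have hc := norm_cos_le_exp (Real.pi * s / 2)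
  have hs := norm_sin_le_exp (Real.pi * s / 2)
  rw [h7, abs_mul, abs_of_pos (by positivity)] at hc hs
  have hβ : 0 ≤ β := le_trans (by positivity) h
  have h1 : ‖Gammaℂ s * Complex.cos (Real.pi * s / 2)‖ ≤ β := by
    rw [norm_mul]
    exact (by gcongr : _ ≤ _).trans h
  have h2 : ‖Gammaℂ s * Complex.sin (Real.pi * s / 2)‖ ≤ β := by
    rw [norm_mul]
    exact (by gcongr : _ ≤ _).trans h
  rw [← NumberField.InfinitePlace.card_add_two_mul_card_eq_rank K, pow_add, pow_mul, gammaChi, norm_mul,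
    norm_pow, norm_pow, norm_mul (Gammaℂ s * _), sq]
  gcongr

lemma norm_Gammaℂ (s : ℂ) : ‖Gammaℂ s‖ = 2 * (2 * Real.pi) ^ (-s.re) * ‖Complex.Gamma s‖ := by
  rw [Gammaℂ_def, norm_mul, norm_mul, RCLike.norm_ofNat]
  rw [show (2 * (Real.pi : ℂ)) = ((2 * Real.pi : ℝ) : ℂ) by push_cast; ring,
    Complex.norm_cpow_eq_rpow_re_of_pos (by positivity), neg_re]

lemma exists_norm_gammaInv_le : ∃ C, 0 ≤ C ∧ ∀ s : ℂ, s.re = 3 / 4 →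
    ‖gammaInv K s‖ ≤ C * Real.exp (C * |s.im|) := by
  obtain ⟨C1, hC1, h1⟩ := exists_norm_inv_Gamma_le (a := 3 / 8) (b := 3 / 8) (by norm_num) (by norm_num)
  obtain ⟨C2, hC2, h2⟩ := exists_norm_inv_Gamma_le (a := 3 / 4) (b := 3 / 4) (by norm_num) (by norm_num)
  set r := NumberField.InfinitePlace.nrRealPlaces K
  set c := NumberField.InfinitePlace.nrComplexPlaces K
  set A : ℝ := (Real.pi ^ (3 / 8 : ℝ) * C1) ^ r * ((2 * Real.pi) ^ (3 / 4 : ℝ) * C2) ^ c with hA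
  have hA0 : 0 ≤ A := by positivity
  refine ⟨A + (r + c) * Real.pi, by positivity, fun s hs => ?_⟩
  have e1 : ‖(Gammaℝ s)⁻¹‖ ≤ Real.pi ^ (3 / 8 : ℝ) * C1 * Real.exp (Real.pi * |s.im|) := by
    have h3 := h1 (s / 2) (by simp [hs]; norm_num) (by simp [hs]; norm_num)
    rw [Gammaℝ_def, mul_inv, norm_mul, norm_inv, Complex.norm_cpow_eq_rpow_re_of_pos Real.pi_pos,
      ← Real.rpow_neg Real.pi_pos.le]
    have h4 : -(-s / 2).re = 3 / 8 := by simp [hs]; norm_num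
    have h5 : |(s / 2).im| ≤ |s.im| := by
      simp only [div_ofNat_im, abs_div]
      have := abs_nonneg s.im
      norm_num
    rw [h4, mul_assoc]
    gcongr
    exact h3.trans (by gcongr)
  have e2 : ‖(Gammaℂ s)⁻¹‖ ≤ (2 * Real.pi) ^ (3 / 4 : ℝ) * C2 * Real.exp (Real.pi * |s.im|) := by
    have h3 := h2 s hs.ge hs.le
    rw [norm_inv] at h3
    rw [norm_inv, norm_Gammaℂ, mul_inv, mul_inv, ← Real.rpow_neg (by positivity), neg_neg, hs, mul_assoc
      ((2 * Real.pi) ^ (3 / 4 : ℝ))]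
    calc _ ≤ 1 * (2 * Real.pi) ^ (3 / 4 : ℝ) * (C2 * Real.exp (Real.pi * |s.im|)) := by
          gcongr; norm_num
      _ = _ := by rw [one_mul]
  rw [gammaInv, norm_mul, norm_pow, norm_pow]
  calc _ ≤ (Real.pi ^ (3 / 8 : ℝ) * C1 * Real.exp (Real.pi * |s.im|)) ^ r *
        ((2 * Real.pi) ^ (3 / 4 : ℝ) * C2 * Real.exp (Real.pi * |s.im|)) ^ c := by gcongr
    _ = A * Real.exp ((r + c) * Real.pi * |s.im|) := by
        rw [mul_pow, mul_pow _ (Real.exp _) c, ← Real.exp_nat_mul, ← Real.exp_nat_mul, hA,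
          show ((r : ℝ) + c) * Real.pi * |s.im| = r * (Real.pi * |s.im|) + c * (Real.pi * |s.im|) by ring,
          Real.exp_add]
        ring
    _ ≤ _ := by
        gcongr
        · exact le_add_of_nonneg_right (by positivity)
        · exact le_add_of_nonneg_left hA0

end GammaBounds

section QuotGrowth

variable {K : Type} [Field K] [NumberField K] {E : ℂ → ℂ} {q : ℝ}

lemma HeckeData.exists_norm_le_div (h : HeckeData K E q) :
    ∃ C, 0 ≤ C ∧ ∀ w : ℂ, 3 / 2 ≤ w.re → ‖mertensQuot K E q w‖ ≤ C / ‖w‖ := by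
  have hs := summable_norm_rpow K (σ := 3 / 2) (by norm_num)
  refine ⟨∑' I : NzIdeal K, (Ideal.absNorm I.1 : ℝ) ^ (-(3 / 2 : ℝ)),
    tsum_nonneg fun I => by positivity, fun w hw => ?_⟩
  rw [h.series w (by linarith), norm_div]
  gcongr
  refine tsum_of_norm_bounded hs.hasSum fun I => (norm_moebiusK_mul_le I w).trans ?_
  have : (1 : ℝ) ≤ Ideal.absNorm I.1 := by exact_mod_cast absNorm_pos I
  exact Real.rpow_le_rpow_of_exponent_le this (by linarith)

lemma HeckeData.exists_norm_le_right (h : HeckeData K E q) :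
    ∃ C, 0 ≤ C ∧ ∀ w : ℂ, 1 / 2 < w.re →
      ‖mertensQuot K E q w‖ ≤ C * (1 + 1 / (w.re - 1 / 2)) := by
  obtain ⟨C1, h1, hC1⟩ := h.exists_norm_le_div
  obtain ⟨C2, h2, hC2⟩ := h.bound
  refine ⟨C1 + C2, by positivity, fun w hw => ?_⟩
  have hp : 0 < w.re - 1 / 2 := by linarith
  rcases le_or_gt w.re 2 with h3 | h3
  · refine (hC2 w hw h3).trans ?_
    rw [div_eq_mul_one_div]
    gcongr <;> linarith
  · refine (hC1 w (by linarith)).trans ?_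
    have : 1 ≤ ‖w‖ := by linarith [(le_abs_self w.re).trans (Complex.abs_re_le_norm w)]
    calc C1 / ‖w‖ ≤ C1 := div_le_self h1 this
      _ ≤ (C1 + C2) * 1 := by linarith
      _ ≤ _ := by gcongr; exact le_add_of_nonneg_right (by positivity)

lemma HeckeData.functional_eq (h : HeckeData K E q) {s : ℂ} (hs : s.re < 1)
    (hn : ∀ n : ℕ, s ≠ -n) :
    mertensQuot K E q s =
      mertensQuot K E q (1 - s) * ((1 - s) / s) * (q : ℂ) ^ (2 * s - 1) * gammaChi K s := by
  have hs0 : s ≠ 0 := by simpa using hn 0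
  have h1 : gammaInv K (1 - s) ≠ 0 := gammaInv_ne_zero (by simp; linarith)
  have h2 := gammaInv_one_sub K hn
  rw [h2] at h1
  have h3 := left_ne_zero_of_mul h1
  have h4 := right_ne_zero_of_mul h1
  have hq : (q : ℂ) ≠ 0 := by exact_mod_cast h.q_pos.ne'
  rw [mertensQuot, mertensQuot, h.symm, h2, show s = (1 - s) + (2 * s - 1) by ring,
    Complex.cpow_add _ _ hq]
  have e : (1 - s) + (2 * s - 1) = s := by ring
  rw [e]
  have e2 : 1 - (1 - s) = s := by ring
  rw [e2]
  by_cases hE : E s = 0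
  · simp [hE]
  field_simp

lemma rpow_le_rpow_add_rpow {q a b x : ℝ} (hq : 0 < q) (h1 : a ≤ x) (h2 : x ≤ b) :
    q ^ x ≤ q ^ a + q ^ b := by
  rcases le_total 1 q with h | h
  · linarith [Real.rpow_le_rpow_of_exponent_le h h2, Real.rpow_nonneg hq.le a]
  · linarith [Real.rpow_le_rpow_of_exponent_ge hq h h1, Real.rpow_nonneg hq.le b]

lemma HeckeData.exists_norm_le_left (h : HeckeData K E q) (a : ℝ) :
    ∃ C, 0 ≤ C ∧ ∀ s : ℂ, a ≤ s.re → s.re < 1 / 2 → (1 / 4 ≤ s.re ∨ 1 ≤ |s.im|) →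
      ‖mertensQuot K E q s‖ ≤ C * Real.exp (C * |s.im|) * (1 + 1 / (1 / 2 - s.re)) := by
  obtain ⟨C1, hC1, h1⟩ := h.exists_norm_le_right
  obtain ⟨C2, hC2, h2⟩ := exists_norm_Gamma_le (show (0 : ℝ) < 1 / 4 by norm_num) (1 / 2)
  obtain ⟨C3, hC3, h3⟩ := exists_norm_Gamma_le_of_im a (1 / 2)
  set n := Module.finrank ℚ K
  have hq := h.q_pos
  have h2pi : 0 < 2 * Real.pi := by positivity
  set D : ℝ := 2 * ((2 * Real.pi) ^ (-(1 / 2) : ℝ) + (2 * Real.pi) ^ (-a)) * (C2 + C3) with hD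
  set Q : ℝ := q ^ (2 * a - 1) + q ^ (0 : ℝ) with hQ
  have hD0 : 0 ≤ D := by positivity
  have hQ0 : 0 ≤ Q := by positivity
  set A : ℝ := C1 * 5 * Q * D ^ n with hA
  have hA0 : 0 ≤ A := by positivity
  refine ⟨A + n * (Real.pi / 2), by positivity, fun s ha hs hor => ?_⟩
  have hp : 0 < 1 / 2 - s.re := by linarith
  have hns : 1 / 4 ≤ ‖s‖ := by
    rcases hor with h' | h'
    · exact h'.trans ((le_abs_self _).trans (Complex.abs_re_le_norm s))
    · linarith [Complex.abs_im_le_norm s]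
  have hn : ∀ m : ℕ, s ≠ -m := by
    rintro m rfl
    rcases hor with h' | h'
    · simp at h'
      linarith [Nat.cast_nonneg (α := ℝ) m]
    · simp at h'
      linarith
  have hG : ‖Complex.Gamma s‖ ≤ C2 + C3 := by
    rcases hor with h' | h'
    · linarith [h2 s h' hs.le]
    · linarith [h3 s ha hs.le h']
  have hchi : ‖gammaChi K s‖ ≤ D ^ n * Real.exp (n * (Real.pi / 2) * |s.im|) := by
    have : ‖Gammaℂ s‖ * Real.exp (Real.pi / 2 * |s.im|) ≤ D * Real.exp (Real.pi / 2 * |s.im|) := by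
      rw [norm_Gammaℂ, hD]
      gcongr
      exact rpow_le_rpow_add_rpow h2pi (by linarith) (by linarith)
    refine (norm_gammaChi_le K this).trans_eq ?_
    rw [mul_pow, ← Real.exp_nat_mul, mul_assoc (n : ℝ)]
  have h5 : ‖(1 - s) / s‖ ≤ 5 := by
    rw [norm_div, div_le_iff₀ (by linarith)]
    have := norm_sub_le 1 s
    rw [norm_one] at this
    linarith
  have h6 : ‖(q : ℂ) ^ (2 * s - 1)‖ ≤ Q := by
    rw [Complex.norm_cpow_eq_rpow_re_of_pos hq]
    exact rpow_le_rpow_add_rpow hq (by simp; linarith) (by simp; linarith)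
  have h7 := h1 (1 - s) (by simp; linarith)
  rw [show (1 - s).re - 1 / 2 = 1 / 2 - s.re by simp; ring] at h7
  rw [h.functional_eq (by linarith) hn, norm_mul, norm_mul, norm_mul]
  calc _ ≤ C1 * (1 + 1 / (1 / 2 - s.re)) * 5 * Q * (D ^ n * Real.exp (n * (Real.pi / 2) * |s.im|)) := by
        gcongr
    _ = A * Real.exp (n * (Real.pi / 2) * |s.im|) * (1 + 1 / (1 / 2 - s.re)) := by rw [hA]; ring
    _ ≤ _ := by
        gcongr
        · exact le_add_of_nonneg_right (by positivity)
        · exact le_add_of_nonneg_left hA0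

lemma norm_Gamma_half_mul_exp_le {s : ℂ} (hs : s.re = 1 / 2) :
    ‖Complex.Gamma s‖ * Real.exp (Real.pi / 2 * |s.im|) ≤ 3 := by
  have h1 := Complex.Gamma_mul_Gamma_one_sub s
  have e1 : 1 - s = (starRingEnd ℂ) s := by
    apply Complex.ext <;> simp [hs]; norm_num
  have e2 : Complex.sin (Real.pi * s) = (Real.cosh (Real.pi * s.im) : ℂ) := by
    rw [show (Real.pi : ℂ) * s = (Real.pi * s.im : ℝ) * I + Real.pi / 2 by
      rw [← Complex.re_add_im s]; simp [hs]; ring]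
    rw [Complex.sin_add_pi_div_two, Complex.cos_mul_I]
    simp
  rw [e1, Complex.Gamma_conj, Complex.mul_conj, e2] at h1
  have h2 : ‖Complex.Gamma s‖ ^ 2 * Real.cosh (Real.pi * s.im) = Real.pi := by
    rw [← Complex.normSq_eq_norm_sq, ← eq_div_iff (Real.cosh_pos _).ne']
    exact_mod_cast h1
  have h3 : Real.exp (Real.pi * |s.im|) ≤ 2 * Real.cosh (Real.pi * s.im) := by
    rw [← Real.cosh_abs, abs_mul, abs_of_pos Real.pi_pos, Real.cosh_eq]
    linarith [Real.exp_pos (-(Real.pi * |s.im|))]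
  refine le_of_sq_le_sq ?_ (by norm_num)
  rw [mul_pow, ← Real.exp_nat_mul, show ((2 : ℕ) : ℝ) * (Real.pi / 2 * |s.im|) = Real.pi * |s.im| by
    push_cast; ring]
  calc _ ≤ ‖Complex.Gamma s‖ ^ 2 * (2 * Real.cosh (Real.pi * s.im)) := by gcongr
    _ = 2 * Real.pi := by linear_combination 2 * h2
    _ ≤ _ := by linarith [Real.pi_le_four]

lemma norm_Gamma_neg_half_mul_exp_le (k : ℕ) {s : ℂ} (hs : s.re = -k - 1 / 2) :
    ‖Complex.Gamma s‖ * Real.exp (Real.pi / 2 * |s.im|) ≤ 3 * 2 ^ k / (k.factorial * ‖s‖) := by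
  have hre : ∀ s : ℂ, |s.re| ≤ ‖s‖ := Complex.abs_re_le_norm
  have hne : ∀ (k : ℕ) (s : ℂ), s.re = -k - 1 / 2 → k + 1 / 2 ≤ ‖s‖ := fun k s hs => by
    have := (neg_le_abs _).trans (hre s)
    linarith
  have hG : ∀ s : ℂ, 0 < ‖s‖ → ‖Complex.Gamma s‖ = ‖Complex.Gamma (s + 1)‖ / ‖s‖ := fun s h => by
    rw [Complex.Gamma_add_one s (norm_pos_iff.1 h), norm_mul, mul_div_cancel_left₀ _ h.ne']
  induction k generalizing s with
  | zero =>
    have h0 := hne 0 s hs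
    have h1 : 0 < ‖s‖ := by push_cast at h0; linarith
    have h2 := norm_Gamma_half_mul_exp_le (s := s + 1) (by simp [hs]; norm_num)
    rw [hG s h1, div_mul_eq_mul_div]
    simp only [add_im, one_im, add_zero] at h2
    simp only [Nat.factorial_zero, Nat.cast_one, pow_zero, mul_one, one_mul]
    gcongr
  | succ k ih =>
    have h0 := hne _ s hs
    have h1 : 0 < ‖s‖ := by push_cast at h0; linarith [Nat.cast_nonneg (α := ℝ) k]
    have hs1 : (s + 1).re = -k - 1 / 2 := by simp [hs]; ring
    have h2 := ih hs1
    have h3 := hne _ _ hs1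
    simp only [add_im, one_im, add_zero] at h2
    have hk := Nat.cast_nonneg (α := ℝ) k
    rw [hG s h1, div_mul_eq_mul_div, div_le_iff₀ h1]
    refine h2.trans ?_
    have hf : (0 : ℝ) < k.factorial := by exact_mod_cast k.factorial_pos
    rw [show (3 * 2 ^ (k + 1) / ((k + 1).factorial * ‖s‖) * ‖s‖ : ℝ) =
      3 * 2 ^ k / (k.factorial * ((k + 1) / 2)) by
        rw [Nat.factorial_succ]; push_cast; field_simp; ring]
    gcongr
    linarith

lemma HeckeData.exists_norm_le_line (h : HeckeData K E q) :
    ∃ C B, 0 ≤ C ∧ 0 ≤ B ∧ ∀ (k : ℕ) (s : ℂ), s.re = -k - 1 / 2 →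
      ‖mertensQuot K E q s‖ ≤ C * B ^ k / k.factorial / ‖s‖ ^ 2 := by
  obtain ⟨C1, hC1, h1⟩ := h.exists_norm_le_div
  have hq := h.q_pos
  have hpi := Real.pi_pos
  set n := Module.finrank ℚ K with hn
  have hn0 : n ≠ 0 := (Module.finrank_pos (R := ℚ) (M := K)).ne'
  obtain ⟨m, hm⟩ := Nat.exists_eq_succ_of_ne_zero hn0
  set D : ℝ := 2 * (2 * Real.pi) ^ (1 / 2 : ℝ) * 3 with hD
  set A : ℝ := 2 * Real.pi * 2 with hA
  refine ⟨C1 * q ^ (-2 : ℝ) * D ^ n * 2 ^ m, q ^ (-2 : ℝ) * A ^ n, by positivity, by positivity, fun k s hs => ?_⟩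
  have hk := Nat.cast_nonneg (α := ℝ) k
  have hsn : 1 / 2 ≤ ‖s‖ := by
    have := (neg_le_abs _).trans (Complex.abs_re_le_norm s)
    linarith
  have hs0 : 0 < ‖s‖ := by linarith
  have hneg : ∀ j : ℕ, s ≠ -j := by
    rintro j rfl
    have : ((2 * j : ℕ) : ℝ) = (2 * k + 1 : ℕ) := by
      push_cast
      simp at hs
      linarith
    have := Nat.cast_injective this
    omega
  have hf : (1 : ℝ) ≤ k.factorial := by exact_mod_cast k.factorial_pos
  have hchi : ‖gammaChi K s‖ ≤ (D * A ^ k / (k.factorial * ‖s‖)) ^ n := by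
    refine norm_gammaChi_le K ?_
    rw [norm_Gammaℂ, mul_assoc]
    calc _ ≤ 2 * (2 * Real.pi) ^ (-s.re) * (3 * 2 ^ k / (k.factorial * ‖s‖)) := by
          gcongr
          exact norm_Gamma_neg_half_mul_exp_le k hs
      _ = _ := by
          rw [hs, show -(-(k : ℝ) - 1 / 2) = 1 / 2 + k by ring, Real.rpow_add (by positivity),
            Real.rpow_natCast, hD, hA, mul_pow (2 * Real.pi) 2]
          ring
  have h2 := h1 (1 - s) (by simp [hs]; linarith)
  have hs1 : 0 < ‖1 - s‖ := by
    refine norm_pos_iff.2 fun h0 => ?_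
    have := congrArg Complex.re h0
    simp [hs] at this
    linarith
  have h3 : ‖mertensQuot K E q (1 - s)‖ * ‖(1 - s) / s‖ ≤ C1 / ‖s‖ := by
    calc _ ≤ C1 / ‖1 - s‖ * ‖(1 - s) / s‖ := by gcongr
      _ = _ := by rw [norm_div]; field_simp
  have h6 : ‖(q : ℂ) ^ (2 * s - 1)‖ = q ^ (-2 : ℝ) * (q ^ (-2 : ℝ)) ^ k := by
    rw [Complex.norm_cpow_eq_rpow_re_of_pos hq, ← Real.rpow_natCast, ← Real.rpow_mul hq.le,
      ← Real.rpow_add hq]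
    congr 1
    simp [hs]
    ring
  rw [h.functional_eq (by linarith) hneg, norm_mul, norm_mul, norm_mul, h6]
  have h7 : (D * A ^ k / (k.factorial * ‖s‖)) ^ n ≤ D ^ n * (A ^ n) ^ k * 2 ^ m / (k.factorial * ‖s‖) := by
    have e : (1 / (k.factorial * ‖s‖)) ^ m ≤ 2 ^ m := by
      gcongr
      rw [div_le_iff₀ (by positivity)]
      nlinarith
    calc _ = D ^ n * (A ^ n) ^ k * (1 / (k.factorial * ‖s‖)) ^ n := by
          rw [div_eq_mul_one_div, mul_pow, mul_pow]; ring
      _ = D ^ n * (A ^ n) ^ k * ((1 / (k.factorial * ‖s‖)) ^ m * (1 / (k.factorial * ‖s‖))) := by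
          rw [← pow_succ, ← Nat.succ_eq_add_one, ← hm]
      _ ≤ D ^ n * (A ^ n) ^ k * (2 ^ m * (1 / (k.factorial * ‖s‖))) := by gcongr
      _ = _ := by ring
  calc _ ≤ C1 / ‖s‖ * (q ^ (-2 : ℝ) * (q ^ (-2 : ℝ)) ^ k) *
        (D ^ n * (A ^ n) ^ k * 2 ^ m / (k.factorial * ‖s‖)) := by
        gcongr
        exact hchi.trans h7
    _ = _ := by rw [mul_pow (q ^ (-2 : ℝ)) (A ^ n)]; ring

end QuotGrowth

section ZeroCount

variable {K : Type} [Field K] [NumberField K] {E : ℂ → ℂ} {q : ℝ}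

lemma HeckeData.exists_le_norm (h : HeckeData K E q) :
    ∃ b B, 0 < b ∧ 0 ≤ B ∧ ∀ s : ℂ, s.re = 3 / 4 → b * Real.exp (-(B * |s.im|)) ≤ ‖E s‖ := by
  obtain ⟨C1, hC1, h1⟩ := h.exists_norm_le_right
  obtain ⟨C2, hC2, h2⟩ := exists_norm_gammaInv_le K
  have hq := h.q_pos
  refine ⟨1 / 4 * q ^ (3 / 4 : ℝ) / ((C1 + 1) * 5 * (C2 + 1)), C2, by positivity, hC2, fun s hs => ?_⟩
  have hE : E s ≠ 0 := fun h0 => by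
    have := h.re_of_zero s h0
    rw [hs] at this
    norm_num at this
  have hg : gammaInv K s ≠ 0 := gammaInv_ne_zero (by rw [hs]; norm_num)
  have hqs : ‖(q : ℂ) ^ s‖ = q ^ (3 / 4 : ℝ) := by rw [Complex.norm_cpow_eq_rpow_re_of_pos hq, hs]
  have h3 : mertensQuot K E q s * (E s * gammaInv K s) = (1 - s) * (q : ℂ) ^ s := by
    rw [mertensQuot, div_mul_cancel₀ _ (mul_ne_zero hE hg)]
  have h4 := congrArg norm h3
  rw [norm_mul, norm_mul, norm_mul, hqs] at h4
  have h5 : 1 / 4 ≤ ‖1 - s‖ := by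
    have := (le_abs_self _).trans (Complex.abs_re_le_norm (1 - s))
    simp only [sub_re, one_re, hs] at this
    linarith
  have h6 := h1 s (by rw [hs]; norm_num)
  rw [hs] at h6
  norm_num at h6
  rw [Real.exp_neg, ← div_eq_mul_inv, div_div, div_le_iff₀ (by positivity)]
  calc 1 / 4 * q ^ (3 / 4 : ℝ) ≤ ‖1 - s‖ * q ^ (3 / 4 : ℝ) := by gcongr
    _ = ‖mertensQuot K E q s‖ * (‖E s‖ * ‖gammaInv K s‖) := h4.symm
    _ ≤ (C1 * 5) * (‖E s‖ * (C2 * Real.exp (C2 * |s.im|))) := by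
        gcongr
        exact h2 s hs
    _ ≤ ((C1 + 1) * 5) * (‖E s‖ * ((C2 + 1) * Real.exp (C2 * |s.im|))) := by
        gcongr <;> linarith
    _ = _ := by ring

lemma HeckeData.exists_card_le (h : HeckeData K E q) :
    ∃ C, 0 ≤ C ∧ ∀ (T : ℝ) (S : Finset ℂ), (∀ ρ ∈ S, E ρ = 0 ∧ |ρ.im - T| ≤ 1 / 4) →
      (S.card : ℝ) ≤ C * (1 + |T|) := by
  obtain ⟨b, B, hb, hB, hlow⟩ := h.exists_le_norm
  obtain ⟨G, hG, hup⟩ := h.growth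
  have hlog : 0 < Real.log (4 / 3) := Real.log_pos (by norm_num)
  refine ⟨(|Real.log ((G + 1) / b)| + 5 + B) / Real.log (4 / 3), by positivity, fun T S hS => ?_⟩
  set c : ℂ := 3 / 4 + T * I with hc
  have hcre : c.re = 3 / 4 := by simp [hc]
  have hcim : c.im = T := by simp [hc]
  have han : ∀ U, AnalyticOnNhd ℂ E U := fun U z _ => h.diff.analyticAt z
  have hEc : 0 < ‖E c‖ := lt_of_lt_of_le (by positivity) (hlow c hcre)
  have hcn : ‖c‖ ≤ 3 / 4 + |T| := by
    have := Complex.norm_le_abs_re_add_abs_im c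
    rw [hcre, hcim] at this
    norm_num at this
    linarith
  set M : ℝ := (G + 1) * Real.exp (2 * (5 / 4 + |T|)) with hM
  have hMb : ∀ z ∈ Metric.sphere c |(1 / 2 : ℝ)|, ‖E z‖ ≤ M := by
    intro z hz
    rw [abs_of_pos (by norm_num), mem_sphere_iff_norm] at hz
    have h1 := Complex.abs_re_le_norm (z - c)
    rw [hz, sub_re, hcre, abs_le] at h1
    have h2 : ‖z‖ ≤ 5 / 4 + |T| := by
      have := norm_add_le (z - c) c
      rw [sub_add_cancel, hz] at this
      linarith
    refine (hup z (by linarith) (by linarith)).trans ?_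
    rw [hM, show (2 : ℝ) * (5 / 4 + |T|) = ((2 : ℕ) : ℝ) * (5 / 4 + |T|) by norm_num, Real.exp_nat_mul]
    have h3 := Real.add_one_le_exp (5 / 4 + |T|)
    gcongr <;> linarith
  have hM1 : 1 ≤ M := by
    have : 1 ≤ Real.exp (2 * (5 / 4 + |T|)) := Real.one_le_exp (by positivity)
    rw [hM]
    nlinarith
  have hj := AnalyticOnNhd.sum_divisor_le (c := c) (r := 3 / 8) (R := 1 / 2) (M := M) (f := E)
    (by norm_num) (by norm_num [abs_of_pos]) hM1 (han _) (norm_pos_iff.1 hEc) hMb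
  rw [abs_of_pos (by norm_num : (0 : ℝ) < 3 / 8)] at hj
  set D := MeromorphicOn.divisor E (Metric.closedBall c (3 / 8)) with hD
  have hfin : D.support.Finite := D.finiteSupport (isCompact_closedBall _ _)
  have hD0 : ∀ z, 0 ≤ D z := fun z => MeromorphicOn.AnalyticOnNhd.divisor_nonneg (han _) z
  have hD1 : ∀ ρ ∈ S, 1 ≤ D ρ := by
    intro ρ hρ
    obtain ⟨h0, him⟩ := hS ρ hρ
    have hmem : ρ ∈ Metric.closedBall c (3 / 8) := by
      rw [mem_closedBall_iff_norm]
      refine le_of_sq_le_sq ?_ (by norm_num)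
      rw [← Complex.normSq_eq_norm_sq, Complex.normSq_apply, sub_re, sub_im, hcre, hcim,
        h.re_of_zero ρ h0]
      have := abs_le.1 him
      nlinarith
    rw [hD, MeromorphicOn.AnalyticOnNhd.divisor_apply (han _) hmem]
    have h1 : analyticOrderAt E ρ ≠ 0 := fun h' =>
      (h.diff.analyticAt ρ).analyticOrderAt_eq_zero.1 h' h0
    have h2 : analyticOrderAt E ρ ≠ ⊤ := fun h' => by
      rw [analyticOrderAt_eq_top] at h'
      exact h.deriv_ne ρ h0 (by
        have : E =ᶠ[𝓝 ρ] fun _ => 0 := h'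
        rw [this.deriv_eq, deriv_const])
    obtain ⟨n, hn⟩ := ENat.ne_top_iff_exists.1 h2
    rw [← hn] at h1 ⊢
    have : 1 ≤ n := Nat.one_le_iff_ne_zero.2 fun h => h1 (by rw [h]; rfl)
    change (1 : ℤ) ≤ (n : ℤ)
    exact_mod_cast this
  have hcard : (S.card : ℤ) ≤ ∑ᶠ u, D u := by
    rw [finsum_eq_sum_of_support_subset (s := S ∪ hfin.toFinset) _ (by intro x hx; simp; right; simpa using hx)]
    calc (S.card : ℤ) = ∑ u ∈ S, 1 := by simp
      _ ≤ ∑ u ∈ S, D u := Finset.sum_le_sum hD1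
      _ ≤ _ := Finset.sum_le_sum_of_subset_of_nonneg Finset.subset_union_left fun u _ _ => hD0 u
  have hcard' : (S.card : ℝ) ≤ ((∑ᶠ u, D u : ℤ) : ℝ) := by exact_mod_cast hcard
  refine hcard'.trans (hj.trans ?_)
  rw [show (1 / 2 : ℝ) / (3 / 8) = 4 / 3 by norm_num, div_mul_eq_mul_div]
  gcongr
  have h1 : M / ‖E c‖ ≤ (G + 1) / b * Real.exp (2 * (5 / 4 + |T|) + B * |T|) := by
    rw [div_le_iff₀ hEc]
    have := hlow c hcre
    rw [hcim, Real.exp_neg, ← div_eq_mul_inv, div_le_iff₀ (by positivity)] at this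
    calc M = (G + 1) / b * Real.exp (2 * (5 / 4 + |T|)) * b := by rw [hM]; field_simp
      _ ≤ (G + 1) / b * Real.exp (2 * (5 / 4 + |T|)) * (‖E c‖ * Real.exp (B * |T|)) := by gcongr
      _ = _ := by rw [Real.exp_add]; ring
  refine (Real.log_le_log (by positivity) h1).trans ?_
  rw [Real.log_mul (by positivity) (by positivity), Real.log_exp]
  have h2 := le_abs_self (Real.log ((G + 1) / b))
  have h3 := abs_nonneg T
  have h4 : 0 ≤ |Real.log ((G + 1) / b)| * |T| := by positivity
  nlinarith

lemma summable_int_one_div_pow : Summable fun k : ℤ => 1 / (1 + |(k : ℝ)|) ^ 3 := by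
  have h : Summable fun n : ℕ => 1 / (1 + (n : ℝ)) ^ 3 := by
    have := (summable_nat_add_iff 1).2 (Real.summable_one_div_nat_pow.2 (show 1 < 3 by norm_num))
    simpa [add_comm] using this
  refine Summable.of_nat_of_neg ?_ ?_ <;> simpa using h

lemma HeckeData.summable_zeros (h : HeckeData K E q) :
    Summable fun ρ : {ρ : ℂ // E ρ = 0} => 1 / (1 + ρ.1.im ^ 2) ^ 2 := by
  obtain ⟨C, hC, hcard⟩ := h.exists_card_le
  set F : {ρ : ℂ // E ρ = 0} → ℤ := fun ρ => ⌊4 * ρ.1.im⌋ with hF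
  have hs := summable_int_one_div_pow.mul_left (C * 1024)
  refine summable_of_sum_le (c := ∑' k : ℤ, C * 1024 * (1 / (1 + |(k : ℝ)|) ^ 3))
    (fun ρ => by positivity) fun u => ?_
  rw [← Finset.sum_fiberwise_of_maps_to (t := u.image F) (g := F)
    fun x hx => Finset.mem_image_of_mem F hx]
  refine le_trans (Finset.sum_le_sum fun k _ => ?_) (hs.sum_le_tsum _ fun k _ => by positivity)
  have hk : ∀ ρ ∈ u.filter (fun ρ => F ρ = k), (k : ℝ) ≤ 4 * ρ.1.im ∧ 4 * ρ.1.im < k + 1 := by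
    intro ρ hρ
    have := (Finset.mem_filter.1 hρ).2
    exact Int.floor_eq_iff.1 this
  have h1 : ∀ ρ ∈ u.filter (fun ρ => F ρ = k), 1 / (1 + ρ.1.im ^ 2) ^ 2 ≤ 1024 / (1 + |(k : ℝ)|) ^ 4 := by
    intro ρ hρ
    obtain ⟨h1, h2⟩ := hk ρ hρ
    have h3 : |(k : ℝ)| ≤ 4 * |ρ.1.im| + 1 := by
      rw [abs_le]
      constructor <;> linarith [le_abs_self ρ.1.im, neg_abs_le ρ.1.im]
    have h4 : (1 + |(k : ℝ)|) ^ 2 ≤ 32 * (1 + ρ.1.im ^ 2) := by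
      rw [← sq_abs ρ.1.im]
      nlinarith [sq_nonneg (|ρ.1.im| - 1), abs_nonneg (k : ℝ), abs_nonneg ρ.1.im]
    rw [div_le_div_iff₀ (by positivity) (by positivity)]
    calc 1 * (1 + |(k : ℝ)|) ^ 4 = ((1 + |(k : ℝ)|) ^ 2) ^ 2 := by ring
      _ ≤ (32 * (1 + ρ.1.im ^ 2)) ^ 2 := by gcongr
      _ = _ := by ring
  have h2 := hcard (k / 4) ((u.filter (fun ρ => F ρ = k)).map ⟨Subtype.val, Subtype.val_injective⟩) (by
    intro ρ hρ
    obtain ⟨x, hx, rfl⟩ := Finset.mem_map.1 hρ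
    obtain ⟨h1, h2⟩ := hk x hx
    refine ⟨x.2, ?_⟩
    simp only [Function.Embedding.coeFn_mk]
    rw [abs_le]
    constructor <;> linarith)
  rw [Finset.card_map] at h2
  calc _ ≤ ((u.filter (fun ρ => F ρ = k)).card : ℝ) * (1024 / (1 + |(k : ℝ)|) ^ 4) := by
        rw [← nsmul_eq_mul]
        exact Finset.sum_le_card_nsmul _ _ _ h1
    _ ≤ C * (1 + |(k : ℝ)|) * (1024 / (1 + |(k : ℝ)|) ^ 4) := by
        gcongr
        have h3 : |(k : ℝ) / 4| ≤ |(k : ℝ)| := by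
          rw [abs_div, abs_of_pos (by norm_num : (0 : ℝ) < 4)]
          linarith [abs_nonneg (k : ℝ)]
        exact h2.trans (by gcongr)
    _ = _ := by field_simp

end ZeroCount

section StripResidue

/-- The filter of points in the strip `a ≤ Re z ≤ b` with `|Im z| → ∞`. -/
def stripEnd (a b : ℝ) : Filter ℂ :=
  comap (fun z : ℂ => |z.im|) atTop ⊓ 𝓟 (re ⁻¹' Set.Icc a b)

lemma mem_stripEnd {a b : ℝ} : re ⁻¹' Set.Icc a b ∈ stripEnd a b :=
  mem_inf_of_right (mem_principal_self _)

lemma tendsto_abs_im_stripEnd {a b : ℝ} : Tendsto (fun z : ℂ => |z.im|) (stripEnd a b) atTop :=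
  tendsto_comap.mono_left inf_le_left

lemma stripEnd_eventually {a b : ℝ} {p : ℂ → Prop} :
    (∀ᶠ z in stripEnd a b, p z) ↔ ∃ T0, ∀ z : ℂ, a ≤ z.re → z.re ≤ b → T0 ≤ |z.im| → p z := by
  rw [stripEnd, eventually_inf_principal, eventually_comap]
  constructor
  · intro h
    obtain ⟨T0, hT⟩ := eventually_atTop.1 h
    exact ⟨T0, fun z h1 h2 h3 => hT _ h3 z rfl ⟨h1, h2⟩⟩
  · rintro ⟨T0, hT⟩
    exact eventually_atTop.2 ⟨T0, fun T h1 z h2 h3 => hT z h3.1 h3.2 (h2 ▸ h1)⟩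

lemma tendsto_intervalIntegral_stripEnd {f : ℂ → ℂ} {a b : ℝ} (hab : a ≤ b)
    (hf : Tendsto f (stripEnd a b) (𝓝 0)) (σ : ℝ) (hσ : |σ| = 1) :
    Tendsto (fun T : ℝ => ∫ x in a..b, f (x + (σ * T : ℝ) * I)) atTop (𝓝 0) := by
  rw [Metric.tendsto_nhds]
  intro δ hδ
  rw [Metric.tendsto_nhds] at hf
  have h1 := hf (δ / (b - a + 1)) (by have := sub_nonneg.2 hab; positivity)
  obtain ⟨T0, hT⟩ := stripEnd_eventually.1 h1
  filter_upwards [eventually_ge_atTop T0, eventually_ge_atTop 0] with T h2 h3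
  rw [dist_zero_right]
  refine (intervalIntegral.norm_integral_le_of_norm_le_const (C := δ / (b - a + 1)) ?_).trans_lt ?_
  · intro x hx
    rw [Set.uIoc_of_le hab] at hx
    have := hT (x + (σ * T : ℝ) * I) (by simp; exact hx.1.le) (by simpa using hx.2)
      (by simp [hσ, abs_mul, abs_of_nonneg h3, h2])
    rw [dist_zero_right] at this
    exact this.le
  · rw [abs_of_nonneg (sub_nonneg.2 hab), div_mul_eq_mul_div, div_lt_iff₀ (by have := sub_nonneg.2 hab; positivity)]
    nlinarith

/-- The difference of the truncated integrals of `f` along `Re z = b` and `Re z = a`. -/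
def lineDiff (f : ℂ → ℂ) (a b T : ℝ) : ℂ :=
  (∫ t in -T..T, f (b + t * I)) - ∫ t in -T..T, f (a + t * I)

lemma tendsto_lineDiff_of_differentiableOn {f : ℂ → ℂ} {a b : ℝ} (hab : a ≤ b)
    (hd : DifferentiableOn ℂ f (re ⁻¹' Set.Icc a b)) (hf : Tendsto f (stripEnd a b) (𝓝 0)) :
    Tendsto (lineDiff f a b) atTop (𝓝 0) := by
  have h1 := tendsto_intervalIntegral_stripEnd hab hf 1 (by simp)
  have h2 := tendsto_intervalIntegral_stripEnd hab hf (-1) (by simp)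
  have h3 := (h1.sub h2).const_mul (-I)
  rw [sub_zero, mul_zero] at h3
  refine h3.congr fun T => ?_
  have h := Complex.integral_boundary_rect_eq_zero_of_differentiableOn f (a + (-T : ℝ) * I) (b + (T : ℝ) * I)
    (hd.mono fun z hz => by
      have := hz.1
      simp only [Set.mem_preimage] at this ⊢
      rw [Set.uIcc_of_le (by simpa using hab)] at this
      simpa using this)
  simp only [add_re, ofReal_re, mul_re, I_re, mul_zero, ofReal_im, I_im, add_im, mul_im,
    mul_one, zero_add, add_zero, sub_self, smul_eq_mul] at h
  rw [lineDiff]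
  simp only [one_mul, neg_one_mul]
  linear_combination I * h - (((∫ t in -T..T, f (b + t * I)) - ∫ t in -T..T, f (a + t * I))) * I_sq

lemma continuous_inv_pow_line {β : ℝ} (hβ : β ≠ 0) (n : ℕ) :
    Continuous fun t : ℝ => (((β : ℂ) + t * I) ^ n)⁻¹ := by
  refine Continuous.inv₀ (by fun_prop) fun t => pow_ne_zero _ fun h => hβ ?_
  simpa using congrArg Complex.re h

lemma add_mul_I_ne {β : ℝ} (hβ : β ≠ 0) (t : ℝ) : (β : ℂ) + t * I ≠ 0 := fun h =>
  hβ (by simpa using congrArg Complex.re h)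

lemma integral_inv_line {β : ℝ} (hβ : β ≠ 0) (T : ℝ) :
    ∫ t in -T..T, ((β : ℂ) + t * I)⁻¹ = (2 * Real.arctan (T / β) : ℝ) := by
  have hd : ∀ t : ℝ, HasDerivAt (fun t : ℝ => ((Real.arctan (t / β) : ℝ) : ℂ) -
      I / 2 * ((Real.log (β ^ 2 + t ^ 2) : ℝ) : ℂ)) ((β : ℂ) + t * I)⁻¹ t := by
    intro t
    have hp : 0 < β ^ 2 + t ^ 2 := by positivity
    have h1 : HasDerivAt (fun t : ℝ => Real.arctan (t / β)) (β / (β ^ 2 + t ^ 2)) t := by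
      refine (((hasDerivAt_id t).div_const β).arctan).congr_deriv ?_
      simp only [id]
      field_simp
    have h2 : HasDerivAt (fun t : ℝ => Real.log (β ^ 2 + t ^ 2)) (2 * t / (β ^ 2 + t ^ 2)) t := by
      refine (((hasDerivAt_id t).pow 2).const_add (β ^ 2) |>.log ?_).congr_deriv ?_
      · simpa using hp.ne'
      · simp
    refine (h1.ofReal_comp.sub (h2.ofReal_comp.const_mul (I / 2))).congr_deriv ?_
    have hp' : (β : ℂ) ^ 2 + t ^ 2 ≠ 0 := by exact_mod_cast hp.ne'
    have hn := add_mul_I_ne hβ t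
    push_cast
    field_simp
    linear_combination (-(t : ℂ) ^ 2) * I_sq
  rw [intervalIntegral.integral_eq_sub_of_hasDerivAt (fun t _ => hd t)
    (by simpa using (continuous_inv_pow_line hβ 1).intervalIntegrable _ _)]
  rw [neg_div, Real.arctan_neg]
  push_cast
  ring_nf

lemma tendsto_integral_inv_pow_line {β : ℝ} (hβ : β ≠ 0) (m : ℕ) :
    Tendsto (fun T : ℝ => ∫ t in -T..T, (((β : ℂ) + t * I) ^ (m + 2))⁻¹) atTop (𝓝 0) := by
  have hm : ((m : ℂ) + 1) ≠ 0 := by exact_mod_cast m.succ_ne_zero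
  have hd : ∀ t : ℝ, HasDerivAt (fun t : ℝ => -(I * (m + 1))⁻¹ * (((β : ℂ) + t * I) ^ (m + 1))⁻¹)
      (((β : ℂ) + t * I) ^ (m + 2))⁻¹ t := by
    intro t
    have hn := add_mul_I_ne hβ t
    have h0 : HasDerivAt (fun t : ℝ => (β : ℂ) + t * I) I t := by
      simpa using ((Complex.ofRealCLM.hasDerivAt (x := t)).mul_const I).const_add (β : ℂ)
    refine (((h0.fun_pow (m + 1)).fun_inv (pow_ne_zero _ hn)).const_mul _).congr_deriv ?_
    push_cast
    have := I_ne_zero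
    generalize (β : ℂ) + t * I = w at hn ⊢
    field_simp
    ring
  have hlim : Tendsto (fun t : ℝ => ‖(((β : ℂ) + t * I) ^ (m + 1))⁻¹‖) (comap (fun t : ℝ => |t|) atTop) (𝓝 0) := by
    have h1 : Tendsto (fun t : ℝ => |t|⁻¹) (comap (fun t : ℝ => |t|) atTop) (𝓝 0) :=
      tendsto_inv_atTop_zero.comp tendsto_comap
    refine squeeze_zero' (.of_forall fun _ => norm_nonneg _) ?_ h1
    filter_upwards [tendsto_comap.eventually (eventually_ge_atTop 1)] with t ht
    rw [norm_inv, norm_pow]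
    have h2 : |t| ≤ ‖(β : ℂ) + t * I‖ := by
      simpa using Complex.abs_im_le_norm ((β : ℂ) + t * I)
    gcongr
    exact h2.trans (le_self_pow₀ (ht.trans h2) (by simp))
  have hlim' := tendsto_zero_iff_norm_tendsto_zero.2 hlim
  have e1 : Tendsto (fun T : ℝ => T) atTop (comap (fun t : ℝ => |t|) atTop) :=
    tendsto_comap_iff.2 tendsto_abs_atTop_atTop
  have e2 : Tendsto (fun T : ℝ => -T) atTop (comap (fun t : ℝ => |t|) atTop) :=
    tendsto_comap_iff.2 (by simpa [Function.comp_def] using tendsto_abs_atTop_atTop)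
  have h := ((hlim'.comp e1).sub (hlim'.comp e2)).const_mul (-(I * (m + 1) : ℂ)⁻¹)
  rw [sub_zero, mul_zero] at h
  refine h.congr fun T => ?_
  rw [intervalIntegral.integral_eq_sub_of_hasDerivAt (fun t _ => hd t)
    ((continuous_inv_pow_line hβ _).intervalIntegrable _ _)]
  simp only [Function.comp_def]
  ring

lemma tendsto_lineDiff_inv_pow {a b x R : ℝ} (hR : 0 < R) (ha : a < x) (hb : x < b) (n : ℕ) (hn : n ≠ 0) :
    Tendsto (lineDiff (fun z => ((z - x) ^ n)⁻¹) a b) atTop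
      (𝓝 (-I * ∮ z in C(x, R), ((z - x) ^ n)⁻¹)) := by
  have e : ∀ (c t : ℝ), (c : ℂ) + t * I - x = ((c - x : ℝ) : ℂ) + t * I := fun c t => by
    push_cast; ring
  have hb' : b - x ≠ 0 := by linarith [sub_pos.2 hb]
  have ha' : a - x ≠ 0 := (sub_neg.2 ha).ne
  obtain ⟨m, rfl⟩ := Nat.exists_eq_succ_of_ne_zero hn
  rcases m with _ | m
  · simp only [Nat.succ_eq_add_one, zero_add, pow_one]
    rw [circleIntegral.integral_sub_center_inv _ hR.ne']
    unfold lineDiff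
    simp only [e, integral_inv_line hb', integral_inv_line ha']
    have hl : Tendsto (fun T : ℝ => Real.arctan (T / (b - x))) atTop (𝓝 (Real.pi / 2)) :=
      (Real.tendsto_arctan_atTop.mono_right nhdsWithin_le_nhds).comp
        (tendsto_id.atTop_div_const (sub_pos.2 hb))
    have hl' : Tendsto (fun T : ℝ => Real.arctan (T / (a - x))) atTop (𝓝 (-(Real.pi / 2))) :=
      (Real.tendsto_arctan_atBot.mono_right nhdsWithin_le_nhds).comp
        (tendsto_id.atTop_div_const_of_neg (sub_neg.2 ha))
    have := (((hl.const_mul 2).sub (hl'.const_mul 2))).ofReal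
    simp only [ofReal_sub] at this
    convert this using 2
    push_cast
    linear_combination -2 * Real.pi * I_sq
  · have h0 : (∮ z in C((x : ℂ), R), ((z - x) ^ (m + 2))⁻¹) = 0 := by
      have := circleIntegral.integral_sub_zpow_of_ne (n := -((m + 2 : ℕ) : ℤ)) (by omega) (x : ℂ) x R
      simpa only [zpow_neg, zpow_natCast] using this
    rw [Nat.succ_eq_add_one, h0, mul_zero]
    unfold lineDiff
    simp only [e]
    have := (tendsto_integral_inv_pow_line hb' m).sub (tendsto_integral_inv_pow_line ha' m)
    rwa [sub_zero] at this

lemma tendsto_inv_pow_stripEnd {a b : ℝ} (x : ℝ) (n : ℕ) (hn : n ≠ 0) :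
    Tendsto (fun z : ℂ => ((z - x) ^ n)⁻¹) (stripEnd a b) (𝓝 0) := by
  rw [tendsto_zero_iff_norm_tendsto_zero]
  refine squeeze_zero' (.of_forall fun _ => norm_nonneg _) ?_
    (tendsto_inv_atTop_zero.comp (tendsto_abs_im_stripEnd (a := a) (b := b)))
  filter_upwards [tendsto_abs_im_stripEnd.eventually (eventually_ge_atTop 1)] with z hz
  have h2 : |z.im| ≤ ‖z - x‖ := by
    simpa using Complex.abs_im_le_norm (z - x)
  rw [norm_inv, norm_pow]
  simp only [Function.comp_apply]
  gcongr
  exact h2.trans (le_self_pow₀ (hz.trans h2) hn)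

lemma tendsto_lineDiff_div {a b x R : ℝ} (hR : 0 < R) (ha : a < x - R) (hb : x + R < b) (n : ℕ)
    {ψ : ℂ → ℂ} (hψ : DifferentiableOn ℂ ψ (re ⁻¹' Set.Icc a b))
    (hf : Tendsto (fun z => ψ z * ((z - x) ^ n)⁻¹) (stripEnd a b) (𝓝 0)) :
    Tendsto (lineDiff (fun z => ψ z * ((z - x) ^ n)⁻¹) a b) atTop
      (𝓝 (-I * ∮ z in C(x, R), ψ z * ((z - x) ^ n)⁻¹)) := by
  have hab : a ≤ b := by linarith
  have hball : Metric.closedBall (x : ℂ) R ⊆ re ⁻¹' Set.Icc a b := by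
    intro z hz
    rw [mem_closedBall_iff_norm] at hz
    have := (Complex.abs_re_le_norm _).trans hz
    rw [sub_re, ofReal_re, abs_le] at this
    constructor <;> linarith
  induction n generalizing ψ with
  | zero =>
    simp only [pow_zero, inv_one, mul_one] at hf ⊢
    have h0 : (∮ z in C((x : ℂ), R), ψ z) = 0 :=
      Complex.circleIntegral_eq_zero_of_differentiable_on_off_countable hR.le Set.countable_empty
        (hψ.continuousOn.mono hball) fun z hz => by
          refine hψ.differentiableAt (mem_of_superset (Metric.isOpen_ball.mem_nhds hz.1) ?_)
          exact Metric.ball_subset_closedBall.trans hball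
    rw [h0, mul_zero]
    exact tendsto_lineDiff_of_differentiableOn hab hψ hf
  | succ n ih =>
    have hnhds : re ⁻¹' Set.Icc a b ∈ 𝓝 (x : ℂ) :=
      mem_of_superset (Metric.closedBall_mem_nhds _ hR) hball
    set φ := dslope ψ x with hφ
    have hφd : DifferentiableOn ℂ φ (re ⁻¹' Set.Icc a b) :=
      (Complex.differentiableOn_dslope hnhds).2 hψ
    have hsplit : ∀ z : ℂ, z ≠ x → ψ z * ((z - x) ^ (n + 1))⁻¹ =
        φ z * ((z - x) ^ n)⁻¹ + ψ x * ((z - x) ^ (n + 1))⁻¹ := by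
      intro z hz
      have h1 := sub_smul_dslope ψ x z
      rw [smul_eq_mul, ← hφ] at h1
      have := sub_ne_zero.2 hz
      rw [show ψ z = (z - x) * φ z + ψ x by rw [h1]; ring]
      field_simp
      ring
    have hlim2 := (tendsto_inv_pow_stripEnd (a := a) (b := b) x (n + 1) (by simp)).const_mul (ψ x)
    rw [mul_zero] at hlim2
    have hlim1 : Tendsto (fun z => φ z * ((z - x) ^ n)⁻¹) (stripEnd a b) (𝓝 0) := by
      have := hf.sub hlim2
      rw [sub_zero] at this
      refine this.congr' ?_
      filter_upwards [tendsto_abs_im_stripEnd.eventually (eventually_ge_atTop 1)] with z hz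
      rw [hsplit z (by rintro rfl; simp at hz; linarith)]
      ring
    have h1 := ih hφd hlim1
    have h2 := (tendsto_lineDiff_inv_pow hR (show a < x by linarith) (show x < b by linarith) (n + 1)
      (by simp)).const_mul (ψ x)
    have hline : ∀ (g : ℂ → ℂ), DifferentiableOn ℂ g (re ⁻¹' Set.Icc a b) → ∀ (k : ℕ) (c : ℝ), a ≤ c → c ≤ b →
        c ≠ x → Continuous fun t : ℝ => g (c + t * I) * (((c : ℂ) + t * I - x) ^ k)⁻¹ := by
      intro g hg k c h1 h2 h3
      refine Continuous.mul ?_ ?_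
      · exact hg.continuousOn.comp_continuous (by fun_prop) fun t => by simp [h1, h2]
      · refine Continuous.inv₀ (by fun_prop) fun t => pow_ne_zero _ fun h => h3 ?_
        have := congrArg Complex.re h
        simp at this
        linarith
    have hcirc : (∮ z in C((x : ℂ), R), ψ z * ((z - x) ^ (n + 1))⁻¹) =
        (∮ z in C((x : ℂ), R), φ z * ((z - x) ^ n)⁻¹) + ψ x * ∮ z in C((x : ℂ), R), ((z - x) ^ (n + 1))⁻¹ := by
      have hne : ∀ z ∈ Metric.sphere (x : ℂ) R, z ≠ x := fun z hz h => by
        rw [h, mem_sphere_iff_norm, sub_self, norm_zero] at hz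
        exact hR.ne hz
      have hcs : ∀ k : ℕ, ContinuousOn (fun z : ℂ => ((z - x) ^ k)⁻¹) (Metric.sphere (x : ℂ) R) := fun k =>
        ContinuousOn.inv₀ (by fun_prop) fun z hz => pow_ne_zero _ (sub_ne_zero.2 (hne z hz))
      rw [circleIntegral.integral_congr hR.le (fun z hz => hsplit z (hne z hz)),
        circleIntegral.integral_add, circleIntegral.integral_const_mul]
      · exact ContinuousOn.circleIntegrable hR.le
          ((hφd.continuousOn.mono (Metric.sphere_subset_closedBall.trans hball)).mul (hcs n))
      · exact ContinuousOn.circleIntegrable hR.le (continuousOn_const.mul (hcs (n + 1)))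
    rw [hcirc]
    have h3 := h1.add h2
    rw [show -I * (∮ z in C((x : ℂ), R), φ z * ((z - x) ^ n)⁻¹) + ψ x * (-I * ∮ z in C((x : ℂ), R), ((z - x) ^ (n + 1))⁻¹) =
      -I * ((∮ z in C((x : ℂ), R), φ z * ((z - x) ^ n)⁻¹) + ψ x * ∮ z in C((x : ℂ), R), ((z - x) ^ (n + 1))⁻¹) by ring] at h3
    refine h3.congr fun T => ?_
    have key : ∀ c : ℝ, a ≤ c → c ≤ b → c ≠ x → (∫ t in -T..T, ψ (c + t * I) * (((c : ℂ) + t * I - x) ^ (n + 1))⁻¹) =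
        (∫ t in -T..T, φ (c + t * I) * (((c : ℂ) + t * I - x) ^ n)⁻¹) +
          ψ x * ∫ t in -T..T, (((c : ℂ) + t * I - x) ^ (n + 1))⁻¹ := by
      intro c h1 h2 h3
      rw [← intervalIntegral.integral_const_mul, ← intervalIntegral.integral_add
        ((hline φ hφd n c h1 h2 h3).intervalIntegrable _ _)
        ((hline (fun _ => ψ x) (differentiableOn_const _) (n + 1) c h1 h2 h3).intervalIntegrable _ _)]
      refine intervalIntegral.integral_congr fun t _ => hsplit _ fun h => h3 ?_
      have := congrArg Complex.re h
      simpa using this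
    unfold lineDiff
    rw [key b hab le_rfl (by linarith), key a le_rfl hab (by linarith)]
    ring

end StripResidue

section GaussWeight

lemma integral_line_sub {f ψ : ℂ → ℂ} {a b x R : ℝ} (hR : 0 < R) (ha : a < x - R) (hb : x + R < b) {n : ℕ}
    (hψ : DifferentiableOn ℂ ψ (re ⁻¹' Set.Icc a b))
    (hf : ∀ z : ℂ, a ≤ z.re → z.re ≤ b → z ≠ x → f z = ψ z * ((z - x) ^ n)⁻¹)
    (hlim : Tendsto f (stripEnd a b) (𝓝 0))
    (hia : Integrable fun t : ℝ => f (a + t * I)) (hib : Integrable fun t : ℝ => f (b + t * I)) :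
    (∫ t : ℝ, f (b + t * I)) - ∫ t : ℝ, f (a + t * I) = -I * ∮ z in C(x, R), f z := by
  have hball : Metric.closedBall (x : ℂ) R ⊆ re ⁻¹' Set.Icc a b := by
    intro z hz
    rw [mem_closedBall_iff_norm] at hz
    have := (Complex.abs_re_le_norm _).trans hz
    rw [sub_re, ofReal_re, abs_le] at this
    constructor <;> linarith
  have h1 : Tendsto (fun z => ψ z * ((z - x) ^ n)⁻¹) (stripEnd a b) (𝓝 0) := by
    refine hlim.congr' ?_
    filter_upwards [mem_stripEnd, tendsto_abs_im_stripEnd.eventually (eventually_ge_atTop 1)] with z hz h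
    exact hf z hz.1 hz.2 (by rintro rfl; simp at h; linarith)
  have h2 := tendsto_lineDiff_div hR ha hb n hψ h1
  have h3 : (∮ z in C((x : ℂ), R), f z) = ∮ z in C((x : ℂ), R), ψ z * ((z - x) ^ n)⁻¹ :=
    circleIntegral.integral_congr hR.le fun z hz => by
      have := hball (Metric.sphere_subset_closedBall hz)
      refine hf z this.1 this.2 fun h => ?_
      rw [h, mem_sphere_iff_norm, sub_self, norm_zero] at hz
      exact hR.ne hz
  have hline : ∀ (c t : ℝ), a ≤ c → c ≤ b → c ≠ x →
      f (c + t * I) = ψ (c + t * I) * (((c : ℂ) + t * I - x) ^ n)⁻¹ := fun c t h1 h2 h3 =>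
    hf _ (by simpa using h1) (by simpa using h2) fun h => h3 (by simpa using congrArg Complex.re h)
  rw [h3]
  refine tendsto_nhds_unique ?_ h2
  have h4 := (intervalIntegral_tendsto_integral hib tendsto_neg_atTop_atBot tendsto_id).sub
    (intervalIntegral_tendsto_integral hia tendsto_neg_atTop_atBot tendsto_id)
  refine h4.congr fun T => ?_
  unfold lineDiff
  congr 1
  · exact intervalIntegral.integral_congr fun t _ => hline b t (by linarith) le_rfl (by linarith)
  · exact intervalIntegral.integral_congr fun t _ => hline a t le_rfl (by linarith) (by linarith)

/-- The Gaussian weight `exp (ε z² + y z)` with `z = s - 1/2`. -/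
def gaussW (ε y : ℝ) (s : ℂ) : ℂ := cexp (ε * (s - 1 / 2) ^ 2 + y * (s - 1 / 2))

lemma differentiable_gaussW (ε y : ℝ) : Differentiable ℂ (gaussW ε y) := by
  unfold gaussW; fun_prop

lemma continuous_gaussW (ε y : ℝ) : Continuous (gaussW ε y) := (differentiable_gaussW ε y).continuous

lemma norm_gaussW (ε y : ℝ) (s : ℂ) : ‖gaussW ε y s‖ =
    Real.exp (ε * ((s.re - 1 / 2) ^ 2 - s.im ^ 2) + y * (s.re - 1 / 2)) := by
  rw [gaussW, Complex.norm_exp]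
  congr 1
  simp [sq, Complex.mul_re, Complex.mul_im]

lemma gaussW_mul (ε ε' y y' : ℝ) (s : ℂ) : gaussW ε y s * gaussW ε' y' s = gaussW (ε + ε') (y + y') s := by
  rw [gaussW, gaussW, gaussW, ← Complex.exp_add]
  congr 1
  push_cast
  ring

lemma exists_norm_gaussW_le {ε : ℝ} (hε : 0 < ε) (y a b C : ℝ) :
    ∃ D, 0 ≤ D ∧ ∀ s : ℂ, a ≤ s.re → s.re ≤ b →
      ‖gaussW ε y s‖ * Real.exp (C * |s.im|) ≤ D * Real.exp (-(ε / 2) * s.im ^ 2) := by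
  set A : ℝ := |a| + |b| + 1 with hA
  refine ⟨Real.exp (ε * A ^ 2 + |y| * A + C ^ 2 / (2 * ε)), by positivity, fun s h1 h2 => ?_⟩
  rw [norm_gaussW, ← Real.exp_add, ← Real.exp_add]
  refine Real.exp_le_exp.2 ?_
  have h3 : |s.re - 1 / 2| ≤ A := by
    rw [abs_le]
    constructor <;> linarith [neg_abs_le a, le_abs_self b, abs_nonneg a, abs_nonneg b]
  have h4 : (s.re - 1 / 2) ^ 2 ≤ A ^ 2 := by
    rw [← sq_abs]; gcongr
  have h5 : y * (s.re - 1 / 2) ≤ |y| * A := by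
    refine (le_abs_self _).trans ?_
    rw [abs_mul]; gcongr
  have h6 : C * |s.im| ≤ C ^ 2 / (2 * ε) + ε / 2 * s.im ^ 2 := by
    have : C ^ 2 / (2 * ε) + ε / 2 * s.im ^ 2 - C * |s.im| = (C - ε * |s.im|) ^ 2 / (2 * ε) := by
      rw [← sq_abs s.im]
      field_simp
      ring
    have h : 0 ≤ (C - ε * |s.im|) ^ 2 / (2 * ε) := by positivity
    linarith
  nlinarith

lemma tendsto_stripEnd_of_le {f : ℂ → ℂ} {a b D δ : ℝ} (hδ : 0 < δ)
    (h : ∀ᶠ z in stripEnd a b, ‖f z‖ ≤ D * Real.exp (-δ * z.im ^ 2)) : Tendsto f (stripEnd a b) (𝓝 0) := by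
  rw [tendsto_zero_iff_norm_tendsto_zero]
  refine squeeze_zero' (.of_forall fun _ => norm_nonneg _) h ?_
  have h1 : Tendsto (fun u : ℝ => D * Real.exp (-δ * u ^ 2)) atTop (𝓝 0) := by
    have : Tendsto (fun u : ℝ => δ * u ^ 2) atTop atTop :=
      (tendsto_pow_atTop two_ne_zero).const_mul_atTop hδ
    have := (Real.tendsto_exp_neg_atTop_nhds_zero.comp this).const_mul D
    rw [mul_zero] at this
    simpa [Function.comp_def, neg_mul] using this
  have := h1.comp (tendsto_abs_im_stripEnd (a := a) (b := b))
  simpa [Function.comp_def, sq_abs] using this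

lemma integrable_of_le_gauss {f : ℝ → ℂ} {D δ : ℝ} (hδ : 0 < δ) (hf : Continuous f)
    (h : ∀ t, ‖f t‖ ≤ D * Real.exp (-δ * t ^ 2)) : Integrable f :=
  ((integrable_exp_neg_mul_sq hδ).const_mul D).mono' hf.aestronglyMeasurable (.of_forall h)

lemma integral_gaussW_div {ε : ℝ} (hε : 0 < ε) (y : ℝ) {ρ : ℂ} (hρ : ρ.re = 1 / 2) :
    (∫ t : ℝ, gaussW ε y ((3 / 4 : ℝ) + t * I) / ((3 / 4 : ℝ) + t * I - ρ)) -
      ∫ t : ℝ, gaussW ε y ((1 / 4 : ℝ) + t * I) / ((1 / 4 : ℝ) + t * I - ρ) = 2 * Real.pi * gaussW ε y ρ := by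
  set ψ : ℂ → ℂ := fun z => gaussW ε y (z + ρ.im * I) with hψ
  have hψd : Differentiable ℂ ψ := by
    rw [hψ]
    exact (differentiable_gaussW ε y).comp (by fun_prop)
  have hρ' : ρ = 1 / 2 + ρ.im * I := by
    apply Complex.ext <;> simp [hρ]
  have hshift : ∀ c : ℝ, (∫ t : ℝ, gaussW ε y (c + t * I) / (c + t * I - ρ)) =
      ∫ t : ℝ, ψ (c + t * I) / (c + t * I - (1 / 2 : ℝ)) := by
    intro c
    rw [← integral_add_right_eq_self _ ρ.im]
    congr 1
    funext t
    rw [hψ]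
    dsimp only
    congr 1
    · congr 1; push_cast; ring
    · nth_rw 2 [hρ']; push_cast; ring
  obtain ⟨D, hD, hb⟩ := exists_norm_gaussW_le hε y (1 / 4) (3 / 4) 0
  set δ := ε / 4
  have hδ : 0 < δ := by positivity
  have hb' : ∀ z : ℂ, 1 / 4 ≤ z.re → z.re ≤ 3 / 4 →
      ‖ψ z‖ ≤ D * Real.exp (ε / 2 * ρ.im ^ 2) * Real.exp (-δ * z.im ^ 2) := by
    intro z h1 h2
    have := hb (z + ρ.im * I) (by simpa using h1) (by simpa using h2)
    rw [zero_mul, Real.exp_zero, mul_one] at this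
    refine this.trans ?_
    rw [mul_assoc, ← Real.exp_add]
    gcongr
    simp only [add_im, mul_im, ofReal_re, I_im, mul_one, ofReal_im, I_re, mul_zero, add_zero]
    have : 0 ≤ ε / 4 * (z.im + 2 * ρ.im) ^ 2 := by positivity
    simp only [δ]
    nlinarith
  have hden : ∀ c : ℝ, |c - 1 / 2| = 1 / 4 → ∀ t : ℝ, 1 / 4 ≤ ‖(c : ℂ) + t * I - (1 / 2 : ℝ)‖ := by
    intro c hc t
    have := Complex.abs_re_le_norm ((c : ℂ) + t * I - (1 / 2 : ℝ))
    simp only [sub_re, add_re, ofReal_re, mul_re, I_re, mul_zero, ofReal_im, I_im, mul_one, sub_self,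
      add_zero] at this
    linarith
  have hint : ∀ c : ℝ, 1 / 4 ≤ c → c ≤ 3 / 4 → |c - 1 / 2| = 1 / 4 →
      Integrable fun t : ℝ => ψ (c + t * I) / (c + t * I - (1 / 2 : ℝ)) := by
    intro c h1 h2 hc
    refine integrable_of_le_gauss (D := D * Real.exp (ε / 2 * ρ.im ^ 2) * 4) hδ ?_ fun t => ?_
    · refine Continuous.div (hψd.continuous.comp (by fun_prop)) (by fun_prop) fun t h => ?_
      have := hden c hc t
      rw [h, norm_zero] at this
      linarith
    · rw [norm_div, div_le_iff₀ (by linarith [hden c hc t])]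
      have h3 := hb' (c + t * I) (by simpa using h1) (by simpa using h2)
      have h4 := hden c hc t
      simp only [add_im, mul_im, ofReal_re, I_im, mul_one, ofReal_im, I_re, mul_zero, add_zero, zero_add] at h3
      have h5 : 0 ≤ D * Real.exp (ε / 2 * ρ.im ^ 2) * Real.exp (-δ * t ^ 2) := by positivity
      nlinarith [mul_nonneg h5 (by linarith : 0 ≤ 4 * ‖(c : ℂ) + t * I - (1 / 2 : ℝ)‖ - 1)]
  rw [hshift, hshift]
  rw [integral_line_sub (f := fun z => ψ z / (z - (1 / 2 : ℝ))) (ψ := ψ) (x := 1 / 2) (R := 1 / 8) (n := 1) (by norm_num)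
    (by norm_num) (by norm_num) hψd.differentiableOn (fun z _ _ _ => by rw [pow_one, div_eq_mul_inv]) ?_
    (hint _ (by norm_num) (by norm_num) (by norm_num [abs_of_neg])) (hint _ (by norm_num) (by norm_num) (by norm_num [abs_of_pos]))]
  · have := (hψd.diffContOnCl (s := Metric.ball ((1 / 2 : ℝ) : ℂ) (1 / 8))).circleIntegral_sub_inv_smul
      (Metric.mem_ball_self (by norm_num))
    simp only [smul_eq_mul] at this
    rw [show (fun z => ψ z / (z - (1 / 2 : ℝ))) = fun z => (z - ((1 / 2 : ℝ) : ℂ))⁻¹ * ψ z from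
      funext fun z => div_eq_inv_mul _ _, this]
    rw [show ψ ((1 / 2 : ℝ) : ℂ) = gaussW ε y ρ by rw [hψ]; dsimp only; rw [hρ']; congr 1; simp]
    linear_combination -2 * Real.pi * gaussW ε y ρ * I_sq
  · refine tendsto_stripEnd_of_le (D := D * Real.exp (ε / 2 * ρ.im ^ 2)) hδ ?_
    filter_upwards [mem_stripEnd, tendsto_abs_im_stripEnd.eventually (eventually_ge_atTop 1)] with z hz h
    rw [norm_div]
    have h1 : 1 ≤ ‖z - (1 / 2 : ℝ)‖ := h.trans (by simpa using Complex.abs_im_le_norm (z - (1 / 2 : ℝ)))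
    exact (div_le_self (norm_nonneg _) h1).trans (hb' z hz.1 hz.2)

end GaussWeight

section SubtractPoles

lemma differentiableOn_tsum_div_sub {ι : Type*} {d z : ι → ℂ} {c : ℂ} {δ : ℝ} (hδ : 0 < δ)
    (hd : Summable fun i => ‖d i‖) (hz : ∀ i, d i = 0 ∨ δ ≤ ‖z i - c‖) :
    (∀ s ∈ Metric.ball c (δ / 2), Summable fun i => d i / (s - z i)) ∧
      DifferentiableOn ℂ (fun s => ∑' i, d i / (s - z i)) (Metric.ball c (δ / 2)) := by
  have hlow : ∀ i, ∀ s ∈ Metric.ball c (δ / 2), d i = 0 ∨ δ / 2 ≤ ‖s - z i‖ := fun i s hs => by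
    refine (hz i).imp_right fun h => ?_
    have h1 : ‖z i - c‖ ≤ ‖s - c‖ + ‖s - z i‖ := by
      rw [show z i - c = (s - c) - (s - z i) by ring]
      exact norm_sub_le _ _
    rw [mem_ball_iff_norm] at hs
    linarith
  have hle : ∀ i, ∀ s ∈ Metric.ball c (δ / 2), ‖d i / (s - z i)‖ ≤ ‖d i‖ * (δ / 2)⁻¹ :=
      fun i s hs => by
    rcases hlow i s hs with h | h
    · simp [h]
    · rw [norm_div, div_eq_mul_inv]
      gcongr
  refine ⟨fun s hs => (hd.mul_right (δ / 2)⁻¹).of_norm_bounded fun i => hle i s hs,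
    differentiableOn_tsum_of_summable_norm (hd.mul_right (δ / 2)⁻¹) (fun i s hs => ?_)
      Metric.isOpen_ball hle⟩
  rcases hlow i s hs with h | h
  · simp only [h, zero_div]
    exact differentiableWithinAt_const _
  · refine DifferentiableWithinAt.div (by fun_prop) (by fun_prop) fun h0 => ?_
    rw [h0, norm_zero] at h
    linarith

lemma exists_eq_limit_of_removable {H : ℂ → ℂ} {U : Set ℂ}
    (h : ∀ c ∈ U, ∃ g : ℂ → ℂ, ∃ δ, 0 < δ ∧ DifferentiableOn ℂ g (Metric.ball c δ) ∧
      ∀ s ∈ Metric.ball c δ, s ≠ c → H s = g s) :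
    ∃ J : ℂ → ℂ, (∀ s ∈ U, DifferentiableAt ℂ J s) ∧ ∀ s ∈ U, ContinuousAt H s → J s = H s := by
  refine ⟨fun s => limUnder (𝓝[≠] s) H, fun c hc => ?_, fun s _ hs => ?_⟩
  · obtain ⟨g, δ, hδ, hg, hH⟩ := h c hc
    refine DifferentiableAt.congr_of_eventuallyEq (hg.differentiableAt (Metric.ball_mem_nhds c hδ)) ?_
    filter_upwards [Metric.ball_mem_nhds c hδ] with s hs
    have hgs := (hg.differentiableAt (Metric.isOpen_ball.mem_nhds hs)).continuousAt
    refine Tendsto.limUnder_eq ?_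
    refine (hgs.tendsto.mono_left nhdsWithin_le_nhds).congr' ?_
    have hc' : ∀ᶠ z in 𝓝[≠] s, z ≠ c := by
      by_cases hsc : s = c
      · rw [hsc]; exact self_mem_nhdsWithin
      · exact nhdsWithin_le_nhds (isOpen_ne.mem_nhds hsc)
    filter_upwards [hc', nhdsWithin_le_nhds (Metric.isOpen_ball.mem_nhds hs)] with z h1 h2
    exact (hH z h2 h1).symm
  · exact Tendsto.limUnder_eq (hs.tendsto.mono_left nhdsWithin_le_nhds)

lemma norm_le_of_le_div_abs_re {J : ℂ → ℂ} {B : ℝ} (hB : 0 ≤ B)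
    (hJ : ∀ s : ℂ, 1 / 4 ≤ s.re → s.re ≤ 3 / 4 → DifferentiableAt ℂ J s)
    (hb : ∀ s : ℂ, 1 / 4 ≤ s.re → s.re ≤ 3 / 4 → s.re ≠ 1 / 2 → ‖J s‖ ≤ B / |s.re - 1 / 2|)
    {s : ℂ} (h1 : 1 / 4 ≤ s.re) (h2 : s.re ≤ 3 / 4) : ‖J s‖ ≤ 8 * B := by
  set c : ℂ := 1 / 2 + s.im * I with hc
  have hcre : c.re = 1 / 2 := by simp [c]
  have hcim : c.im = s.im := by simp [c]
  have hstrip : ∀ z ∈ Metric.closedBall c (1 / 4), 1 / 4 ≤ z.re ∧ z.re ≤ 3 / 4 := fun z hz => by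
    rw [mem_closedBall_iff_norm] at hz
    have := abs_le.1 ((Complex.abs_re_le_norm _).trans hz)
    rw [sub_re, hcre] at this
    constructor <;> linarith
  have hfr : ∀ z ∈ frontier (Metric.ball c (1 / 4)),
      ‖J z * ((z - c) ^ 2 + (1 / 4) ^ 2)‖ ≤ B / 2 := fun z hz => by
    rw [frontier_ball c (by norm_num)] at hz
    obtain ⟨hz1, hz2⟩ := hstrip z (Metric.sphere_subset_closedBall hz)
    rw [mem_sphere_iff_norm] at hz
    have hsq : normSq (z - c) = (1 / 4) ^ 2 := by rw [normSq_eq_norm_sq, hz]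
    have hfac : (z - c) ^ 2 + (1 / 4) ^ 2 = (2 * (z.re - 1 / 2) : ℝ) * (z - c) := by
      have h3 : ((1 / 4 : ℂ)) ^ 2 = (z - c) * (starRingEnd ℂ) (z - c) := by
        rw [mul_conj, hsq]; push_cast; ring
      have h4 := add_conj (z - c)
      rw [sub_re, hcre] at h4
      rw [h3, ← h4]
      ring
    rw [hfac, norm_mul, norm_mul, hz, Complex.norm_real, Real.norm_eq_abs, abs_mul]
    by_cases h0 : z.re = 1 / 2
    · simp [h0]; positivity
    · have := hb z hz1 hz2 h0
      rw [le_div_iff₀ (abs_pos.2 (sub_ne_zero.2 h0))] at this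
      rw [abs_two]
      linarith
  have hdc : DiffContOnCl ℂ (fun z => J z * ((z - c) ^ 2 + (1 / 4) ^ 2)) (Metric.ball c (1 / 4)) := by
    refine DifferentiableOn.diffContOnCl fun z hz => ?_
    rw [closure_ball c (by norm_num)] at hz
    have := hJ z (hstrip z hz).1 (hstrip z hz).2
    exact DifferentiableAt.differentiableWithinAt (by fun_prop)
  have hs : s - c = ((s.re - 1 / 2 : ℝ) : ℂ) := by
    apply Complex.ext <;> simp [hcre, hcim]
  have := Complex.norm_le_of_forall_mem_frontier_norm_le Metric.isBounded_ball hdc hfr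
    (z := s) (by
      rw [closure_ball c (by norm_num), mem_closedBall_iff_norm, hs, Complex.norm_real,
        Real.norm_eq_abs, abs_le]
      constructor <;> linarith)
  rw [norm_mul, hs] at this
  rw [show ((((s.re - 1 / 2 : ℝ) : ℂ)) ^ 2 + (1 / 4) ^ 2) = (((s.re - 1 / 2) ^ 2 + (1 / 4) ^ 2 : ℝ) : ℂ) by
    push_cast; ring, Complex.norm_real, Real.norm_of_nonneg (by positivity)] at this
  nlinarith [norm_nonneg (J s), mul_nonneg (norm_nonneg (J s)) (sq_nonneg (s.re - 1 / 2))]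

lemma abs_re_sub_le {z s : ℂ} (hz : z.re = 1 / 2) : |s.re - 1 / 2| ≤ ‖s - z‖ := by
  rw [← hz, ← sub_re]
  exact Complex.abs_re_le_norm _

lemma norm_tsum_div_sub_le {ι : Type*} {d z : ι → ℂ} (hd : Summable fun i => ‖d i‖)
    (hz : ∀ i, (z i).re = 1 / 2) {s : ℂ} (hs : s.re ≠ 1 / 2) :
    Summable (fun i => ‖d i / (s - z i)‖) ∧
      ‖∑' i, d i / (s - z i)‖ ≤ (∑' i, ‖d i‖) / |s.re - 1 / 2| := by
  have hpos : 0 < |s.re - 1 / 2| := abs_pos.2 (sub_ne_zero.2 hs)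
  have hle : ∀ i, ‖d i / (s - z i)‖ ≤ ‖d i‖ / |s.re - 1 / 2| := fun i => by
    rw [norm_div]
    have := abs_re_sub_le (hz i) (s := s)
    gcongr
  have hsum := (hd.div_const |s.re - 1 / 2|).of_nonneg_of_le (fun i => norm_nonneg _) hle
  exact ⟨hsum, (norm_tsum_le_tsum_norm hsum).trans
    ((hsum.tsum_le_tsum hle (hd.div_const _)).trans_eq tsum_div_const)⟩

/-- A quotient with simple poles on `Re s = 1/2`, growing like `1 / |Re s - 1/2|`, is a bounded
holomorphic function on the strip plus its polar parts. -/
lemma exists_bounded_sub_poles {E N : ℂ → ℂ} (hE : Differentiable ℂ E)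
    (hN : ∀ s : ℂ, 0 < s.re → DifferentiableAt ℂ N s) (hre : ∀ s, E s = 0 → s.re = 1 / 2)
    (hder : ∀ s, E s = 0 → deriv E s ≠ 0)
    (hd : Summable fun ρ : {ρ : ℂ // E ρ = 0} => ‖N ρ / deriv E ρ‖) {B : ℝ} (hB : 0 ≤ B)
    (hb : ∀ s : ℂ, 1 / 4 ≤ s.re → s.re ≤ 3 / 4 → s.re ≠ 1 / 2 → ‖N s / E s‖ ≤ B / |s.re - 1 / 2|) :
    ∃ (J : ℂ → ℂ) (B' : ℝ), (∀ s : ℂ, 1 / 4 ≤ s.re → s.re ≤ 3 / 4 → DifferentiableAt ℂ J s ∧ ‖J s‖ ≤ B') ∧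
      ∀ s : ℂ, 1 / 4 ≤ s.re → s.re ≤ 3 / 4 → s.re ≠ 1 / 2 →
        N s / E s = J s + ∑' ρ : {ρ : ℂ // E ρ = 0}, N ρ / deriv E ρ / (s - ρ) := by
  set d : {ρ : ℂ // E ρ = 0} → ℂ := fun ρ => N ρ / deriv E ρ with hddef
  set H : ℂ → ℂ := fun s => N s / E s - ∑' ρ : {ρ : ℂ // E ρ = 0}, d ρ / (s - ρ) with hH
  have hopen : IsOpen {s : ℂ | 0 < s.re} := isOpen_lt continuous_const continuous_re
  have hregular : ∀ c : ℂ, 0 < c.re → E c ≠ 0 →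
      ∃ δ, 0 < δ ∧ DifferentiableOn ℂ H (Metric.ball c δ) := by
    intro c hc h0
    obtain ⟨δ, hδ, hball⟩ := Metric.eventually_nhds_iff_ball.1
      ((hE.continuous.continuousAt.eventually_ne h0).and (hopen.mem_nhds hc))
    refine ⟨δ / 2, by positivity, DifferentiableOn.sub (fun s hs => ?_)
      (differentiableOn_tsum_div_sub hδ hd fun ρ => Or.inr ?_).2⟩
    · have := hball s (Metric.ball_subset_ball (by linarith) hs)
      exact ((hN s this.2).div hE.differentiableAt this.1).differentiableWithinAt
    · by_contra! hlt
      exact (hball ρ (mem_ball_iff_norm.2 hlt)).1 ρ.2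
  have hlocal : ∀ c ∈ {s : ℂ | 0 < s.re}, ∃ g : ℂ → ℂ, ∃ δ, 0 < δ ∧
      DifferentiableOn ℂ g (Metric.ball c δ) ∧ ∀ s ∈ Metric.ball c δ, s ≠ c → H s = g s := by
    intro c hc
    by_cases h0 : E c = 0
    · have hne : ∀ᶠ s in 𝓝 c, s ≠ c → E s ≠ 0 := by
        have := (hE c).hasDerivAt.eventually_ne (c := 0) (hder c h0)
        exact eventually_nhdsWithin_iff.1 this
      obtain ⟨δ, hδ, hball⟩ := Metric.eventually_nhds_iff_ball.1 (hne.and (hopen.mem_nhds hc))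
      have hmem : Metric.ball c (δ / 2) ∈ 𝓝 c := Metric.ball_mem_nhds c (by positivity)
      have hsub : Metric.ball c (δ / 2) ⊆ Metric.ball c δ := Metric.ball_subset_ball (by linarith)
      have hds : ∀ s, E s = (s - c) * dslope E c s := fun s => by
        rw [← smul_eq_mul, sub_smul_dslope, h0, sub_zero]
      have hdne : ∀ s ∈ Metric.ball c δ, dslope E c s ≠ 0 := fun s hs => by
        by_cases hsc : s = c
        · rw [hsc, dslope_same]; exact hder c h0
        · intro h
          exact (hball s hs).1 hsc (by rw [hds, h, mul_zero])
      set ψ : ℂ → ℂ := fun s => N s / dslope E c s with hψ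
      have hψd : DifferentiableOn ℂ ψ (Metric.ball c (δ / 2)) :=
        DifferentiableOn.div (fun s hs => (hN s (hball s (hsub hs)).2).differentiableWithinAt)
          ((Complex.differentiableOn_dslope hmem).2 hE.differentiableOn) fun s hs => hdne s (hsub hs)
      obtain ⟨hsum, hdiff⟩ := differentiableOn_tsum_div_sub (z := fun ρ : {ρ : ℂ // E ρ = 0} => (ρ : ℂ))
          (d := fun ρ => if ρ = ⟨c, h0⟩ then 0 else d ρ) (c := c) hδ (by
        refine hd.of_nonneg_of_le (fun ρ => norm_nonneg _) fun ρ => ?_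
        split_ifs
        · rw [norm_zero]; exact norm_nonneg _
        · exact le_rfl) fun ρ => by
        by_cases hρ : ρ = ⟨c, h0⟩
        · exact Or.inl (if_pos hρ)
        · right
          by_contra! hlt
          exact (hball ρ (mem_ball_iff_norm.2 hlt)).1 (fun h => hρ (Subtype.ext h)) ρ.2
      refine ⟨_, δ / 2, by positivity, DifferentiableOn.sub
          ((Complex.differentiableOn_dslope hmem).2 hψd) hdiff, fun s hs hsc => ?_⟩
      have h1 := (hsum s hs).hasSum.add (hasSum_ite_eq (⟨c, h0⟩ : {ρ : ℂ // E ρ = 0}) (d ⟨c, h0⟩ / (s - c)))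
      have h2 : (fun ρ : {ρ : ℂ // E ρ = 0} => d ρ / (s - ρ)) = fun ρ : {ρ : ℂ // E ρ = 0} =>
          (if ρ = ⟨c, h0⟩ then 0 else d ρ) / (s - ρ) +
            if ρ = ⟨c, h0⟩ then d ⟨c, h0⟩ / (s - c) else 0 := by
        funext ρ
        split_ifs with h
        · rw [h, zero_div, zero_add]
        · rw [add_zero]
      have h3 : s - c ≠ 0 := sub_ne_zero.2 hsc
      have h4 := hdne s (hsub hs)
      simp only [hH, h2, h1.tsum_eq, Pi.sub_apply, dslope_of_ne _ hsc, slope_def_field]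
      have h5 : ψ c = d ⟨c, h0⟩ := by simp only [hψ, hddef, dslope_same]
      have h6 : N s / E s = ψ s / (s - c) := by
        rw [hds, hψ]
        field_simp
      rw [h5, h6]
      ring
    · obtain ⟨δ, hδ, h⟩ := hregular c hc h0
      exact ⟨H, δ, hδ, h, fun _ _ _ => rfl⟩
  obtain ⟨J, hJd, hJH⟩ := exists_eq_limit_of_removable hlocal
  have hJ : ∀ s : ℂ, 1 / 4 ≤ s.re → s.re ≠ 1 / 2 → J s = H s := fun s h1 h3 => by
    have h4 : 0 < s.re := by linarith
    obtain ⟨δ, hδ, h⟩ := hregular s h4 fun h => h3 (hre s h)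
    exact hJH s h4 (h.differentiableAt (Metric.ball_mem_nhds s hδ)).continuousAt
  set S := ∑' ρ : {ρ : ℂ // E ρ = 0}, ‖d ρ‖ with hS
  have hS0 : 0 ≤ S := tsum_nonneg fun _ => norm_nonneg _
  have hd' : ∀ s : ℂ, 1 / 4 ≤ s.re → s.re ≤ 3 / 4 → DifferentiableAt ℂ J s := fun s h1 _ =>
    hJd s (by change 0 < s.re; linarith)
  refine ⟨J, 8 * (B + S), fun s h1 h2 => ⟨hd' s h1 h2, ?_⟩, fun s h1 h2 h3 => ?_⟩
  · refine norm_le_of_le_div_abs_re (by positivity) hd' (fun z h1 h2 h3 => ?_) h1 h2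
    rw [hJ z h1 h3, add_div]
    exact (norm_sub_le _ _).trans (add_le_add (hb z h1 h2 h3)
      (norm_tsum_div_sub_le hd (fun ρ => hre _ ρ.2) h3).2)
  · rw [hJ s h1 h3]
    ring

end SubtractPoles

section GaussIntegrals

lemma integrable_mul_gaussW {ε : ℝ} (hε : 0 < ε) (y : ℝ) {f : ℂ → ℂ} {c C : ℝ} (hC : 0 ≤ C)
    (hf : Continuous fun t : ℝ => f (c + t * I))
    (hb : ∀ t : ℝ, ‖f (c + t * I)‖ ≤ C * Real.exp (C * |t|)) :
    Integrable fun t : ℝ => f (c + t * I) * gaussW ε y (c + t * I) := by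
  obtain ⟨D, hD, hDb⟩ := exists_norm_gaussW_le hε y c c C
  refine integrable_of_le_gauss (D := C * D) (half_pos hε)
    (hf.mul ((continuous_gaussW ε y).comp (by fun_prop))) fun t => ?_
  have := hDb (c + t * I) (by simp) (by simp)
  simp only [add_im, mul_im, ofReal_re, I_im, mul_one, ofReal_im, I_re, mul_zero, add_zero, zero_add] at this
  rw [norm_mul]
  calc _ ≤ C * Real.exp (C * |t|) * ‖gaussW ε y (c + t * I)‖ := by gcongr; exact hb t
    _ = C * (‖gaussW ε y (c + t * I)‖ * Real.exp (C * |t|)) := by ring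
    _ ≤ C * (D * Real.exp (-(ε / 2) * t ^ 2)) := by gcongr
    _ = _ := by ring

lemma tendsto_mul_gaussW {ε : ℝ} (hε : 0 < ε) (y : ℝ) {f : ℂ → ℂ} {a b C : ℝ} (hC : 0 ≤ C)
    (hb : ∀ᶠ z in stripEnd a b, ‖f z‖ ≤ C * Real.exp (C * |z.im|)) :
    Tendsto (fun z => f z * gaussW ε y z) (stripEnd a b) (𝓝 0) := by
  obtain ⟨D, hD, hDb⟩ := exists_norm_gaussW_le hε y a b C
  refine tendsto_stripEnd_of_le (D := C * D) (half_pos hε) ?_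
  filter_upwards [hb, mem_stripEnd] with z hz hz'
  rw [norm_mul]
  calc _ ≤ C * Real.exp (C * |z.im|) * ‖gaussW ε y z‖ := by gcongr
    _ = C * (‖gaussW ε y z‖ * Real.exp (C * |z.im|)) := by ring
    _ ≤ C * (D * Real.exp (-(ε / 2) * z.im ^ 2)) := mul_le_mul_of_nonneg_left (hDb z hz'.1 hz'.2) hC
    _ = _ := by ring

lemma integral_line_eq {ε : ℝ} (hε : 0 < ε) (y : ℝ) {f : ℂ → ℂ} {a b C : ℝ} (hab : a < b)
    (hC : 0 ≤ C) (hf : ∀ z : ℂ, a ≤ z.re → z.re ≤ b → DifferentiableAt ℂ f z)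
    (hb : ∀ z : ℂ, a ≤ z.re → z.re ≤ b → ‖f z‖ ≤ C * Real.exp (C * |z.im|)) :
    ∫ t : ℝ, f (b + t * I) * gaussW ε y (b + t * I) = ∫ t : ℝ, f (a + t * I) * gaussW ε y (a + t * I) := by
  have hd : DifferentiableOn ℂ (fun z => f z * gaussW ε y z) (re ⁻¹' Set.Icc a b) := fun z hz =>
    ((hf z hz.1 hz.2).mul (differentiable_gaussW ε y z)).differentiableWithinAt
  have hint : ∀ c : ℝ, a ≤ c → c ≤ b →
      Integrable fun t : ℝ => f (c + t * I) * gaussW ε y (c + t * I) := fun c h1 h2 => by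
    refine integrable_mul_gaussW hε y hC ?_ fun t => ?_
    · rw [continuous_iff_continuousAt]
      intro t
      exact ContinuousAt.comp (f := fun t : ℝ => (c : ℂ) + t * I)
        (hf (c + t * I) (by simpa) (by simpa)).continuousAt (by fun_prop)
    · simpa using hb (c + t * I) (by simpa) (by simpa)
  have hball : Metric.closedBall (((a + b) / 2 : ℝ) : ℂ) ((b - a) / 4) ⊆ re ⁻¹' Set.Icc a b := fun z hz => by
    rw [mem_closedBall_iff_norm] at hz
    have := abs_le.1 ((Complex.abs_re_le_norm _).trans hz)
    rw [sub_re, ofReal_re] at this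
    constructor <;> linarith
  have := integral_line_sub (f := fun z => f z * gaussW ε y z) (x := (a + b) / 2) (R := (b - a) / 4) (n := 0)
    (by linarith) (by linarith) (by linarith) hd (fun z _ _ _ => by simp)
    (tendsto_mul_gaussW hε y hC (by filter_upwards [mem_stripEnd] with z hz using hb z hz.1 hz.2))
    (hint a le_rfl hab.le) (hint b hab.le le_rfl)
  rw [(hd.diffContOnCl_ball hball).circleIntegral_eq_zero (by linarith), mul_zero] at this
  exact sub_eq_zero.1 this

end GaussIntegrals

section CriticalLine

variable {K : Type} [Field K] [NumberField K] {E : ℂ → ℂ} {q : ℝ}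

/-- The coefficient of `x ^ ρ` in the explicit formula. -/
def zeroCoeff (K : Type) [Field K] [NumberField K] (E : ℂ → ℂ) (q : ℝ) (ρ : ℂ) : ℂ :=
  (1 - ρ) * (q : ℂ) ^ ρ / gammaInv K ρ / deriv E ρ

lemma HeckeData.differentiableAt (h : HeckeData K E q) {s : ℂ} (hs : 0 < s.re) (hs' : s.re ≠ 1 / 2) :
    DifferentiableAt ℂ (mertensQuot K E q) s := by
  unfold mertensQuot
  have hq : (q : ℂ) ≠ 0 := ofReal_ne_zero.2 h.q_pos.ne'
  refine DifferentiableAt.div (by fun_prop (disch := exact Or.inl hq))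
    ((h.diff s).mul (differentiable_gammaInv s))
    (mul_ne_zero (fun h0 => hs' (h.re_of_zero s h0)) (gammaInv_ne_zero hs))

lemma HeckeData.exists_norm_zeroCoeff_le (h : HeckeData K E q) :
    ∃ C, 0 ≤ C ∧ ∀ ρ, E ρ = 0 → ‖zeroCoeff K E q ρ‖ ≤ C := by
  obtain ⟨C, hC, hb⟩ := h.bound
  refine ⟨C, hC, fun ρ hρ => ?_⟩
  have hre := h.re_of_zero ρ hρ
  have hq : (q : ℂ) ≠ 0 := ofReal_ne_zero.2 h.q_pos.ne'
  have hmap : Tendsto (fun x : ℝ => ρ + x) (𝓝[>] 0) (𝓝[≠] ρ) := by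
    refine tendsto_nhdsWithin_iff.2 ⟨?_, ?_⟩
    · have : Tendsto (fun x : ℝ => ρ + (x : ℂ)) (𝓝 0) (𝓝 (ρ + (0 : ℝ))) :=
        Continuous.tendsto (by fun_prop) 0
      rw [ofReal_zero, add_zero] at this
      exact this.mono_left nhdsWithin_le_nhds
    · filter_upwards [self_mem_nhdsWithin] with x hx
      simpa using (ne_of_gt hx : x ≠ 0)
  have hslope := (hasDerivAt_iff_tendsto_slope.1 (h.diff ρ).hasDerivAt).comp hmap
  have hnum : ContinuousAt (fun s : ℂ => (1 - s) * (q : ℂ) ^ s / gammaInv K s) ρ :=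
    (ContinuousAt.mul (by fun_prop) (continuousAt_const_cpow hq)).div
      (differentiable_gammaInv ρ).continuousAt (gammaInv_ne_zero (by rw [hre]; norm_num))
  have hlim := ((hnum.tendsto.mono_left nhdsWithin_le_nhds).comp hmap).div hslope (h.deriv_ne ρ hρ)
  refine le_of_tendsto hlim.norm ?_
  filter_upwards [Ioo_mem_nhdsGT (show (0 : ℝ) < 1 by norm_num)] with x hx
  have hb' := hb (ρ + x) (by simp [hre, hx.1]) (by simp [hre]; linarith [hx.2])
  have hx0 : (x : ℂ) ≠ 0 := ofReal_ne_zero.2 hx.1.ne'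
  simp only [add_re, hre, ofReal_re, add_sub_cancel_left] at hb'
  rw [le_div_iff₀ hx.1] at hb'
  refine le_of_eq_of_le ?_ hb'
  rw [show ‖mertensQuot K E q (ρ + x)‖ * x = ‖mertensQuot K E q (ρ + x) * x‖ by
    rw [norm_mul, Complex.norm_real, Real.norm_of_nonneg hx.1.le]]
  congr 1
  simp only [Function.comp, slope_def_field, hρ, mertensQuot, add_sub_cancel_left, sub_zero, Pi.div_apply]
  rw [div_div_eq_mul_div, mul_comm (E _), ← div_div]
  ring

lemma HeckeData.summable_zeroCoeff (h : HeckeData K E q) {ε : ℝ} (hε : 0 < ε) (y : ℝ) :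
    Summable fun ρ : {ρ : ℂ // E ρ = 0} => ‖zeroCoeff K E q ρ * gaussW ε y ρ‖ := by
  obtain ⟨C, hC, hc⟩ := h.exists_norm_zeroCoeff_le
  refine (h.summable_zeros.mul_left (C * (2 * Real.exp ε / ε ^ 2))).of_nonneg_of_le
    (fun _ => norm_nonneg _) fun ρ => ?_
  have hpow := Real.pow_div_factorial_le_exp (ε * (1 + ρ.1.im ^ 2)) (by positivity) 2
  rw [norm_mul, norm_gaussW, h.re_of_zero ρ ρ.2, mul_assoc]
  refine mul_le_mul (hc ρ ρ.2) ?_ (Real.exp_pos _).le hC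
  rw [mul_one_div, le_div_iff₀ (by positivity), le_div_iff₀ (by positivity)]
  rw [show ε * ((1 / 2 - 1 / 2) ^ 2 - ρ.1.im ^ 2) + y * (1 / 2 - 1 / 2) = ε - ε * (1 + ρ.1.im ^ 2) by ring,
    Real.exp_sub]
  rw [Nat.factorial_two, Nat.cast_ofNat, mul_pow, div_le_iff₀ two_pos] at hpow
  rw [div_mul_eq_mul_div, div_mul_eq_mul_div, div_le_iff₀ (Real.exp_pos _)]
  nlinarith [Real.exp_pos ε]

lemma HeckeData.exists_norm_le_strip (h : HeckeData K E q) :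
    ∃ C, 0 ≤ C ∧ ∀ s : ℂ, 1 / 4 ≤ s.re → s.re ≤ 3 / 4 → s.re ≠ 1 / 2 →
      ‖mertensQuot K E q s‖ ≤ C * Real.exp (C * |s.im|) / |s.re - 1 / 2| := by
  obtain ⟨C1, hC1, h1⟩ := h.exists_norm_le_right
  obtain ⟨C2, hC2, h2⟩ := h.exists_norm_le_left (1 / 4)
  refine ⟨2 * (C1 + C2), by positivity, fun s hs1 hs2 hs => ?_⟩
  have key : ∀ d : ℝ, 0 < d → d ≤ 1 / 4 → 1 + 1 / d ≤ 2 / d := fun d hd hd' => by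
    rw [le_div_iff₀ hd, add_mul, one_div_mul_cancel hd.ne']
    linarith
  rcases lt_or_gt_of_ne hs with hlt | hgt
  · have hd : 0 < 1 / 2 - s.re := by linarith
    rw [abs_sub_comm, abs_of_pos hd]
    refine (h2 s hs1 hlt (Or.inl hs1)).trans ?_
    calc _ ≤ (C1 + C2) * Real.exp (2 * (C1 + C2) * |s.im|) * (2 / (1 / 2 - s.re)) := by
          gcongr
          · linarith
          · linarith
          · exact key _ hd (by linarith)
      _ = _ := by ring
  · have hd : 0 < s.re - 1 / 2 := by linarith
    rw [abs_of_pos hd]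
    refine (h1 s hgt).trans ?_
    have h1e : 1 ≤ Real.exp (2 * (C1 + C2) * |s.im|) := Real.one_le_exp (by positivity)
    calc _ ≤ (C1 + C2) * (2 / (s.re - 1 / 2)) := by
          gcongr
          · linarith
          · exact key _ hd (by linarith)
      _ ≤ (C1 + C2) * (2 / (s.re - 1 / 2)) * Real.exp (2 * (C1 + C2) * |s.im|) :=
          le_mul_of_one_le_right (by positivity) h1e
      _ = _ := by ring

lemma HeckeData.integrable_line (h : HeckeData K E q) {ε : ℝ} (hε : 0 < ε) (y : ℝ) {c : ℝ}
    (hc1 : 1 / 4 ≤ c) (hc2 : c ≤ 3 / 4) (hc : c ≠ 1 / 2) :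
    Integrable fun t : ℝ => mertensQuot K E q (c + t * I) * gaussW ε y (c + t * I) := by
  obtain ⟨C, hC, hb⟩ := h.exists_norm_le_strip
  have hpos : 0 < |c - 1 / 2| := abs_pos.2 (sub_ne_zero.2 hc)
  have hre : ∀ t : ℝ, ((c : ℂ) + t * I).re = c := fun t => by simp
  have hle : |c - 1 / 2| ≤ 1 := abs_le.2 ⟨by linarith, by linarith⟩
  refine integrable_mul_gaussW hε y (C := C / |c - 1 / 2|) (by positivity) ?_ fun t => ?_
  · rw [continuous_iff_continuousAt]
    intro t
    exact ContinuousAt.comp (f := fun t : ℝ => (c : ℂ) + t * I)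
      (h.differentiableAt (s := c + t * I) (by rw [hre]; linarith) (by rwa [hre])).continuousAt (by fun_prop)
  · have := hb (c + t * I) (by rwa [hre]) (by rwa [hre]) (by rwa [hre])
    simp only [add_re, add_im, mul_re, mul_im, ofReal_re, I_im, mul_one, ofReal_im, I_re, mul_zero, add_zero,
      zero_add, sub_self] at this
    refine this.trans ?_
    rw [div_mul_eq_mul_div]
    gcongr
    exact le_div_self hC hpos hle

/-- Moving the line of integration across the critical line picks up all the zeros. -/
lemma HeckeData.integral_sub_integral (h : HeckeData K E q) {ε : ℝ} (hε : 0 < ε) (y : ℝ) :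
    (∫ t : ℝ, mertensQuot K E q ((3 / 4 : ℝ) + t * I) * gaussW ε y ((3 / 4 : ℝ) + t * I)) -
      ∫ t : ℝ, mertensQuot K E q ((1 / 4 : ℝ) + t * I) * gaussW ε y ((1 / 4 : ℝ) + t * I) =
    2 * Real.pi * ∑' ρ : {ρ : ℂ // E ρ = 0}, zeroCoeff K E q ρ * gaussW ε y ρ := by
  have hε2 := half_pos hε
  have hq : (q : ℂ) ≠ 0 := ofReal_ne_zero.2 h.q_pos.ne'
  have : Countable {ρ : ℂ // E ρ = 0} := by
    have := h.summable_zeros.countable_support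
    rw [Function.support_eq_univ fun ρ => by positivity] at this
    exact Set.countable_univ_iff.1 this
  set N : ℂ → ℂ := fun s => (1 - s) * (q : ℂ) ^ s / gammaInv K s * gaussW (ε / 2) 0 s with hN
  have hNE : ∀ s, N s / E s = mertensQuot K E q s * gaussW (ε / 2) 0 s := fun s => by
    rw [hN, mertensQuot, mul_comm (E s), ← div_div]
    ring
  have hres : ∀ ρ, N ρ / deriv E ρ = zeroCoeff K E q ρ * gaussW (ε / 2) 0 ρ := fun ρ => by
    rw [hN, zeroCoeff]
    ring
  have hsplit : ∀ s, gaussW (ε / 2) 0 s * gaussW (ε / 2) y s = gaussW ε y s := fun s => by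
    rw [gaussW_mul, add_halves, zero_add]
  obtain ⟨C, hC, hFb⟩ := h.exists_norm_le_strip
  obtain ⟨D, hD, hgb⟩ := exists_norm_gaussW_le hε2 0 (1 / 4) (3 / 4) C
  have hd : Summable fun ρ : {ρ : ℂ // E ρ = 0} => ‖N ρ / deriv E ρ‖ := by
    simp only [hres]
    exact h.summable_zeroCoeff hε2 0
  obtain ⟨J, B, hJ, hdec⟩ := exists_bounded_sub_poles (N := N) h.diff (fun s hs => by
      refine DifferentiableAt.mul (DifferentiableAt.div (by fun_prop (disch := exact Or.inl hq))
        (differentiable_gammaInv s) (gammaInv_ne_zero hs)) (differentiable_gaussW _ _ s))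
    h.re_of_zero h.deriv_ne hd (B := C * D) (by positivity) fun s h1 h2 h3 => by
      have hpos : 0 < |s.re - 1 / 2| := abs_pos.2 (sub_ne_zero.2 h3)
      have hgb' := hgb s h1 h2
      have : Real.exp (-(ε / 2 / 2) * s.im ^ 2) ≤ 1 := Real.exp_le_one_iff.2 (by nlinarith [sq_nonneg s.im])
      rw [hNE, norm_mul]
      calc _ ≤ C * Real.exp (C * |s.im|) / |s.re - 1 / 2| * ‖gaussW (ε / 2) 0 s‖ := by
            gcongr; exact hFb s h1 h2 h3
        _ = C * (‖gaussW (ε / 2) 0 s‖ * Real.exp (C * |s.im|)) / |s.re - 1 / 2| := by ring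
        _ ≤ C * (D * 1) / |s.re - 1 / 2| := by
            gcongr ?_ / _
            exact mul_le_mul_of_nonneg_left (hgb'.trans (mul_le_mul_of_nonneg_left this hD)) hC
        _ = _ := by rw [mul_one]
  have hB : 0 ≤ B := (norm_nonneg _).trans (hJ (1 / 4 : ℝ) (by simp) (by simp; norm_num)).2
  have hJint : ∀ c : ℝ, 1 / 4 ≤ c → c ≤ 3 / 4 →
      Integrable fun t : ℝ => J (c + t * I) * gaussW (ε / 2) y (c + t * I) := fun c h1 h2 => by
    have hre : ∀ t : ℝ, ((c : ℂ) + t * I).re = c := fun t => by simp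
    refine integrable_mul_gaussW hε2 y hB ?_ fun t => ?_
    · rw [continuous_iff_continuousAt]
      intro t
      exact ContinuousAt.comp (f := fun t : ℝ => (c : ℂ) + t * I)
        (hJ (c + t * I) (by rwa [hre]) (by rwa [hre])).1.continuousAt (by fun_prop)
    · exact (hJ (c + t * I) (by rwa [hre]) (by rwa [hre])).2.trans
        (le_mul_of_one_le_right hB (Real.one_le_exp (by positivity)))
  have hJeq := integral_line_eq hε2 y (f := J) (a := (1 / 4 : ℝ)) (b := (3 / 4 : ℝ)) (by norm_num) hB
    (fun z h1 h2 => (hJ z h1 h2).1) fun z h1 h2 => (hJ z h1 h2).2.trans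
        (le_mul_of_one_le_right hB (Real.one_le_exp (by positivity)))
  set d : {ρ : ℂ // E ρ = 0} → ℂ := fun ρ => N ρ / deriv E ρ with hddef
  have hline : ∀ c : ℝ, 1 / 4 ≤ c → c ≤ 3 / 4 → |c - 1 / 2| = 1 / 4 →
      HasSum (fun ρ => d ρ * ∫ t : ℝ, gaussW (ε / 2) y (c + t * I) / (c + t * I - ρ))
        ((∫ t : ℝ, mertensQuot K E q (c + t * I) * gaussW ε y (c + t * I)) -
          ∫ t : ℝ, J (c + t * I) * gaussW (ε / 2) y (c + t * I)) := fun c h1 h2 hc => by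
    have hre : ∀ t : ℝ, ((c : ℂ) + t * I).re = c := fun t => by simp
    have hc0 : c ≠ 1 / 2 := fun h0 => by rw [h0] at hc; norm_num at hc
    have hlow : ∀ (ρ : {ρ : ℂ // E ρ = 0}) (t : ℝ), 1 / 4 ≤ ‖(c : ℂ) + t * I - ρ‖ := fun ρ t => by
      have := abs_re_sub_le (s := (c : ℂ) + t * I) (h.re_of_zero ρ ρ.2)
      rwa [hre, hc] at this
    have hgint : Integrable fun t : ℝ => gaussW (ε / 2) y (c + t * I) := by
      simpa using integrable_mul_gaussW hε2 y (f := fun _ => 1) (c := c) (C := 1) zero_le_one (by fun_prop)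
        fun t => by simp
    have hle : ∀ (ρ : {ρ : ℂ // E ρ = 0}) (t : ℝ),
        ‖d ρ * (gaussW (ε / 2) y (c + t * I) / (c + t * I - ρ))‖ ≤
          ‖d ρ‖ * 4 * ‖gaussW (ε / 2) y (c + t * I)‖ := fun ρ t => by
      rw [norm_mul, mul_assoc]
      refine mul_le_mul_of_nonneg_left ?_ (norm_nonneg _)
      rw [norm_div, div_le_iff₀ (by linarith [hlow ρ t])]
      nlinarith [hlow ρ t, norm_nonneg (gaussW (ε / 2) y (c + t * I))]
    have hint : ∀ ρ : {ρ : ℂ // E ρ = 0},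
        Integrable fun t : ℝ => d ρ * (gaussW (ε / 2) y (c + t * I) / (c + t * I - ρ)) := fun ρ => by
      refine (hgint.norm.const_mul (‖d ρ‖ * 4)).mono' (Continuous.aestronglyMeasurable ?_)
        (.of_forall (hle ρ))
      refine continuous_const.mul (((continuous_gaussW _ _).comp (by fun_prop)).div (by fun_prop) fun t h0 => ?_)
      have := hlow ρ t
      rw [h0, norm_zero] at this
      linarith
    have hsum := hasSum_integral_of_summable_integral_norm hint
      (((hd.mul_right 4).mul_right (∫ t : ℝ, ‖gaussW (ε / 2) y (c + t * I)‖)).of_nonneg_of_le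
        (fun ρ => integral_nonneg fun t => norm_nonneg _) fun ρ => by
          rw [← integral_const_mul]
          exact integral_mono (hint ρ).norm (hgint.norm.const_mul _) (hle ρ))
    simp only [integral_const_mul] at hsum
    refine (congrArg (HasSum _) ?_).mpr hsum
    rw [← integral_sub (h.integrable_line hε y h1 h2 hc0) (hJint c h1 h2)]
    refine integral_congr_ae (.of_forall fun t => ?_)
    have h3 := hdec (c + t * I) (by rwa [hre]) (by rwa [hre]) (by rwa [hre])
    rw [hNE] at h3
    dsimp only
    rw [← hsplit, ← mul_assoc, h3, add_mul, add_sub_cancel_left, ← tsum_mul_right]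
    exact tsum_congr fun ρ => by rw [hddef]; ring
  have hdiff := (hline (3 / 4) (by norm_num) (by norm_num) (by norm_num [abs_of_pos])).sub
    (hline (1 / 4) (by norm_num) (by norm_num) (by norm_num [abs_of_neg]))
  rw [hJeq] at hdiff
  rw [sub_sub_sub_cancel_right] at hdiff
  rw [← hdiff.tsum_eq, ← tsum_mul_left]
  refine tsum_congr fun ρ => ?_
  rw [← mul_sub, integral_gaussW_div hε2 y (h.re_of_zero ρ ρ.2), hddef]
  dsimp only
  rw [hres, ← hsplit]
  ring

end CriticalLine

section GaussAverage

lemma integral_gaussW_line {ε : ℝ} (hε : 0 < ε) (w : ℝ) :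
    ∫ t : ℝ, gaussW ε w ((2 : ℝ) + t * I) = (√(Real.pi / ε) * Real.exp (-w ^ 2 / (4 * ε)) : ℝ) := by
  have hε' : (ε : ℂ) ≠ 0 := ofReal_ne_zero.2 hε.ne'
  have := integral_cexp_quadratic (b := -(ε : ℂ)) (by simpa) (I * (3 * ε + w)) (ε * (9 / 4) + w * (3 / 2))
  have h1 : (fun t : ℝ => gaussW ε w ((2 : ℝ) + t * I)) = fun t : ℝ =>
      cexp (-(ε : ℂ) * t ^ 2 + I * (3 * ε + w) * t + (ε * (9 / 4) + w * (3 / 2))) := by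
    funext t
    rw [gaussW]
    congr 1
    push_cast
    linear_combination ε * t ^ 2 * I_sq
  rw [h1, this]
  push_cast
  congr 1
  · rw [neg_neg, Real.sqrt_eq_rpow, ofReal_cpow (by positivity)]
    push_cast
    rfl
  · congr 1
    field_simp
    linear_combination (2 * (3 * ε + w) ^ 2 : ℂ) * I_sq

variable (K : Type) [Field K] [NumberField K]

/-- The average of `mertensLog K` around `y` against a Gaussian of variance `2 ε`. -/
def mertensAvg (ε y : ℝ) : ℝ :=
  (√Real.pi)⁻¹ * ∫ v : ℝ, mertensLog K (y + 2 * √ε * v) * Real.exp (-v ^ 2)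

lemma exists_abs_mertensLog_le : ∃ B, 0 ≤ B ∧ ∀ u, |mertensLog K u| ≤ B * Real.exp u := by
  obtain ⟨B, hB, hb⟩ := abs_mertensK_le K (show (1 : ℝ) < 3 / 2 by norm_num)
  refine ⟨B, hB, fun u => ?_⟩
  rw [mertensLog, abs_mul, abs_of_pos (Real.exp_pos _)]
  calc _ ≤ Real.exp (-u / 2) * (B * Real.exp u ^ (3 / 2 : ℝ)) := by gcongr; exact hb _ (Real.exp_pos u)
    _ = B * (Real.exp (-u / 2) * Real.exp (u * (3 / 2))) := by rw [← Real.exp_mul]; ring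
    _ = _ := by rw [← Real.exp_add]; ring_nf

variable {K}

lemma mertensLog_eq_zero {u : ℝ} (hu : u < 0) : mertensLog K u = 0 := by
  rw [mertensLog, mertensK_eq_zero (Real.exp_lt_one_iff.2 hu), mul_zero]

lemma integral_mertensLog_gauss {ε : ℝ} (hε : 0 < ε) (y : ℝ) :
    ∫ u : ℝ, mertensLog K u * (√(Real.pi / ε) * Real.exp (-(y - u) ^ 2 / (4 * ε))) =
      2 * Real.pi * mertensAvg K ε y := by
  have hs : 0 < 2 * √ε := by positivity
  have h1 := integral_add_left_eq_self (μ := volume)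
    (fun u => mertensLog K u * (√(Real.pi / ε) * Real.exp (-(y - u) ^ 2 / (4 * ε)))) y
  have h2 := Measure.integral_comp_mul_left
    (fun u => mertensLog K (y + u) * (√(Real.pi / ε) * Real.exp (-(y - (y + u)) ^ 2 / (4 * ε)))) (2 * √ε)
  rw [← h1, mertensAvg]
  rw [abs_of_pos (inv_pos.2 hs), smul_eq_mul, eq_comm, inv_mul_eq_iff_eq_mul₀ hs.ne'] at h2
  rw [h2]
  have h3 : ∀ v : ℝ, -(y - (y + 2 * √ε * v)) ^ 2 / (4 * ε) = -v ^ 2 := fun v => by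
    rw [show (y - (y + 2 * √ε * v)) ^ 2 = 4 * √ε ^ 2 * v ^ 2 by ring, Real.sq_sqrt hε.le]
    field_simp
  simp only [h3]
  rw [← integral_const_mul, ← integral_const_mul, ← integral_const_mul]
  refine integral_congr_ae (.of_forall fun v => ?_)
  dsimp only
  rw [Real.sqrt_div Real.pi_pos.le]
  field_simp
  rw [Real.sq_sqrt Real.pi_pos.le]

variable {E : ℂ → ℂ} {q : ℝ}

lemma HeckeData.integral_eq_mertensAvg (h : HeckeData K E q) {ε : ℝ} (hε : 0 < ε) (y : ℝ) :
    ∫ t : ℝ, mertensQuot K E q ((3 / 4 : ℝ) + t * I) * gaussW ε y ((3 / 4 : ℝ) + t * I) =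
      2 * Real.pi * mertensAvg K ε y := by
  obtain ⟨C, hC, hb⟩ := h.exists_norm_le_right
  have hshift := integral_line_eq hε y (f := mertensQuot K E q) (a := (3 / 4 : ℝ)) (b := (2 : ℝ)) (C := C * 5)
    (by norm_num) (by positivity) (fun z h1 _ => h.differentiableAt (by linarith) (by linarith))
    fun z h1 _ => by
      refine (hb z (by linarith)).trans ?_
      rw [mul_assoc]
      refine mul_le_mul_of_nonneg_left ?_ hC
      have h2 : 1 / (z.re - 1 / 2) ≤ 4 := by
        rw [div_le_iff₀ (by linarith)]; linarith
      have h3 : 1 ≤ Real.exp (C * 5 * |z.im|) := Real.one_le_exp (by positivity)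
      linarith
  rw [← hshift]
  have hre : ∀ t : ℝ, (((2 : ℝ) : ℂ) + t * I).re = 2 := fun t => by simp
  have hlap : ∀ t : ℝ, mertensQuot K E q ((2 : ℝ) + t * I) * gaussW ε y ((2 : ℝ) + t * I) =
      ∫ u in Set.Ioi (0 : ℝ), (mertensK K (Real.exp u) : ℂ) * cexp (-((2 : ℝ) + t * I) * u) *
        gaussW ε y ((2 : ℝ) + t * I) := fun t => by
    rw [integral_mul_const, (laplace_mertensK (by rw [hre]; norm_num)).2, h.series _ (by rw [hre]; norm_num)]
  simp only [hlap]
  have hgint : Integrable fun t : ℝ => gaussW ε y ((2 : ℝ) + t * I) := by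
    simpa using integrable_mul_gaussW hε y (f := fun _ => 1) (c := 2) (C := 1) zero_le_one (by fun_prop)
      fun t => by simp
  have hMint := (laplace_mertensK (K := K) (s := 2) (by norm_num)).1
  have hprod : Integrable (Function.uncurry fun (t u : ℝ) => (mertensK K (Real.exp u) : ℂ) *
      cexp (-((2 : ℝ) + t * I) * u) * gaussW ε y ((2 : ℝ) + t * I))
      (volume.prod (volume.restrict (Set.Ioi 0))) := by
    have h1 := hgint.mul_prod hMint
    refine (h1.bdd_mul (c := 1) (f := fun p : ℝ × ℝ => cexp (-(p.1 * I) * p.2))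
      (Continuous.aestronglyMeasurable (by fun_prop)) (.of_forall fun p => ?_)).congr (.of_forall fun p => ?_)
    · rw [Complex.norm_exp]
      simp
    · simp only [Function.uncurry]
      push_cast
      rw [show -(2 + p.1 * I) * (p.2 : ℂ) = -(p.1 * I) * p.2 + -2 * p.2 by ring, Complex.exp_add]
      ring
  rw [integral_integral_swap hprod]
  rw [← ofReal_ofNat, ← ofReal_mul, ← ofReal_mul, ← integral_mertensLog_gauss hε y, ← integral_complex_ofReal]
  have hIoi : ∫ u in Set.Ici (0 : ℝ),
      ((mertensLog K u * (√(Real.pi / ε) * Real.exp (-(y - u) ^ 2 / (4 * ε))) : ℝ) : ℂ) =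
      ∫ u : ℝ, ((mertensLog K u * (√(Real.pi / ε) * Real.exp (-(y - u) ^ 2 / (4 * ε))) : ℝ) : ℂ) :=
    setIntegral_eq_integral_of_forall_compl_eq_zero fun u hu => by
      rw [mertensLog_eq_zero (not_le.1 hu), zero_mul, ofReal_zero]
  rw [← hIoi, integral_Ici_eq_integral_Ioi]
  refine integral_congr_ae (.of_forall fun u => ?_)
  dsimp only
  rw [ofReal_mul, ← integral_gaussW_line hε (y - u), ← integral_const_mul]
  refine integral_congr_ae (.of_forall fun t => ?_)
  dsimp only
  rw [mertensLog, gaussW, gaussW]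
  push_cast
  have : cexp (-(2 + t * I) * u) * cexp (ε * (2 + t * I - 1 / 2) ^ 2 + y * (2 + t * I - 1 / 2)) =
      cexp (-u / 2) * cexp (ε * (2 + t * I - 1 / 2) ^ 2 + (y - u) * (2 + t * I - 1 / 2)) := by
    rw [← Complex.exp_add, ← Complex.exp_add]
    congr 1
    ring
  linear_combination (mertensK K (Real.exp u) : ℂ) * this

end GaussAverage

section AverageLimits

variable {K : Type} [Field K] [NumberField K]

lemma integral_exp_mul_gauss (c : ℝ) : Integrable (fun v : ℝ => Real.exp (c * v) * Real.exp (-v ^ 2)) ∧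
    ∫ v : ℝ, Real.exp (c * v) * Real.exp (-v ^ 2) = √Real.pi * Real.exp (c ^ 2 / 4) := by
  have h1 : (fun v : ℝ => Real.exp (c * v) * Real.exp (-v ^ 2)) = fun v : ℝ =>
      Real.exp (-1 * (v - c / 2) ^ 2) * Real.exp (c ^ 2 / 4) := by
    funext v
    rw [← Real.exp_add, ← Real.exp_add]
    ring_nf
  rw [h1]
  refine ⟨((integrable_exp_neg_mul_sq one_pos).comp_sub_right (c / 2)).mul_const _, ?_⟩
  rw [integral_mul_const, integral_sub_right_eq_self (fun v => Real.exp (-1 * v ^ 2)) (c / 2),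
    integral_gaussian, div_one]

lemma integrable_mertensLog_gauss (a y : ℝ) :
    Integrable fun v : ℝ => mertensLog K (y + a * v) * Real.exp (-v ^ 2) := by
  obtain ⟨B, hB, hb⟩ := exists_abs_mertensLog_le K
  refine ((integral_exp_mul_gauss a).1.const_mul (B * Real.exp y)).mono' ?_ (.of_forall fun v => ?_)
  · exact ((measurable_mertensLog.comp (by fun_prop)).mul (by fun_prop)).aestronglyMeasurable
  · rw [norm_mul, Real.norm_eq_abs, Real.norm_of_nonneg (Real.exp_pos _).le]
    calc _ ≤ B * Real.exp (y + a * v) * Real.exp (-v ^ 2) := by gcongr; exact hb _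
      _ = _ := by rw [Real.exp_add]; ring

lemma mul_mertensAvg_le {σ L B : ℝ} (hp : ∀ u, σ * mertensLog K u ≤ L + B * Real.exp (-u)) {ε : ℝ}
    (hε : 0 < ε) (y : ℝ) : σ * mertensAvg K ε y ≤ L + B * Real.exp (-y + ε) := by
  have h0 := integral_exp_mul_gauss 0
  have h1 := integral_exp_mul_gauss (-(2 * √ε))
  simp only [zero_mul, Real.exp_zero, one_mul, ne_eq, OfNat.ofNat_ne_zero, not_false_eq_true, zero_pow,
    zero_div, mul_one] at h0
  have hsq : (-(2 * √ε)) ^ 2 / 4 = ε := by rw [neg_sq, mul_pow, Real.sq_sqrt hε.le]; ring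
  rw [hsq] at h1
  have hint : Integrable fun v : ℝ => L * Real.exp (-v ^ 2) +
      B * Real.exp (-y) * (Real.exp (-(2 * √ε) * v) * Real.exp (-v ^ 2)) :=
    (h0.1.const_mul _).add (h1.1.const_mul _)
  have hle : σ * ∫ v : ℝ, mertensLog K (y + 2 * √ε * v) * Real.exp (-v ^ 2) ≤
      ∫ v : ℝ, (L * Real.exp (-v ^ 2) +
        B * Real.exp (-y) * (Real.exp (-(2 * √ε) * v) * Real.exp (-v ^ 2))) := by
    rw [← integral_const_mul]
    refine integral_mono ((integrable_mertensLog_gauss _ _).const_mul σ) hint fun v => ?_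
    dsimp only
    rw [← mul_assoc]
    calc _ ≤ (L + B * Real.exp (-(y + 2 * √ε * v))) * Real.exp (-v ^ 2) := by gcongr; exact hp _
      _ = _ := by
        rw [show -(y + 2 * √ε * v) = -y + -(2 * √ε) * v by ring, Real.exp_add]
        ring
  rw [integral_add (h0.1.const_mul _) (h1.1.const_mul _), integral_const_mul, integral_const_mul, h0.2,
    h1.2] at hle
  have hpi : 0 < √Real.pi := by positivity
  rw [mertensAvg, mul_left_comm, inv_mul_le_iff₀ hpi, Real.exp_add]
  linarith

lemma tendsto_mertensLog_symm (y : ℝ) :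
    Tendsto (fun h : ℝ => mertensLog K (y + h) + mertensLog K (y - h)) (𝓝 0) (𝓝 (2 * mertensLog K y)) := by
  obtain ⟨B, hB, hb⟩ := abs_mertensK_le K (show (1 : ℝ) < 2 by norm_num)
  have hbd : ∀ s : ℝ, |s| ≤ 1 → |mertensK K (Real.exp (y + s))| ≤ B * Real.exp (y + 1) ^ (2 : ℝ) := fun s hs => by
    refine (hb _ (Real.exp_pos _)).trans ?_
    gcongr
    linarith [(abs_le.1 hs).2]
  have hsmall : ∀ᶠ h : ℝ in 𝓝 0, |h| ≤ 1 := by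
    filter_upwards [Metric.closedBall_mem_nhds (0 : ℝ) one_pos] with h hh
    simpa using hh
  have hz : ∀ c : ℝ, Tendsto (fun h : ℝ => (Real.exp (c * h) - 1)) (𝓝 0) (𝓝 0) := fun c => by
    have : Continuous fun h : ℝ => (Real.exp (c * h) - 1) := by fun_prop
    simpa using this.tendsto 0
  have h1 := bdd_le_mul_tendsto_zero' (f := fun h => mertensK K (Real.exp (y + h))) _
    (hsmall.mono fun h hh => hbd h hh) (hz (-1 / 2))
  have h2 := bdd_le_mul_tendsto_zero' (f := fun h => mertensK K (Real.exp (y + -h))) _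
    (hsmall.mono fun h hh => hbd (-h) (by rwa [abs_neg])) (hz (1 / 2))
  have h3 := ((h1.add h2).const_mul (Real.exp (-y / 2))).add_const (2 * mertensLog K y)
  simp only [add_zero, mul_zero, zero_add] at h3
  refine h3.congr' ?_
  filter_upwards [mertensK_symm_limit (K := K) (y := y)] with h hh
  simp only [mertensLog, ← sub_eq_add_neg]
  rw [show -(y + h) / 2 = -y / 2 + -1 / 2 * h by ring, show -(y - h) / 2 = -y / 2 + 1 / 2 * h by ring,
    Real.exp_add (-y / 2) (-1 / 2 * h), Real.exp_add (-y / 2) (1 / 2 * h)]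
  linear_combination (-Real.exp (-y / 2)) * hh

lemma tendsto_mertensAvg (y : ℝ) :
    Tendsto (fun ε => mertensAvg K ε y) (𝓝[>] 0) (𝓝 (mertensLog K y)) := by
  obtain ⟨B, hB, hb⟩ := exists_abs_mertensLog_le K
  have hsymm : ∀ ε : ℝ, mertensAvg K ε y = (√Real.pi)⁻¹ * ∫ v : ℝ,
      (mertensLog K (y + 2 * √ε * v) + mertensLog K (y - 2 * √ε * v)) / 2 * Real.exp (-v ^ 2) := fun ε => by
    have h1 := integral_neg_eq_self (μ := volume)
      (fun v : ℝ => mertensLog K (y + 2 * √ε * v) * Real.exp (-v ^ 2))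
    have hi := integrable_mertensLog_gauss (K := K) (2 * √ε) y
    have h2 := integral_add hi hi.comp_neg
    rw [h1, ← two_mul] at h2
    rw [mertensAvg, eq_div_of_mul_eq two_ne_zero ((mul_comm _ _).trans h2.symm), ← integral_div]
    congr 1
    refine integral_congr_ae (.of_forall fun v => ?_)
    dsimp only
    rw [neg_sq, mul_neg, ← sub_eq_add_neg]
    ring
  have hlim : Tendsto (fun ε : ℝ => ∫ v : ℝ,
      (mertensLog K (y + 2 * √ε * v) + mertensLog K (y - 2 * √ε * v)) / 2 * Real.exp (-v ^ 2)) (𝓝[>] 0)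
      (𝓝 (∫ v : ℝ, 2 * mertensLog K y / 2 * Real.exp (-v ^ 2))) := by
    refine tendsto_integral_filter_of_dominated_convergence (fun v => B * Real.exp y *
      (Real.exp (2 * v) * Real.exp (-v ^ 2) + Real.exp (-2 * v) * Real.exp (-v ^ 2))) ?_ ?_ ?_ ?_
    · refine .of_forall fun ε => Measurable.aestronglyMeasurable ?_
      exact (((measurable_mertensLog.comp (by fun_prop)).add
        (measurable_mertensLog.comp (by fun_prop))).div_const 2).mul (by fun_prop)
    · filter_upwards [Ioo_mem_nhdsGT (zero_lt_one (α := ℝ))] with ε hε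
      refine .of_forall fun v => ?_
      have hs : √ε ≤ 1 := Real.sqrt_le_one.2 hε.2.le
      have hexp : ∀ w : ℝ, w ≤ 2 * |v| → |mertensLog K (y + w)| ≤
          B * Real.exp y * (Real.exp (2 * v) + Real.exp (-2 * v)) := fun w hw => by
        refine (hb _).trans ?_
        rw [Real.exp_add, ← mul_assoc]
        refine mul_le_mul_of_nonneg_left ?_ (by positivity)
        refine (Real.exp_le_exp.2 hw).trans ?_
        rcases abs_cases v with ⟨h, -⟩ | ⟨h, -⟩
        · rw [h]; linarith [Real.exp_pos (-2 * v)]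
        · rw [h, show 2 * -v = -2 * v by ring]; linarith [Real.exp_pos (2 * v)]
      have h1 := hexp (2 * √ε * v) (by
        nlinarith [le_abs_self v, abs_nonneg v, Real.sqrt_nonneg ε])
      have h2 := hexp (-(2 * √ε * v)) (by
        nlinarith [neg_le_abs v, abs_nonneg v, Real.sqrt_nonneg ε])
      rw [← sub_eq_add_neg] at h2
      rw [norm_mul, Real.norm_of_nonneg (Real.exp_pos _).le, ← add_mul, ← mul_assoc]
      refine mul_le_mul_of_nonneg_right ?_ (Real.exp_pos _).le
      rw [norm_div, Real.norm_eq_abs, Real.norm_two, div_le_iff₀ two_pos]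
      exact (abs_add_le _ _).trans (by linarith)
    · have h1 := (integral_exp_mul_gauss 2).1
      have h2 := (integral_exp_mul_gauss (-2)).1
      exact (h1.add h2).const_mul _
    · refine .of_forall fun v => Tendsto.mul_const _ (Tendsto.div_const ?_ 2)
      refine (tendsto_mertensLog_symm y).comp (f := fun ε : ℝ => 2 * √ε * v) ?_
      have : Continuous fun ε : ℝ => 2 * √ε * v := by fun_prop
      simpa using (this.tendsto 0).mono_left nhdsWithin_le_nhds
  simp only [hsymm]
  have h0 := integral_exp_mul_gauss 0
  simp only [zero_mul, Real.exp_zero, one_mul, ne_eq, OfNat.ofNat_ne_zero, not_false_eq_true, zero_pow,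
    zero_div, mul_one] at h0
  rw [integral_const_mul, h0.2, mul_div_cancel_left₀ _ (two_ne_zero' ℝ)] at hlim
  have := hlim.const_mul (√Real.pi)⁻¹
  rwa [mul_comm (mertensLog K y), inv_mul_cancel_left₀ (by positivity)] at this

end AverageLimits

section LeftShift

variable {K : Type} [Field K] [NumberField K] {E : ℂ → ℂ} {q : ℝ}

lemma gammaInv_ne_zero_of_ne {s : ℂ} (hs : ∀ n : ℕ, s ≠ -n) : gammaInv K s ≠ 0 := by
  have h1 : Gammaℂ s ≠ 0 := by
    rw [Gammaℂ_def]
    refine mul_ne_zero (mul_ne_zero two_ne_zero ?_) (Complex.Gamma_ne_zero hs)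
    rw [Ne, Complex.cpow_eq_zero_iff]
    exact fun h => (by simp [Real.pi_ne_zero] : (2 * Real.pi : ℂ) ≠ 0) h.1
  have h2 : Gammaℝ s ≠ 0 := by
    rw [← Gammaℝ_mul_Gammaℝ_add_one] at h1
    exact left_ne_zero_of_mul h1
  exact mul_ne_zero (pow_ne_zero _ (inv_ne_zero h2)) (pow_ne_zero _ (inv_ne_zero h1))

lemma ne_neg_nat_of_strip {k : ℕ} {z : ℂ} (h1 : -(k : ℝ) - 1 < z.re) (h2 : z.re < -k + 1) (hz : z ≠ -k) (n : ℕ) :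
    z ≠ -n := by
  rintro rfl
  simp only [neg_re, natCast_re] at h1 h2
  have h3 : n < k + 1 := by exact_mod_cast (by linarith : (n : ℝ) < k + 1)
  have h4 : k < n + 1 := by exact_mod_cast (by linarith : (k : ℝ) < n + 1)
  exact hz (by rw [show n = k by omega])

lemma HeckeData.exists_pole_factor (h : HeckeData K E q) {k : ℕ} {a b : ℝ} (ha : -(k : ℝ) - 1 < a)
    (hb : b < -k + 1) (hb' : b < 1 / 2) : ∃ (n : ℕ) (ψ : ℂ → ℂ), DifferentiableOn ℂ ψ (re ⁻¹' Set.Icc a b) ∧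
      ∀ z : ℂ, a ≤ z.re → z.re ≤ b → z ≠ -k → mertensQuot K E q z = ψ z * ((z + k) ^ n)⁻¹ := by
  have hq : (q : ℂ) ≠ 0 := ofReal_ne_zero.2 h.q_pos.ne'
  have hE : ∀ z : ℂ, z.re ≤ b → E z ≠ 0 := fun z hz h0 => by
    have := h.re_of_zero z h0
    linarith
  have hG : ∀ z : ℂ, a ≤ z.re → z.re ≤ b → z ≠ -k → gammaInv K z ≠ 0 := fun z h1 h2 h3 =>
    gammaInv_ne_zero_of_ne (ne_neg_nat_of_strip (by linarith) (by linarith) h3)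
  have hGn : ¬ ∀ᶠ z in 𝓝 (-k : ℂ), gammaInv K z = 0 := fun h0 => by
    have hU : re ⁻¹' Set.Ioo (-(k : ℝ) - 1) (-k + 1) ∈ 𝓝 (-k : ℂ) :=
      (isOpen_Ioo.preimage continuous_re).mem_nhds (by simp)
    have h1 : ∀ᶠ z in 𝓝[≠] (-k : ℂ), gammaInv K z = 0 ∧ z ∈ re ⁻¹' Set.Ioo (-(k : ℝ) - 1) (-k + 1) ∧ z ≠ -k :=
      (h0.filter_mono nhdsWithin_le_nhds).and
        (Filter.inter_mem (mem_nhdsWithin_of_mem_nhds hU) self_mem_nhdsWithin)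
    obtain ⟨z, hz1, hz2, hz3⟩ := h1.exists
    exact gammaInv_ne_zero_of_ne (ne_neg_nat_of_strip hz2.1 hz2.2 hz3) hz1
  obtain ⟨n, g, hg, hg0, hgz⟩ := ((differentiable_gammaInv (K := K)).analyticAt
    (-k : ℂ)).exists_eventuallyEq_pow_smul_nonzero_iff.2 hGn
  refine ⟨n, fun z => if z = -k then (1 - z) * (q : ℂ) ^ z / (E z * g z) else
    mertensQuot K E q z * (z + k) ^ n, fun z hz => DifferentiableAt.differentiableWithinAt ?_,
    fun z h1 h2 h3 => ?_⟩
  · by_cases h3 : z = -k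
    · have hd : DifferentiableAt ℂ (fun z => (1 - z) * (q : ℂ) ^ z / (E z * g z)) z :=
        DifferentiableAt.div (by fun_prop (disch := exact Or.inl hq))
          ((h.diff z).mul (h3 ▸ hg.differentiableAt)) (mul_ne_zero (hE z hz.2) (h3 ▸ hg0))
      refine hd.congr_of_eventuallyEq ?_
      rw [h3]
      filter_upwards [hgz] with w hw
      split_ifs with hwk
      · rfl
      · have hwk' : w + k ≠ 0 := fun h0 => hwk (eq_neg_of_add_eq_zero_left h0)
        rw [mertensQuot, hw, sub_neg_eq_add, smul_eq_mul]
        have := pow_ne_zero n hwk'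
        rw [mul_left_comm, div_mul_eq_mul_div, mul_comm ((w + k) ^ n), mul_div_mul_right _ _ this]
    · have hd : DifferentiableAt ℂ (fun z => mertensQuot K E q z * (z + k) ^ n) z := by
        refine DifferentiableAt.mul ?_ (by fun_prop)
        unfold mertensQuot
        exact DifferentiableAt.div (by fun_prop (disch := exact Or.inl hq))
          ((h.diff z).mul (differentiable_gammaInv z)) (mul_ne_zero (hE z hz.2) (hG z hz.1 hz.2 h3))
      refine hd.congr_of_eventuallyEq ?_
      filter_upwards [isOpen_ne.mem_nhds h3] with w hw
      exact if_neg hw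
  · have hzk : z + k ≠ 0 := fun h0 => h3 (eq_neg_of_add_eq_zero_left h0)
    dsimp only
    rw [if_neg h3, mul_inv_cancel_right₀ (pow_ne_zero n hzk)]

lemma HeckeData.differentiableAt_left (h : HeckeData K E q) {s : ℂ} (hs : s.re < 1 / 2) (hn : ∀ n : ℕ, s ≠ -n) :
    DifferentiableAt ℂ (mertensQuot K E q) s := by
  unfold mertensQuot
  have hq : (q : ℂ) ≠ 0 := ofReal_ne_zero.2 h.q_pos.ne'
  refine DifferentiableAt.div (by fun_prop (disch := exact Or.inl hq))
    ((h.diff s).mul (differentiable_gammaInv s)) (mul_ne_zero (fun h0 => ?_) (gammaInv_ne_zero_of_ne hn))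
  have := h.re_of_zero s h0
  linarith

lemma HeckeData.continuous_line_left (h : HeckeData K E q) {c : ℝ} (hc : c < 1 / 2) (hn : ∀ n : ℕ, c ≠ -n) :
    Continuous fun t : ℝ => mertensQuot K E q (c + t * I) := by
  refine continuous_iff_continuousAt.2 fun t => ContinuousAt.comp (f := fun t : ℝ => (c : ℂ) + t * I)
    (h.differentiableAt_left (by simpa using hc) fun n h0 => hn n ?_).continuousAt (by fun_prop)
  simpa using congrArg Complex.re h0

lemma HeckeData.integral_shift (h : HeckeData K E q) {ε : ℝ} (hε : 0 < ε) (y : ℝ) {k : ℕ} {a b R C : ℝ} (hR : 0 < R)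
    (ha : -(k : ℝ) - 1 < a) (haR : a < -k - R) (hbR : -k + R < b) (hb : b < -k + 1) (hb' : b < 1 / 2)
    (hC : 0 ≤ C) (hfa : ∀ t : ℝ, ‖mertensQuot K E q (a + t * I)‖ ≤ C * Real.exp (C * |t|))
    (hfb : ∀ t : ℝ, ‖mertensQuot K E q (b + t * I)‖ ≤ C * Real.exp (C * |t|)) :
    (∫ t : ℝ, mertensQuot K E q (b + t * I) * gaussW ε y (b + t * I)) -
      ∫ t : ℝ, mertensQuot K E q (a + t * I) * gaussW ε y (a + t * I) =
      -I * ∮ z in C(-k, R), mertensQuot K E q z * gaussW ε y z := by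
  obtain ⟨n, ψ, hψ, hF⟩ := h.exists_pole_factor ha hb hb'
  have hne : ∀ c : ℝ, -(k : ℝ) - 1 < c → c < -k + 1 → c ≠ -k → ∀ n : ℕ, c ≠ -n := fun c h1 h2 h3 n h0 => by
    refine ne_neg_nat_of_strip (k := k) (z := (c : ℂ)) (by rwa [ofReal_re]) (by rwa [ofReal_re]) (fun h4 => h3 ?_) n (by rw [h0]; simp)
    exact_mod_cast h4
  obtain ⟨C', hC', hl⟩ := h.exists_norm_le_left a
  have hlim : Tendsto (fun z => mertensQuot K E q z * gaussW ε y z) (stripEnd a b) (𝓝 0) := by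
    refine tendsto_mul_gaussW hε y (C := C' * (1 + 1 / (1 / 2 - b)) + C') ?_ ?_
    · have : 0 < 1 / 2 - b := by linarith
      positivity
    · filter_upwards [mem_stripEnd, tendsto_abs_im_stripEnd.eventually_ge_atTop 1] with z hz hz1
      have hp : 0 < 1 / 2 - b := by linarith
      have hzb : z.re ≤ b := hz.2
      refine (hl z hz.1 (by linarith) (Or.inr hz1)).trans ?_
      rw [mul_right_comm]
      have : 1 / (1 / 2 - z.re) ≤ 1 / (1 / 2 - b) := by gcongr
      have h0 : 0 ≤ C' * (1 + 1 / (1 / 2 - b)) := by positivity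
      gcongr
      · linarith [mul_le_mul_of_nonneg_left this hC']
      · linarith
  have := integral_line_sub (x := -(k : ℝ)) hR haR hbR (n := n)
    (hψ.mul (differentiable_gaussW ε y).differentiableOn) (f := fun z => mertensQuot K E q z * gaussW ε y z)
    (fun z h1 h2 h3 => by
      push_cast at h3 ⊢
      rw [hF z h1 h2 h3, sub_neg_eq_add]
      simp only [Pi.mul_apply]
      ring) hlim
    (integrable_mul_gaussW hε y hC (h.continuous_line_left (by linarith) (hne a ha (by linarith) (by linarith))) hfa)
    (integrable_mul_gaussW hε y hC (h.continuous_line_left hb' (hne b (by linarith) hb (by linarith))) hfb)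
  simpa using this

end LeftShift

section ResidueSum

variable {K : Type} [Field K] [NumberField K] {E : ℂ → ℂ} {q : ℝ}

lemma HeckeData.exists_norm_le_line_inv (h : HeckeData K E q) :
    ∃ C B, 0 ≤ C ∧ 0 ≤ B ∧ ∀ (k : ℕ) (t : ℝ),
      ‖mertensQuot K E q ((-k - 1 / 2 : ℝ) + t * I)‖ ≤ C * (B ^ k / k.factorial) * (1 + t ^ 2)⁻¹ := by
  obtain ⟨C, B, hC, hB, hb⟩ := h.exists_norm_le_line
  refine ⟨4 * C, B, by positivity, hB, fun k t => ?_⟩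
  have hre : (((-k - 1 / 2 : ℝ) : ℂ) + t * I).re = -k - 1 / 2 := by simp
  have him : (((-k - 1 / 2 : ℝ) : ℂ) + t * I).im = t := by simp
  refine (hb k _ hre).trans ?_
  have hs : (1 + t ^ 2) / 4 ≤ ‖((-k - 1 / 2 : ℝ) : ℂ) + t * I‖ ^ 2 := by
    rw [Complex.sq_norm, Complex.normSq_apply, hre, him]
    have : (0 : ℝ) ≤ k := k.cast_nonneg
    nlinarith
  calc C * B ^ k / k.factorial / ‖((-k - 1 / 2 : ℝ) : ℂ) + t * I‖ ^ 2
      ≤ C * B ^ k / k.factorial / ((1 + t ^ 2) / 4) := by gcongr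
    _ = _ := by field_simp

lemma neg_sub_half_ne_neg (k n : ℕ) : (-k - 1 / 2 : ℝ) ≠ -n := by
  intro h0
  have h1 : (k : ℝ) < n := by linarith
  have h2 : (n : ℝ) < k + 1 := by linarith
  have h3 : k < n := by exact_mod_cast h1
  have h4 : n < k + 1 := by exact_mod_cast h2
  omega

lemma HeckeData.tendsto_integral_line (h : HeckeData K E q) (y : ℝ) (k : ℕ) :
    Tendsto (fun ε : ℝ => ∫ t : ℝ, mertensQuot K E q ((-k - 1 / 2 : ℝ) + t * I) *
      gaussW ε y ((-k - 1 / 2 : ℝ) + t * I)) (𝓝[>] 0) (𝓝 (∫ t : ℝ,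
        mertensQuot K E q ((-k - 1 / 2 : ℝ) + t * I) * gaussW 0 y ((-k - 1 / 2 : ℝ) + t * I))) := by
  obtain ⟨C, B, hC, hB, hb⟩ := h.exists_norm_le_line_inv
  have hF : Continuous fun t : ℝ => mertensQuot K E q ((-k - 1 / 2 : ℝ) + t * I) :=
    h.continuous_line_left (by linarith [(k.cast_nonneg : (0 : ℝ) ≤ k)]) (neg_sub_half_ne_neg k)
  refine tendsto_integral_filter_of_dominated_convergence (fun t : ℝ => C * (B ^ k / k.factorial) *
    (1 + t ^ 2)⁻¹ * Real.exp ((-k - 1 / 2 - 1 / 2) ^ 2 + y * (-k - 1 / 2 - 1 / 2))) ?_ ?_ ?_ ?_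
  · exact .of_forall fun ε => (hF.mul ((continuous_gaussW ε y).comp (by fun_prop))).aestronglyMeasurable
  · filter_upwards [Ioo_mem_nhdsGT (zero_lt_one (α := ℝ))] with ε hε
    refine .of_forall fun t => ?_
    rw [norm_mul, norm_gaussW]
    refine mul_le_mul (hb k t) (Real.exp_le_exp.2 ?_) (Real.exp_pos _).le (by positivity)
    simp only [add_re, add_im, mul_re, mul_im, ofReal_re, I_im, mul_one, ofReal_im, I_re, mul_zero, add_zero,
      zero_add, sub_self]
    have h1 := hε.1
    have h2 := hε.2
    nlinarith [sq_nonneg t, sq_nonneg (-(k : ℝ) - 1 / 2 - 1 / 2), mul_nonneg h1.le (sq_nonneg t)]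
  · exact (integrable_inv_one_add_sq.const_mul _).mul_const _
  · refine .of_forall fun t => Tendsto.const_mul _ ?_
    have : Continuous fun ε : ℝ => gaussW ε y (((-k - 1 / 2 : ℝ) : ℂ) + t * I) := by
      unfold gaussW
      fun_prop
    exact (this.tendsto 0).mono_left nhdsWithin_le_nhds

lemma tendsto_circleIntegral_gaussW {f : ℂ → ℂ} {c : ℂ} {R : ℝ} (hR : 0 ≤ R)
    (hf : ContinuousOn f (Metric.sphere c R)) (y : ℝ) :
    Tendsto (fun ε : ℝ => ∮ z in C(c, R), f z * gaussW ε y z) (𝓝[>] 0)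
      (𝓝 (∮ z in C(c, R), f z * gaussW 0 y z)) := by
  have hfc : Continuous fun θ : ℝ => f (circleMap c R θ) :=
    hf.comp_continuous (continuous_circleMap c R) fun θ => circleMap_mem_sphere c hR θ
  have : Continuous fun ε : ℝ => ∮ z in C(c, R), f z * gaussW ε y z := by
    unfold circleIntegral
    refine intervalIntegral.continuous_parametric_intervalIntegral_of_continuous' ?_ _ _
    simp only [Function.uncurry_def, deriv_circleMap, gaussW]
    have h1 := hfc.comp (continuous_snd (X := ℝ))
    have h2 : ∀ c : ℂ, Continuous fun p : ℝ × ℝ => circleMap c R p.2 := fun c =>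
      (continuous_circleMap c R).comp continuous_snd
    have h3 : Continuous fun p : ℝ × ℝ => ((p.1 : ℝ) : ℂ) := continuous_ofReal.comp continuous_fst
    exact ((h2 0).mul continuous_const).smul (h1.mul (Complex.continuous_exp.comp
      ((h3.mul (((h2 c).sub continuous_const).pow 2)).add (continuous_const.mul ((h2 c).sub continuous_const)))))
  exact (this.tendsto 0).mono_left nhdsWithin_le_nhds

lemma HeckeData.tendsto_circle (h : HeckeData K E q) (y : ℝ) {k : ℕ} {R : ℝ} (hR : 0 < R) (hR' : R < 1 / 4) :
    Tendsto (fun ε : ℝ => ∮ z in C(-k, R), mertensQuot K E q z * gaussW ε y z) (𝓝[>] 0)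
      (𝓝 (∮ z in C(-k, R), mertensQuot K E q z * gaussW 0 y z)) := by
  refine tendsto_circleIntegral_gaussW hR.le (fun z hz => ContinuousAt.continuousWithinAt ?_) y
  rw [mem_sphere_iff_norm, sub_neg_eq_add] at hz
  have h1 := (abs_le.1 ((Complex.abs_re_le_norm _).trans hz.le))
  simp only [add_re, natCast_re] at h1
  have hk : (0 : ℝ) ≤ k := k.cast_nonneg
  refine (h.differentiableAt_left (by linarith) (ne_neg_nat_of_strip (k := k) (by linarith) (by linarith)
    fun h0 => ?_)).continuousAt
  rw [h0, neg_add_cancel, norm_zero] at hz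
  exact hR.ne hz

lemma HeckeData.line_sub_line (h : HeckeData K E q) {y : ℝ} {k : ℕ} {r : ℂ}
    (hr : ∀ᶠ R in 𝓝[>] (0 : ℝ), (∮ z in C(-(k + 1 : ℕ), R), mertensQuot K E q z * gaussW 0 y z) =
      2 * Real.pi * I * r) :
    (∫ t : ℝ, mertensQuot K E q ((-k - 1 / 2 : ℝ) + t * I) * gaussW 0 y ((-k - 1 / 2 : ℝ) + t * I)) -
      ∫ t : ℝ, mertensQuot K E q ((-(k + 1 : ℕ) - 1 / 2 : ℝ) + t * I) *
        gaussW 0 y ((-(k + 1 : ℕ) - 1 / 2 : ℝ) + t * I) = 2 * Real.pi * r := by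
  obtain ⟨R, hR1, hR⟩ := (hr.and (Ioo_mem_nhdsGT (show (0 : ℝ) < 1 / 4 by norm_num))).exists
  obtain ⟨C, B, hC, hB, hb⟩ := h.exists_norm_le_line_inv
  have hk : (0 : ℝ) ≤ k := k.cast_nonneg
  have hbd : ∀ (j : ℕ) (t : ℝ), j = k ∨ j = k + 1 → ‖mertensQuot K E q ((-j - 1 / 2 : ℝ) + t * I)‖ ≤
      (C * (B ^ k / k.factorial) + C * (B ^ (k + 1) / (k + 1).factorial)) *
      Real.exp ((C * (B ^ k / k.factorial) + C * (B ^ (k + 1) / (k + 1).factorial)) * |t|) := fun j t hj => by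
    have h1 : 0 ≤ C * (B ^ k / k.factorial) := by positivity
    have h2 : 0 ≤ C * (B ^ (k + 1) / (k + 1).factorial) := by positivity
    refine (hb j t).trans ?_
    refine mul_le_mul ?_ ?_ (by positivity) (by positivity)
    · rcases hj with rfl | rfl <;> linarith
    · exact (inv_le_one_of_one_le₀ (by nlinarith)).trans (Real.one_le_exp (by positivity))
  refine tendsto_nhds_unique ((h.tendsto_integral_line y k).sub (h.tendsto_integral_line y (k + 1))) ?_
  have h1 := (h.tendsto_circle y (k := k + 1) hR.1 hR.2).const_mul (-I)
  rw [hR1, show -I * (2 * Real.pi * I * r) = -(I * I) * (2 * Real.pi * r) by ring, I_mul_I, neg_neg, one_mul] at h1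
  refine h1.congr' ?_
  filter_upwards [self_mem_nhdsWithin] with ε hε
  refine (h.integral_shift hε y (k := k + 1) hR.1 ?_ ?_ ?_ ?_ ?_ ?_ (fun t => hbd _ t (Or.inr rfl))
    (fun t => hbd _ t (Or.inl rfl))).symm <;> first | positivity | (push_cast; linarith [hR.2])

lemma HeckeData.tendsto_line_zero (h : HeckeData K E q) (y : ℝ) :
    Tendsto (fun k : ℕ => ∫ t : ℝ, mertensQuot K E q ((-k - 1 / 2 : ℝ) + t * I) *
      gaussW 0 y ((-k - 1 / 2 : ℝ) + t * I)) atTop (𝓝 0) := by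
  obtain ⟨C, B, hC, hB, hb⟩ := h.exists_norm_le_line_inv
  have hlim : Tendsto (fun k : ℕ => C * ((B * Real.exp (-y)) ^ k / k.factorial) * Real.exp (-y) *
      ∫ t : ℝ, (1 + t ^ 2)⁻¹) atTop (𝓝 0) := by
    have := (((FloorSemiring.tendsto_pow_div_factorial_atTop (B * Real.exp (-y))).const_mul C).mul_const
      (Real.exp (-y))).mul_const (∫ t : ℝ, (1 + t ^ 2)⁻¹)
    simpa using this
  refine squeeze_zero_norm (fun k => ?_) hlim
  rw [← integral_const_mul]
  refine norm_integral_le_of_norm_le (integrable_inv_one_add_sq.const_mul _) (.of_forall fun t => ?_)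
  rw [norm_mul, norm_gaussW]
  have he : Real.exp (0 * (((((-k - 1 / 2 : ℝ) : ℂ) + t * I).re - 1 / 2) ^ 2 -
      (((-k - 1 / 2 : ℝ) : ℂ) + t * I).im ^ 2) + y * ((((-k - 1 / 2 : ℝ) : ℂ) + t * I).re - 1 / 2)) =
      Real.exp (-y) ^ k * Real.exp (-y) := by
    rw [← Real.exp_nat_mul, ← Real.exp_add]
    congr 1
    simp
    ring
  rw [he, mul_pow]
  calc _ ≤ C * (B ^ k / k.factorial) * (1 + t ^ 2)⁻¹ * (Real.exp (-y) ^ k * Real.exp (-y)) := by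
        gcongr; exact hb k t
    _ = _ := by ring

lemma HeckeData.tendsto_integral_quarter (h : HeckeData K E q) {y : ℝ} {r : ℕ → ℂ}
    (hr : ∀ k : ℕ, ∀ᶠ R in 𝓝[>] (0 : ℝ), (∮ z in C(-k, R), mertensQuot K E q z * gaussW 0 y z) =
      2 * Real.pi * I * r k) (hsum : Summable r) :
    Tendsto (fun ε : ℝ => ∫ t : ℝ, mertensQuot K E q ((1 / 4 : ℝ) + t * I) * gaussW ε y ((1 / 4 : ℝ) + t * I))
      (𝓝[>] 0) (𝓝 (2 * Real.pi * ∑' k, r k)) := by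
  set J : ℕ → ℂ := fun k => ∫ t : ℝ, mertensQuot K E q ((-k - 1 / 2 : ℝ) + t * I) *
      gaussW 0 y ((-k - 1 / 2 : ℝ) + t * I) with hJ
  have hJ0 : J 0 = 2 * Real.pi * ∑' k, r (k + 1) := by
    have h1 : Tendsto (fun n => ∑ k ∈ Finset.range n, (J k - J (k + 1))) atTop (𝓝 (J 0)) := by
      simp only [Finset.sum_range_sub']
      have := (h.tendsto_line_zero y).const_sub (J 0)
      rwa [sub_zero] at this
    have h2 : ∀ k, J k - J (k + 1) = 2 * Real.pi * r (k + 1) := fun k => h.line_sub_line (hr (k + 1))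
    simp only [h2] at h1
    have h3 := (((summable_nat_add_iff 1).2 hsum).mul_left (2 * Real.pi : ℂ)).hasSum.tendsto_sum_nat
    rw [tsum_mul_left] at h3
    exact tendsto_nhds_unique h1 h3
  obtain ⟨R, hR1, hR⟩ := ((hr 0).and (Ioo_mem_nhdsGT (show (0 : ℝ) < 1 / 4 by norm_num))).exists
  obtain ⟨C, B, hC, hB, hb⟩ := h.exists_norm_le_line_inv
  obtain ⟨C', hC', hb'⟩ := h.exists_norm_le_left (1 / 4)
  have h1 := ((h.tendsto_circle y (k := 0) hR.1 hR.2).const_mul (-I)).add (h.tendsto_integral_line y 0)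
  have hlim : -I * (∮ z in C(-(0 : ℕ), R), mertensQuot K E q z * gaussW 0 y z) + J 0 = 2 * Real.pi * ∑' k, r k := by
    rw [hR1, show -I * (2 * Real.pi * I * r 0) = -(I * I) * (2 * Real.pi * r 0) by ring, I_mul_I, neg_neg, one_mul,
      hJ0, hsum.tsum_eq_zero_add, mul_add]
  rw [← hlim]
  refine h1.congr' ?_
  filter_upwards [self_mem_nhdsWithin] with ε hε
  rw [eq_comm, ← sub_eq_iff_eq_add]
  refine (h.integral_shift hε y (k := 0) (b := 1 / 4) (C := C + 5 * C') hR.1 ?_ ?_ ?_ ?_ ?_ ?_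
    (fun t => ?left) (fun t => ?right))
  case left =>
    have := hb 0 t
    refine this.trans ?_
    simp only [pow_zero, Nat.factorial_zero, Nat.cast_one, div_one, mul_one]
    refine mul_le_mul (by linarith) ?_ (by positivity) (by positivity)
    exact (inv_le_one_of_one_le₀ (by nlinarith)).trans (Real.one_le_exp (by positivity))
  case right =>
    have hre : (((1 / 4 : ℝ) : ℂ) + t * I).re = 1 / 4 := by simp
    have him : (((1 / 4 : ℝ) : ℂ) + t * I).im = t := by simp
    refine (hb' _ hre.ge (by rw [hre]; norm_num) (Or.inl hre.ge)).trans ?_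
    rw [hre, him]
    have : Real.exp (C' * |t|) ≤ Real.exp ((C + 5 * C') * |t|) := by gcongr; linarith
    calc _ = 5 * C' * Real.exp (C' * |t|) := by ring
      _ ≤ _ := mul_le_mul (by linarith) this (by positivity) (by positivity)
  all_goals first | positivity | (norm_num; linarith [hR.2]) | norm_num

end ResidueSum

section Recurrence

lemma exists_recurrence {ι : Type*} (γ : ι → ℝ) {U : Set (ι → Circle)} (hU : U ∈ 𝓝 1) (N : ℕ) :
    ∃ n, N ≤ n ∧ (fun i => Circle.exp (γ i)) ^ n ∈ U := by
  set g : ι → Circle := fun i => Circle.exp (γ i)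
  obtain ⟨p, -, hp⟩ := isCompact_univ.exists_mapClusterPt (f := atTop) (u := fun n : ℕ => g ^ n)
    (by simp)
  have hdiv : Tendsto (fun z : (ι → Circle) × (ι → Circle) => z.1 / z.2) (𝓝 p ×ˢ 𝓝 p) (𝓝 1) := by
    have : Continuous fun z : (ι → Circle) × (ι → Circle) => z.1 / z.2 := by fun_prop
    simpa [nhds_prod_eq] using this.tendsto (p, p)
  obtain ⟨V, hV, hVU⟩ := mem_prod_same_iff.1 (hdiv hU)
  have hfreq := hp.frequently hV
  obtain ⟨n, -, hn⟩ := frequently_atTop.1 hfreq 0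
  obtain ⟨m, hm, hm'⟩ := frequently_atTop.1 hfreq (n + N)
  refine ⟨m - n, by omega, ?_⟩
  have := hVU (Set.mk_mem_prod hm' hn)
  rwa [Set.mem_preimage, div_eq_mul_inv, ← pow_sub g (by omega)] at this

lemma exists_almost_period {ι : Type*} {a : ι → ℂ} (γ : ι → ℝ) (ha : Summable fun i => ‖a i‖) {δ : ℝ} (hδ : 0 < δ)
    (N : ℕ) : ∃ n : ℕ, N ≤ n ∧ ‖(∑' i, a i * cexp (n * (γ i * I))) - ∑' i, a i‖ < δ := by
  have hc : Continuous fun z : ι → Circle => ∑' i, a i * (z i : ℂ) :=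
    continuous_tsum (fun i => by fun_prop) ha fun i z => by rw [norm_mul, Circle.norm_coe, mul_one]
  have hU : {z : ι → Circle | ‖(∑' i, a i * (z i : ℂ)) - ∑' i, a i‖ < δ} ∈ 𝓝 1 :=
    (isOpen_lt (by fun_prop) continuous_const).mem_nhds (by simpa)
  obtain ⟨n, hn, hn'⟩ := exists_recurrence γ hU N
  refine ⟨n, hn, ?_⟩
  simpa [Complex.exp_nat_mul] using hn'

variable {K : Type} [Field K] [NumberField K] {E : ℂ → ℂ} {q : ℝ}

lemma HeckeData.re_tsum_le (h : HeckeData K E q) {σ L B : ℝ} (hσ : σ = 1 ∨ σ = -1)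
    (hp : ∀ u, σ * mertensLog K u ≤ L + B * Real.exp (-u)) {ε : ℝ} (hε : 0 < ε) (y : ℝ) :
    σ * (∑' ρ : {ρ : ℂ // E ρ = 0}, zeroCoeff K E q ρ * gaussW ε y ρ).re ≤ L := by
  set A : ℝ → ℂ := fun y => ∑' ρ : {ρ : ℂ // E ρ = 0}, zeroCoeff K E q ρ * gaussW ε y ρ with hA
  have hpi := Real.pi_pos
  have hσ1 : |σ| = 1 := by rcases hσ with rfl | rfl <;> simp
  set D : ℝ := ∫ t : ℝ, ‖mertensQuot K E q ((1 / 4 : ℝ) + t * I) * gaussW ε 0 ((1 / 4 : ℝ) + t * I)‖ with hD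
  have hbound : ∀ Y, σ * (A Y).re ≤ L + B * Real.exp ε * Real.exp (-Y) +
      D / (2 * Real.pi) * Real.exp (-Y / 4) := fun Y => by
    set J := ∫ t : ℝ, mertensQuot K E q ((1 / 4 : ℝ) + t * I) * gaussW ε Y ((1 / 4 : ℝ) + t * I) with hJ
    have h1 := h.integral_sub_integral hε Y
    rw [h.integral_eq_mertensAvg hε Y] at h1
    have h2 := congrArg Complex.re h1
    have h3 : (2 * Real.pi * mertensAvg K ε Y : ℂ).re = 2 * Real.pi * mertensAvg K ε Y := by
      rw [← ofReal_re (2 * Real.pi * mertensAvg K ε Y)]; push_cast; rfl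
    have h4 : (2 * Real.pi * A Y : ℂ).re = 2 * Real.pi * (A Y).re := by
      rw [show (2 * Real.pi : ℂ) = ((2 * Real.pi : ℝ) : ℂ) by push_cast; rfl, re_ofReal_mul]
    rw [sub_re, h3, h4, ← hJ] at h2
    have hJle : ‖J‖ ≤ D * Real.exp (-Y / 4) := by
      rw [hD, ← integral_mul_const]
      refine (norm_integral_le_integral_norm _).trans (le_of_eq (integral_congr_ae (.of_forall fun t => ?_)))
      dsimp only
      rw [show gaussW ε Y ((1 / 4 : ℝ) + t * I) = gaussW ε 0 ((1 / 4 : ℝ) + t * I) *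
        gaussW 0 Y ((1 / 4 : ℝ) + t * I) by rw [gaussW_mul]; simp, ← mul_assoc, norm_mul _ (gaussW 0 Y _),
        norm_gaussW 0 Y]
      congr 2
      simp
      ring
    have h5 : -(σ * J.re) ≤ D * Real.exp (-Y / 4) := by
      refine (neg_le_abs _).trans ?_
      rw [abs_mul, hσ1, one_mul]
      exact (Complex.abs_re_le_norm J).trans hJle
    have h6 := mul_mertensAvg_le hp hε Y
    rw [Real.exp_add] at h6
    have h7 : (A Y).re = mertensAvg K ε Y - J.re / (2 * Real.pi) := by
      field_simp
      linarith
    have h8 : -(σ * J.re) / (2 * Real.pi) ≤ D * Real.exp (-Y / 4) / (2 * Real.pi) := by gcongr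
    rw [h7]
    calc _ = σ * mertensAvg K ε Y + -(σ * J.re) / (2 * Real.pi) := by ring
      _ ≤ L + B * (Real.exp (-Y) * Real.exp ε) + D * Real.exp (-Y / 4) / (2 * Real.pi) := add_le_add h6 h8
      _ = _ := by ring
  have hlim : Tendsto (fun n : ℕ => L + B * Real.exp ε * Real.exp (-(y + n)) +
      D / (2 * Real.pi) * Real.exp (-(y + n) / 4)) atTop (𝓝 L) := by
    have h0 : Tendsto (fun n : ℕ => y + n) atTop atTop :=
      tendsto_atTop_add_const_left _ _ tendsto_natCast_atTop_atTop
    have h1 := (Real.tendsto_exp_neg_atTop_nhds_zero.comp h0).const_mul (B * Real.exp ε)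
    have h2 := (Real.tendsto_exp_neg_atTop_nhds_zero.comp (h0.atTop_div_const (show (0 : ℝ) < 4 by norm_num))).const_mul
      (D / (2 * Real.pi))
    simp only [Function.comp_def, ← neg_div, mul_zero] at h1 h2
    simpa only [add_zero] using (h1.const_add L).add h2
  refine le_of_forall_pos_le_add fun δ hδ => ?_
  obtain ⟨N, hN⟩ := eventually_atTop.1 (hlim.eventually_le_const (show L < L + δ / 2 by linarith))
  obtain ⟨n, hn, hclose⟩ := exists_almost_period (fun ρ : {ρ : ℂ // E ρ = 0} => ρ.1.im) (h.summable_zeroCoeff hε y)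
    (half_pos hδ) N
  have hAn : A (y + n) = ∑' ρ : {ρ : ℂ // E ρ = 0},
      zeroCoeff K E q ρ * gaussW ε y ρ * cexp (n * (ρ.1.im * I)) := by
    refine tsum_congr fun ρ => ?_
    have hρ : ρ.1 - 1 / 2 = ρ.1.im * I := by
      apply Complex.ext <;> simp [h.re_of_zero _ ρ.2]
    rw [mul_assoc]
    congr 1
    rw [gaussW, gaussW, ← Complex.exp_add, hρ]
    congr 1
    push_cast
    ring
  rw [← hAn] at hclose
  have h1 : σ * (A y).re - σ * (A (y + n)).re ≤ δ / 2 := by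
    rw [← mul_sub, ← sub_re]
    refine (le_abs_self _).trans ?_
    rw [abs_mul, hσ1, one_mul]
    refine (Complex.abs_re_le_norm _).trans ?_
    rw [norm_sub_rev]
    exact hclose.le
  linarith [hbound (y + n), hN n hn]

lemma HeckeData.mertensLog_sub_le (h : HeckeData K E q) {σ L B : ℝ} (hσ : σ = 1 ∨ σ = -1)
    (hp : ∀ u, σ * mertensLog K u ≤ L + B * Real.exp (-u)) {y : ℝ} {r : ℕ → ℂ}
    (hr : ∀ k : ℕ, ∀ᶠ R in 𝓝[>] (0 : ℝ), (∮ z in C(-k, R), mertensQuot K E q z * gaussW 0 y z) =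
      2 * Real.pi * I * r k) (hsum : Summable r) :
    σ * (mertensLog K y - (∑' k, r k).re) ≤ L := by
  have hpi : (2 * Real.pi : ℂ) ≠ 0 := by simp [Real.pi_ne_zero]
  have h1 := ((continuous_re.tendsto _).comp ((h.tendsto_integral_quarter hr hsum).div_const (2 * Real.pi : ℂ)))
  rw [mul_div_cancel_left₀ _ hpi] at h1
  refine le_of_tendsto (((tendsto_mertensAvg y).sub h1).const_mul σ) ?_
  filter_upwards [self_mem_nhdsWithin] with ε hε
  have hle := h.re_tsum_le hσ hp hε y
  have h2 := h.integral_sub_integral hε y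
  rw [h.integral_eq_mertensAvg hε y] at h2
  have h3 : (mertensAvg K ε y : ℂ) - (∫ t : ℝ, mertensQuot K E q ((1 / 4 : ℝ) + t * I) *
      gaussW ε y ((1 / 4 : ℝ) + t * I)) / (2 * Real.pi) =
      ∑' ρ : {ρ : ℂ // E ρ = 0}, zeroCoeff K E q ρ * gaussW ε y ρ := by
    rw [eq_div_of_mul_eq hpi ((mul_comm _ _).trans h2.symm), sub_div, mul_div_cancel_left₀ _ hpi]
  rwa [← h3, sub_re, ofReal_re] at hle

lemma exists_forall_mul_mertensLog_le {σ L : ℝ} (hσ : σ = 1 ∨ σ = -1)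
    (h : ∀ᶠ u in atTop, σ * mertensLog K u ≤ L) :
    ∃ B, 0 ≤ B ∧ ∀ u, σ * mertensLog K u ≤ L + B * Real.exp (-u) := by
  obtain ⟨u0, hu0⟩ := eventually_atTop.1 h
  obtain ⟨B, hB, hb⟩ := exists_abs_mertensLog_le K
  have hσ1 : |σ| = 1 := by rcases hσ with rfl | rfl <;> simp
  refine ⟨(|L| + B * Real.exp u0) * Real.exp u0, by positivity, fun u => ?_⟩
  rcases le_total u0 u with hu | hu
  · exact (hu0 u hu).trans (le_add_of_nonneg_right (by positivity))
  · have h1 : σ * mertensLog K u ≤ B * Real.exp u := by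
      refine (le_abs_self _).trans ?_
      rw [abs_mul, hσ1, one_mul]
      exact hb u
    have h2 : B * Real.exp u ≤ B * Real.exp u0 := by gcongr
    have h3 : 1 ≤ Real.exp u0 * Real.exp (-u) := by
      rw [← Real.exp_add]; exact Real.one_le_exp (by linarith)
    have h4 : 0 ≤ |L| + B * Real.exp u0 := by positivity
    rw [mul_assoc]
    linarith [mul_le_mul_of_nonneg_left h3 h4, neg_abs_le L]

lemma circleIntegral_mertensQuot {Z : ℂ → ℂ} (hF : ∀ s : ℂ, s ≠ 0 → s ≠ 1 → 1 / (s * Z s) = mertensQuot K E q s)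
    {x : ℝ} (hx : 0 < x) {k : ℕ} {r : ℂ} (hr : IsResidue (fun s => (x : ℂ) ^ s / (s * Z s)) (-(k : ℂ)) r) :
    ∀ᶠ R in 𝓝[>] (0 : ℝ), (∮ z in C(-k, R), mertensQuot K E q z * gaussW 0 (Real.log x) z) =
      2 * Real.pi * I * (r / √x) := by
  filter_upwards [hr, Ioo_mem_nhdsGT (zero_lt_one (α := ℝ))] with R hR hR1
  have hx0 : (x : ℂ) ≠ 0 := ofReal_ne_zero.2 hx.ne'
  rw [← mul_div_assoc, ← hR, div_eq_inv_mul, ← circleIntegral.integral_const_mul]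
  refine circleIntegral.integral_congr hR1.1.le fun z hz => ?_
  rw [mem_sphere_iff_norm, sub_neg_eq_add] at hz
  have hne : ∀ n : ℕ, z + k ≠ n := fun n h0 => by
    rw [h0, Complex.norm_natCast] at hz
    have h1 := hR1.1
    have h2 := hR1.2
    rw [← hz] at h1 h2
    have h3 : 0 < n := by exact_mod_cast h1
    have h4 : n < 1 := by exact_mod_cast h2
    omega
  have hz0 : z ≠ 0 := fun h0 => hne k (by rw [h0, zero_add])
  have hz1 : z ≠ 1 := fun h0 => hne (k + 1) (by rw [h0]; push_cast; ring)
  have hsqrt : √x = Real.exp (Real.log x / 2) := by rw [Real.exp_half, Real.exp_log hx]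
  rw [← hF z hz0 hz1, gaussW, Complex.cpow_def_of_ne_zero hx0, hsqrt, ofReal_exp, ← Complex.exp_neg,
    ← ofReal_log hx.le, div_eq_mul_one_div (cexp _), mul_left_comm, ← mul_assoc, ← Complex.exp_add, mul_comm (1 / _)]
  congr 2
  push_cast
  ring

end Recurrence

/-- **Proposition 3.4.** Assume the Riemann hypothesis for `ζ_K`, that all nontrivial
zeros of `ζ_K` are simple, and that `1/|ρ ζ_K'(ρ)| ≤ C` uniformly over the nontrivial
zeros. With `M_K^*(x) = -∑_{k≥0} res_{s=-k} x^s/(s ζ_K(s))`, for every `x > 0` the value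
`(M_K(x) + M_K^*(x))/x^{1/2}` is a limit point of `t ↦ M_K(t)/t^{1/2}` as `t → ∞`. -/
theorem mstar_limit_point
    (K : Type) [Field K] [NumberField K]
    (Z : ℂ → ℂ) (hZ : IsDedekindZeta K Z) (hRH : ZetaRH Z)
    (hsimple : ∀ ρ : ℂ, Z ρ = 0 → 0 < ρ.re → ρ.re < 1 → deriv Z ρ ≠ 0)
    (C : ℝ) (hC : 0 < C)
    (hbound : ∀ ρ : ℂ, Z ρ = 0 → 0 < ρ.re → ρ.re < 1 → 1 / ‖ρ * deriv Z ρ‖ ≤ C)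
    (x : ℝ) (hx : 0 < x)
    (r : ℕ → ℂ)
    (hr : ∀ k : ℕ, IsResidue (fun s => (x : ℂ) ^ s / (s * Z s)) (-(k : ℂ)) (r k))
    (hsum : Summable r)
    (mstar : ℝ) (hmstar : (mstar : ℂ) = -∑' k : ℕ, r k) :
    ∃ t : ℕ → ℝ, Tendsto t atTop atTop ∧
      Tendsto (fun j : ℕ => mertensK K (t j) / Real.sqrt (t j)) atTop
        (𝓝 ((mertensK K x + mstar) / Real.sqrt x)) := by
  by_contra hcon
  obtain ⟨σ, δ, hσ, hδ, hev⟩ := one_sided_of_not_limit hcon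
  obtain ⟨B, hB, hp⟩ := exists_forall_mul_mertensLog_le hσ hev
  obtain ⟨E, q, h, hF⟩ := heckeData_of_one_sided hZ hRH hsimple hσ hB fun u _ => hp u
  have hle := h.mertensLog_sub_le hσ hp (fun k => circleIntegral_mertensQuot hF hx (hr k))
    (hsum.div_const (√x : ℂ))
  have hre : (∑' k, r k / (√x : ℂ)).re = -mstar / √x := by
    rw [tsum_div_const, ← neg_eq_iff_eq_neg.2 hmstar, ← ofReal_neg, ← ofReal_div, ofReal_re]
  rw [hre, mertensLog_log hx, neg_div, sub_neg_eq_add, ← add_div] at hle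
  linarith
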